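/- Fix integers d ≥ 2 and N ≥ 1. The infimum of d^{N−2}·‖Tr_n Ω‖, taken over all Hermitian d^{N+1} × d^{N+1} complex matrices Ω such that Ω − σ_a is positive semidefinite for every a ∈ {1,…,N}, equals (1/d²)·λ_max(M_F^d(N)), where λ_max(M_F^d(N)) is the largest eigenvalue of the Teleportation Matrix restricted to partitions of N with at most d parts, Tr_n denotes the partial trace over the last ((N+1)-th) tensor factor, and ‖·‖ is the operator (spectral) norm. -/

import Mathlib

/-- `AddBox α μ` means that the Young diagram `μ` is obtained from the Young diagram `α`
by adding a single box; equivalently, `α` is obtained from `μ` by removing a box: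
the diagram of `α` is contained in the diagram of `μ` and `μ` has exactly one more cell. -/
def AddBox (α μ : YoungDiagram) : Prop :=
  α ≤ μ ∧ μ.card = α.card + 1

/-- `MoveBox μ ν` (written `μ/ν = □` in the paper): `μ ≠ ν` and some Young diagram can be
obtained from both `μ` and `ν` by removing a single box, i.e. `μ` is obtained from `ν`
by moving a single box. -/
def MoveBox (μ ν : YoungDiagram) : Prop :=
  μ ≠ ν ∧ ∃ α : YoungDiagram, AddBox α μ ∧ AddBox α ν

/-- `nBox μ` is the number `n_μ` of Young diagrams obtained from `μ` by removing a box. -/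
noncomputable def nBox (μ : YoungDiagram) : ℕ :=
  Nat.card {α : YoungDiagram // AddBox α μ}

/-- Partitions of `N` with at most `d` parts, identified with Young diagrams with `N` boxes
whose first column has height at most `d`. -/
abbrev PartLE (N d : ℕ) : Type :=
  {μ : YoungDiagram // μ.card = N ∧ μ.colLen 0 ≤ d}

instance : DecidableEq YoungDiagram := fun μ ν =>
  decidable_of_iff (μ.cells = ν.cells) (YoungDiagram.ext_iff).symm

theorem cell_lt_card {μ : YoungDiagram} {i j : ℕ} (h : (i, j) ∈ μ.cells) :
    i < μ.card ∧ j < μ.card := by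
  rw [YoungDiagram.mem_cells] at h
  constructor
  · have hsub : Finset.range (i + 1) ×ˢ ({j} : Finset ℕ) ⊆ μ.cells := by
      rintro ⟨a, b⟩ hab
      rw [Finset.mem_product, Finset.mem_range, Finset.mem_singleton] at hab
      rw [YoungDiagram.mem_cells]
      obtain ⟨h1, h2⟩ := hab
      subst h2
      exact μ.up_left_mem (Nat.lt_succ_iff.mp h1) le_rfl h
    have := Finset.card_le_card hsub
    simpa [YoungDiagram.card] using this
  · have hsub : ({i} : Finset ℕ) ×ˢ Finset.range (j + 1) ⊆ μ.cells := by
      rintro ⟨a, b⟩ hab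
      rw [Finset.mem_product, Finset.mem_range, Finset.mem_singleton] at hab
      rw [YoungDiagram.mem_cells]
      obtain ⟨h1, h2⟩ := hab
      subst h1
      exact μ.up_left_mem le_rfl (Nat.lt_succ_iff.mp h2) h
    have := Finset.card_le_card hsub
    simpa [YoungDiagram.card] using this

noncomputable instance (N d : ℕ) : Fintype (PartLE N d) := by
  apply Fintype.ofInjective
    (β := {s : Finset (ℕ × ℕ) // s ∈ (Finset.range N ×ˢ Finset.range N).powerset})
    (f := fun μ => ⟨μ.1.cells, by
      rw [Finset.mem_powerset]
      rintro ⟨i, j⟩ hc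
      have h := cell_lt_card hc
      rw [μ.2.1] at h
      simp only [Finset.mem_product, Finset.mem_range]
      exact h⟩)
  rintro ⟨μ, hμ⟩ ⟨ν, hν⟩ h
  simp only [Subtype.mk.injEq] at h ⊢
  exact YoungDiagram.ext h

open scoped Classical in
/-- The Teleportation Matrix `M_F^d(N)`, indexed by the partitions of `N` with at most
`d` parts: the diagonal entry at `μ` is `n_μ`, the off-diagonal entry at `(μ, ν)` is `1`
if `μ/ν = □` and `0` otherwise.  For `d ≥ N` this is the full matrix `M_F(N)`. -/
noncomputable def MF (N d : ℕ) : Matrix (PartLE N d) (PartLE N d) ℝ :=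
  fun μ ν => if μ = ν then (nBox μ.1 : ℝ) else if MoveBox μ.1 ν.1 then 1 else 0

open scoped ComplexOrder

/-- The operator `σ_a` of the deterministic port-based teleportation protocol, acting on
`(ℂ^d)^{⊗(N+1)}`: its `(f, g)` entry is `d^{-N}` if `f(a) = f(n)`, `g(a) = g(n)` and
`f(i) = g(i)` for all `i ∉ {a, n}` (where `n = N + 1` is the last tensor factor), and `0`
otherwise; i.e. `σ_a = d^{-N} · 1 ⊗ P̃⁺_{a,n}`. -/
noncomputable def sigmaPBT (d N : ℕ) (a : Fin N) :
    Matrix (Fin (N + 1) → Fin d) (Fin (N + 1) → Fin d) ℂ := fun f g =>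
  if f a.castSucc = f (Fin.last N) ∧ g a.castSucc = g (Fin.last N) ∧
      ∀ i : Fin (N + 1), i ≠ a.castSucc → i ≠ Fin.last N → f i = g i
    then ((d : ℂ) ^ N)⁻¹ else 0

/-- The partial trace over the last (`(N+1)`-th) tensor factor:
`(Tr_n Ω)_{f',g'} = ∑_{j} Ω_{(f',j),(g',j)}`. -/
noncomputable def ptraceLast (d N : ℕ)
    (Ω : Matrix (Fin (N + 1) → Fin d) (Fin (N + 1) → Fin d) ℂ) :
    Matrix (Fin N → Fin d) (Fin N → Fin d) ℂ := fun f g =>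
  ∑ j : Fin d, Ω (Fin.snoc f j) (Fin.snoc g j)


section PartA
open Finset Polynomial
namespace PBT
variable {d : ℕ}

/-- shape of a word -/
def sh (w : List (Fin d)) (i : Fin d) : ℕ := w.count i

/-- lattice words -/
def Valid : List (Fin d) → Prop
  | [] => True
  | i :: w => Valid w ∧ Antitone (sh (i :: w))

noncomputable def cont (w : List (Fin d)) (i : Fin d) : ℝ := (sh w i : ℝ) - (i : ℕ)

noncomputable def wt (a : Fin d → ℝ) (i : Fin d) : ℝ :=
  ∏ j ∈ univ.erase i, (a i - a j + 1) / (a i - a j)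

noncomputable def mom (a : Fin d → ℝ) (p : ℝ[X]) : ℝ := ∑ i, wt a i * p.eval (a i)

theorem sh_cons (i : Fin d) (w : List (Fin d)) (j : Fin d) :
    sh (i :: w) j = sh w j + if i = j then 1 else 0 := by
  simp [sh, List.count_cons]

theorem Valid.antitone {w : List (Fin d)} (h : Valid w) : Antitone (sh w) := by
  cases w with
  | nil => intro i j _; simp [sh]
  | cons i w => exact h.2

theorem cont_strictAnti {w : List (Fin d)} (h : Antitone (sh w)) : StrictAnti (cont w) := by
  intro i j hij
  have h1 : (sh w j : ℝ) ≤ sh w i := by exact_mod_cast h hij.le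
  have h2 : ((i : ℕ) : ℝ) < (j : ℕ) := by exact_mod_cast hij
  simp only [cont]; linarith

theorem cont_int (w : List (Fin d)) (i : Fin d) : cont w i = (((sh w i : ℤ) - (i : ℕ) : ℤ) : ℝ) := by
  simp [cont]

theorem cont_cons (i : Fin d) (w : List (Fin d)) (j : Fin d) :
    cont (i :: w) j = cont w j + if i = j then 1 else 0 := by
  simp only [cont, sh_cons]; push_cast; split_ifs <;> ring

theorem lt_of_adm {i : Fin d} {w : List (Fin d)} (h : Antitone (sh (i :: w))) {j : Fin d}
    (hj : j < i) : sh w i + 1 ≤ sh w j := by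
  have := h hj.le
  simp only [sh_cons] at this
  simpa [hj.ne'] using this

theorem adm_of_lt {i : Fin d} {w : List (Fin d)} (hw : Antitone (sh w))
    (h : ∀ j < i, sh w i + 1 ≤ sh w j) : Antitone (sh (i :: w)) := by
  intro a b hab
  simp only [sh_cons]
  by_cases hb : i = b
  · subst hb
    rcases hab.lt_or_eq with h1 | h1
    · have := h a h1
      simp; omega
    · subst h1; simp
  · have := hw hab
    simp [hb]; omega

theorem wt_pos {i : Fin d} {w : List (Fin d)} (hw : Antitone (sh w))
    (h : Antitone (sh (i :: w))) : 0 < wt (cont w) i := by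
  apply Finset.prod_pos
  intro j hj
  have hne : j ≠ i := by simpa using hj
  rcases lt_or_gt_of_ne hne with h1 | h1
  · apply div_pos_of_neg_of_neg
    · have h2 := lt_of_adm h h1
      have h2' : (sh w i : ℝ) + 1 ≤ sh w j := by exact_mod_cast h2
      have h3 : ((j : ℕ) : ℝ) < (i : ℕ) := by exact_mod_cast h1
      simp only [cont]; linarith
    · have := cont_strictAnti hw h1; linarith
  · have := cont_strictAnti hw h1
    apply div_pos <;> linarith

theorem wt_zero {i : Fin d} {w : List (Fin d)} (hw : Antitone (sh w))
    (h : ¬ Antitone (sh (i :: w))) : wt (cont w) i = 0 := by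
  have : ∃ j < i, ¬ (sh w i + 1 ≤ sh w j) := by
    by_contra hc
    push Not at hc
    exact h (adm_of_lt hw (fun j hj => hc j hj))
  obtain ⟨j, hj, hlt⟩ := this
  -- take predecessor
  have hi : 0 < (i : ℕ) := lt_of_le_of_lt (Nat.zero_le _) hj
  let k : Fin d := ⟨(i : ℕ) - 1, by omega⟩
  have hki : k < i := by show (i : ℕ) - 1 < i; omega
  have hjk : j ≤ k := by
    have : (j : ℕ) < i := hj
    show (j : ℕ) ≤ (i : ℕ) - 1
    omega
  have h1 := hw hjk
  have h2 := hw hki.le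
  have h3 : sh w k = sh w i := by omega
  apply Finset.prod_eq_zero (i := k) (by simp [hki.ne])
  have h4 : ((k : ℕ) : ℝ) = (i : ℕ) - 1 := by
    have : (k : ℕ) + 1 = i := by show (i : ℕ) - 1 + 1 = i; omega
    rw [← this]; push_cast; ring
  have : cont w i - cont w k + 1 = 0 := by
    simp only [cont, h3, h4]; ring
  rw [this, zero_div]

/-- the basic Lagrange identity -/
theorem lag_identity {a : Fin d → ℝ} (ha : Function.Injective a) (u : ℝ) :
    ∏ j, (u - a j + 1) = ∏ j, (u - a j) + ∑ i, wt a i * ∏ j ∈ univ.erase i, (u - a j) := by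
  classical
  let p : ℝ[X] := ∏ j, (X - C (a j) + 1)
  let q : ℝ[X] := ∏ j, (X - C (a j))
  let r : ℝ[X] := ∑ i, C (wt a i) * ∏ j ∈ univ.erase i, (X - C (a j))
  have hp : p.Monic := monic_prod_of_monic _ _ (fun j _ => by
    have : (X - C (a j) + 1 : ℝ[X]) = X - C (a j - 1) := by simp; ring
    rw [this]; exact monic_X_sub_C _)
  have hq : q.Monic := monic_prod_of_monic _ _ (fun j _ => monic_X_sub_C _)
  have hpd : p.degree = d := by
    have : p = ∏ j, (X - C (a j - 1)) := by
      apply Finset.prod_congr rfl; intro j _; simp; ring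
    rw [this, degree_prod]; simp only [degree_X_sub_C]; simp
  have hqd : q.degree = d := by
    show (∏ j, (X - C (a j)) : ℝ[X]).degree = d
    rw [degree_prod]; simp
  have h1 : (p - q).degree < (univ : Finset (Fin d)).card := by
    have := degree_sub_lt_left (hpd.trans hqd.symm) hp.ne_zero (by rw [hp.leadingCoeff, hq.leadingCoeff])
    simpa [hpd] using this
  have h2 : r.degree < (univ : Finset (Fin d)).card := by
    apply lt_of_le_of_lt (degree_sum_le _ _)
    rw [Finset.sup_lt_iff (by exact WithBot.bot_lt_coe _)]
    intro i _
    apply lt_of_le_of_lt (degree_mul_le _ _)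
    apply lt_of_le_of_lt (add_le_add_left degree_C_le _)
    rw [degree_prod]
    have : 0 < d := i.pos
    simp [Finset.card_erase_of_mem]
    exact this
  have h3 : p - q = r := by
    apply Polynomial.eq_of_degrees_lt_of_eval_index_eq (s := univ) (v := a) ha.injOn h1 h2
    intro i _
    simp only [p, q, r, eval_sub, eval_prod, eval_add, eval_X, eval_C, eval_one, eval_finsetSum,
      eval_mul]
    rw [Finset.prod_eq_zero (f := fun j => a i - a j) (mem_univ i) (by simp), sub_zero]
    rw [Finset.sum_eq_single i]
    · rw [← Finset.mul_prod_erase _ _ (mem_univ i)]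
      simp only [sub_self, zero_add, one_mul, wt]
      rw [← Finset.prod_mul_distrib]
      apply Finset.prod_congr rfl
      intro j hj
      have : a i - a j ≠ 0 := by
        intro h
        have : a i = a j := by linarith
        have := ha this
        simp [this] at hj
      field_simp
    · intro b _ hb
      rw [Finset.prod_eq_zero (i := i) (by simp [hb.symm]) (by simp)]; simp
    · simp
  have := congrArg (eval u) h3
  simp only [p, q, r, eval_sub, eval_prod, eval_add, eval_X, eval_C, eval_one, eval_finsetSum,
      eval_mul] at this
  linarith

theorem coeff_prod_one_add {ι : Type*} [DecidableEq ι] (s : Finset ι) (b : ι → ℝ) :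
    (∏ i ∈ s, (1 + C (b i) * X : ℝ[X])).coeff 0 = 1 ∧
    (∏ i ∈ s, (1 + C (b i) * X : ℝ[X])).coeff 1 = ∑ i ∈ s, b i ∧
    2 * (∏ i ∈ s, (1 + C (b i) * X : ℝ[X])).coeff 2 = (∑ i ∈ s, b i) ^ 2 - ∑ i ∈ s, b i ^ 2 := by
  induction s using Finset.induction_on with
  | empty => simp [coeff_one]
  | insert x s hx ih =>
    obtain ⟨h0, h1, h2⟩ := ih
    rw [Finset.prod_insert hx, Finset.sum_insert hx, Finset.sum_insert hx]
    have e : ∀ (q : ℝ[X]), (1 + C (b x) * X) * q = q + C (b x) * (X * q) := by intro q; ring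
    rw [e]
    refine ⟨?_, ?_, ?_⟩
    · simp [h0]
    · simp only [coeff_add, coeff_C_mul, coeff_X_mul, h0, h1]; ring
    · simp only [coeff_add, coeff_C_mul, coeff_X_mul, h1, mul_add, h2]; ring

theorem lag_rev {a : Fin d → ℝ} (ha : Function.Injective a) :
    (∏ j, (1 + C (1 - a j) * X) : ℝ[X]) = ∏ j, (1 + C (- a j) * X) +
      ∑ i, C (wt a i) * (X * ∏ j ∈ univ.erase i, (1 + C (- a j) * X)) := by
  apply Polynomial.eq_of_infinite_eval_eq
  apply Set.Infinite.mono (s := Set.Ioi 0) _ (Set.Ioi_infinite 0)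
  intro t ht
  have ht0 : t ≠ 0 := (ne_of_gt ht)
  have := lag_identity ha t⁻¹
  have h2 := congrArg (fun z => t ^ d * z) this
  have key : ∀ (s : Finset (Fin d)) (b : Fin d → ℝ),
      ∏ j ∈ s, (1 + b j * t) = t ^ s.card * ∏ j ∈ s, (t⁻¹ + b j) := by
    intro s b
    rw [← Finset.prod_const, ← Finset.prod_mul_distrib]
    apply Finset.prod_congr rfl; intro j _; field_simp
  simp only [Set.mem_ofPred_eq, eval_prod, eval_add, eval_one, eval_mul, eval_C, eval_X,
    eval_finsetSum]
  rw [key, key]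
  simp only [key]
  simp only [Finset.card_univ, Fintype.card_fin, Finset.card_erase_of_mem (mem_univ _)]
  have e1 : ∏ j, (t⁻¹ - a j + 1) = ∏ j, (t⁻¹ + (1 - a j)) :=
    Finset.prod_congr rfl (fun j _ => by ring)
  rw [← e1, this, mul_add, Finset.mul_sum]
  congr 1
  apply Finset.sum_congr rfl
  intro i _
  have hd : 0 < d := i.pos
  have : t ^ d = t * t ^ (d - 1) := by rw [← pow_succ']; congr 1; omega
  rw [this]; simp only [← sub_eq_add_neg]; ring

theorem mom_one {a : Fin d → ℝ} (ha : Function.Injective a) : ∑ i, wt a i = d := by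
  have := congrArg (fun p => coeff p 1) (lag_rev ha)
  simp only [coeff_add, finsetSum_coeff, coeff_C_mul, coeff_X_mul] at this
  rw [(coeff_prod_one_add _ _).2.1, (coeff_prod_one_add _ _).2.1] at this
  simp only [(coeff_prod_one_add _ _).1] at this
  simp at this
  linarith

theorem mom_X {a : Fin d → ℝ} (ha : Function.Injective a) :
    ∑ i, wt a i * a i = ∑ i, a i + d * (d - 1) / 2 := by
  have h1 := mom_one ha
  have := congrArg (fun p => 2 * coeff p 2) (lag_rev ha)
  simp only [coeff_add, finsetSum_coeff, coeff_C_mul, coeff_X_mul, mul_add] at this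
  rw [(coeff_prod_one_add _ _).2.2, (coeff_prod_one_add _ _).2.2] at this
  simp only [(coeff_prod_one_add _ _).2.1] at this
  have e : ∀ i, ∑ x ∈ univ.erase i, - a x = a i - ∑ x, a x := by
    intro i
    rw [← Finset.add_sum_erase _ a (mem_univ i), Finset.sum_neg_distrib]; ring
  simp only [e, mul_sub, Finset.sum_sub_distrib, ← Finset.sum_mul, h1, Finset.sum_neg_distrib,
    sub_sq, Finset.sum_add_distrib, ← Finset.mul_sum, neg_sq] at this
  simp at this
  linarith [this]

theorem sum_cont (w : List (Fin d)) : ∑ i, cont w i + d * (d - 1) / 2 = w.length := by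
  induction w with
  | nil =>
    simp only [cont, sh, List.count_nil, Nat.cast_zero, zero_sub, Finset.sum_neg_distrib,
      List.length_nil]
    rw [Fin.sum_univ_eq_sum_range (fun i => (i : ℝ))]
    have := Finset.sum_range_id_mul_two d
    have h2 : ((∑ i ∈ range d, i : ℕ) : ℝ) * 2 = d * (d - 1) := by
      cases d with
      | zero => simp
      | succ n => 
        have h3 : ((∑ i ∈ range (n + 1), i : ℕ) : ℝ) * 2 = ((n + 1 : ℕ) : ℝ) * (n : ℝ) := by
          exact_mod_cast this
        rw [h3]; push_cast; ring
    push_cast at h2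
    linarith
  | cons i w ih =>
    simp only [cont_cons, Finset.sum_add_distrib]
    simp
    linarith

theorem mom_step {i : Fin d} {w : List (Fin d)} (h : Valid (i :: w)) (f : ℝ[X]) :
    mom (cont (i :: w)) (((X - C (cont w i)) ^ 2 - 1) * f) =
      mom (cont w) ((X - C (cont w i)) ^ 2 * f) := by
  simp only [mom]
  apply Finset.sum_congr rfl
  intro j _
  by_cases hj : j = i
  · subst hj
    simp [cont_cons]
  have hij : i ≠ j := fun h => hj h.symm
  have hinj := (cont_strictAnti h.1.antitone).injective
  have hinj' := (cont_strictAnti h.antitone).injective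
  have h1 : cont w j - cont w i ≠ 0 := fun h => hj (hinj (by linarith))
  have h2 : cont w j - cont w i - 1 ≠ 0 := fun h => hj (hinj' (by simp [cont_cons, hij]; linarith))
  have hmem : i ∈ univ.erase j := by simp [hij]
  have hprod : ∏ x ∈ (univ.erase j).erase i, (cont (i :: w) j - cont (i :: w) x + 1) /
      (cont (i :: w) j - cont (i :: w) x) =
      ∏ x ∈ (univ.erase j).erase i, (cont w j - cont w x + 1) / (cont w j - cont w x) := by
    apply Finset.prod_congr rfl
    intro x hx
    have : i ≠ x := fun h => by simp [h] at hx
    simp [cont_cons, hij, this]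
  simp only [wt]
  rw [← Finset.mul_prod_erase _ _ hmem, ← Finset.mul_prod_erase _ _ hmem, hprod]
  simp only [cont_cons, hij, if_true, if_false, eval_mul, eval_sub, eval_pow, eval_X, eval_C,
    eval_one, add_zero]
  have h2' : cont w j - (cont w i + 1) ≠ 0 := by rwa [← sub_sub]
  field_simp
  ring

theorem mom_nil (p : ℝ[X]) : mom (cont ([] : List (Fin d))) p = d * p.eval 0 := by
  have hinj := (cont_strictAnti (w := ([] : List (Fin d))) (fun i j _ => by simp [sh])).injective
  rw [← mom_one hinj, Finset.sum_mul]
  apply Finset.sum_congr rfl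
  intro i _
  by_cases hi : (i : ℕ) = 0
  · have : cont ([] : List (Fin d)) i = 0 := by simp [cont, sh, hi]
    rw [this]
  · rw [wt_zero (fun i j _ => by simp [sh])]
    · simp
    · intro h
      have := lt_of_adm h (j := ⟨0, i.pos⟩) (by
        show (0:ℕ) < i; omega)
      simp [sh] at this

theorem mom_add (a : Fin d → ℝ) (p q : ℝ[X]) : mom a (p + q) = mom a p + mom a q := by
  simp [mom, mul_add, Finset.sum_add_distrib]

/-- quadratic division -/
theorem quad_div (c : ℝ) (p : ℝ[X]) :
    ∃ (f : ℝ[X]) (α β : ℝ), p = ((X - C c) ^ 2 - 1) * f + (C α + C β * X) := by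
  have hm : ((X - C c) ^ 2 - 1 : ℝ[X]) = (X - C (c+1)) * (X - C (c-1)) := by
    simp; ring
  have hmon : ((X - C c) ^ 2 - 1 : ℝ[X]).Monic := by
    rw [hm]; exact (monic_X_sub_C _).mul (monic_X_sub_C _)
  have hdeg : ((X - C c) ^ 2 - 1 : ℝ[X]).degree = 2 := by
    rw [hm, degree_mul, degree_X_sub_C, degree_X_sub_C]; rfl
  refine ⟨p /ₘ ((X - C c) ^ 2 - 1), (p %ₘ ((X - C c) ^ 2 - 1)).coeff 0,
    (p %ₘ ((X - C c) ^ 2 - 1)).coeff 1, ?_⟩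
  have h1 := modByMonic_add_div p ((X - C c) ^ 2 - 1)
  have h2 : (p %ₘ ((X - C c) ^ 2 - 1)).degree ≤ 1 := by
    have := degree_modByMonic_lt p hmon
    rw [hdeg] at this
    exact Order.le_of_lt_succ this
  have h3 := eq_X_add_C_of_degree_le_one h2
  conv_lhs => rw [← h1, h3]
  ring

end PBT

end PartA

section PartB
open Finset Polynomial
namespace PBT

structure Tower (𝓐 : Type*) [Ring 𝓐] [Algebra ℝ 𝓐] [StarRing 𝓐] [StarModule ℝ 𝓐] (d n : ℕ) where
  s : ℕ → 𝓐
  E : ℕ → 𝓐 →ₗ[ℝ] 𝓐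
  s_sq : ∀ j, j + 1 < n → s j * s j = 1
  s_star : ∀ j, j + 1 < n → star (s j) = s j
  comm : ∀ i j, i + 1 < j → j + 1 < n → s i * s j = s j * s i
  braid : ∀ j, j + 2 < n → s j * s (j+1) * s j = s (j+1) * s j * s (j+1)
  E_left : ∀ j k, j + 1 < k → k < n → ∀ x, E k (s j * x) = s j * E k x
  E_right : ∀ j k, j + 1 < k → k < n → ∀ x, E k (x * s j) = E k x * s j
  E_one : ∀ k, k < n → E k 1 = (d : ℝ) • 1
  E_s : ∀ k, k + 1 < n → E (k+1) (s k) = 1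
  E_faithful : ∀ k, k < n → ∀ x, E k (star x * x) = 0 → x = 0
  pos : ∀ x y : 𝓐, star x * x + star y * y = 0 → x = 0

variable {𝓐 : Type*} [Ring 𝓐] [Algebra ℝ 𝓐] [StarRing 𝓐] [StarModule ℝ 𝓐] {d n : ℕ}

namespace Tower
variable (τ : Tower 𝓐 d n)

def A (k : ℕ) : Subalgebra ℝ 𝓐 := Algebra.adjoin ℝ {x | ∃ j, j + 1 < k ∧ x = τ.s j}

theorem s_mem {j k : ℕ} (h : j + 1 < k) : τ.s j ∈ τ.A k := Algebra.subset_adjoin ⟨j, h, rfl⟩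

theorem A_mono {k l : ℕ} (h : k ≤ l) : τ.A k ≤ τ.A l :=
  Algebra.adjoin_mono (by rintro x ⟨j, hj, rfl⟩; exact ⟨j, by omega, rfl⟩)

theorem A_scalar {k : ℕ} (hk : k ≤ 1) {a : 𝓐} (ha : a ∈ τ.A k) : ∃ r : ℝ, a = r • 1 := by
  have : {x | ∃ j, j + 1 < k ∧ x = τ.s j} = ∅ := by
    ext x; simp; omega
  rw [A, this, Algebra.adjoin_empty, Algebra.mem_bot] at ha
  obtain ⟨r, rfl⟩ := ha
  exact ⟨r, by rw [Algebra.algebraMap_eq_smul_one]⟩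

theorem A_star {k : ℕ} (hk : k ≤ n) {a : 𝓐} (ha : a ∈ τ.A k) : star a ∈ τ.A k := by
  induction ha using Algebra.adjoin_induction with
  | mem x hx =>
    obtain ⟨j, hj, rfl⟩ := hx
    rw [τ.s_star j (by omega)]; exact τ.s_mem hj
  | algebraMap r =>
    rw [Algebra.algebraMap_eq_smul_one, star_smul, star_one]
    exact (τ.A k).smul_mem (one_mem _) _
  | add x y _ _ hx hy => rw [star_add]; exact add_mem hx hy
  | mul x y _ _ hx hy => rw [star_mul]; exact mul_mem hy hx

theorem comm_of_gen {k : ℕ} {z : 𝓐} (h : ∀ j, j + 1 < k → τ.s j * z = z * τ.s j) {a : 𝓐}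
    (ha : a ∈ τ.A k) : a * z = z * a := by
  induction ha using Algebra.adjoin_induction with
  | mem x hx => obtain ⟨j, hj, rfl⟩ := hx; exact h j hj
  | algebraMap r => exact Algebra.commutes r z
  | add x y _ _ hx hy => rw [add_mul, mul_add, hx, hy]
  | mul x y _ _ hx hy => rw [mul_assoc, hy, ← mul_assoc, hx, mul_assoc]

theorem s_comm_A {k : ℕ} (hk : k + 1 < n) {a : 𝓐} (ha : a ∈ τ.A k) : a * τ.s k = τ.s k * a :=
  τ.comm_of_gen (fun j hj => τ.comm j k hj hk) ha

theorem E_left' {k : ℕ} (hk : k < n) {a : 𝓐} (ha : a ∈ τ.A k) (x : 𝓐) :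
    τ.E k (a * x) = a * τ.E k x := by
  induction ha using Algebra.adjoin_induction generalizing x with
  | mem y hy => obtain ⟨j, hj, rfl⟩ := hy; exact τ.E_left j k hj hk x
  | algebraMap r => simp [Algebra.algebraMap_eq_smul_one]
  | add a b _ _ ha hb => rw [add_mul, map_add, ha, hb, add_mul]
  | mul a b _ _ ha hb => rw [mul_assoc, ha, hb, mul_assoc]

theorem E_right' {k : ℕ} (hk : k < n) {a : 𝓐} (ha : a ∈ τ.A k) (x : 𝓐) :
    τ.E k (x * a) = τ.E k x * a := by
  induction ha using Algebra.adjoin_induction generalizing x with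
  | mem y hy => obtain ⟨j, hj, rfl⟩ := hy; exact τ.E_right j k hj hk x
  | algebraMap r => simp [Algebra.algebraMap_eq_smul_one]
  | add a b _ _ ha hb => rw [mul_add, map_add, ha, hb, mul_add]
  | mul a b _ _ ha hb => rw [← mul_assoc, hb, ha, mul_assoc]

def cosetSpan (k : ℕ) : Submodule ℝ 𝓐 :=
  Submodule.span ℝ ({x | x ∈ τ.A (k+1)} ∪
    {x | ∃ b ∈ τ.A (k+1), ∃ c ∈ τ.A (k+1), x = b * τ.s k * c})

theorem cs1 {k : ℕ} {x : 𝓐} (h : x ∈ τ.A (k+1)) : x ∈ τ.cosetSpan k :=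
  Submodule.subset_span (Or.inl h)

theorem cs2 {k : ℕ} {b c : 𝓐} (hb : b ∈ τ.A (k+1)) (hc : c ∈ τ.A (k+1)) :
    b * τ.s k * c ∈ τ.cosetSpan k :=
  Submodule.subset_span (Or.inr ⟨b, hb, c, hc, rfl⟩)

theorem coset_mem (k : ℕ) (hk : k + 1 < n) {a : 𝓐} (ha : a ∈ τ.A (k+2)) :
    a ∈ τ.cosetSpan k := by
  induction k generalizing a with
  | zero =>
    have gen : ∀ j, j + 1 < 2 → ∀ x ∈ τ.cosetSpan 0, τ.s j * x ∈ τ.cosetSpan 0 := by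
      intro j hj x hx
      obtain rfl : j = 0 := by omega
      induction hx using Submodule.span_induction with
      | mem x hx =>
        rcases hx with hx | ⟨b, hb, c, hc, rfl⟩
        · have := τ.cs2 (k := 0) (one_mem _) hx
          simpa using this
        · obtain ⟨r, rfl⟩ := τ.A_scalar (by omega) hb
          have : τ.s 0 * (r • (1 : 𝓐) * τ.s 0 * c) = r • c := by
            simp only [smul_mul_assoc, one_mul, mul_smul_comm]
            rw [← mul_assoc, τ.s_sq 0 hk, one_mul]
          rw [this]
          exact Submodule.smul_mem _ _ (τ.cs1 hc)
      | zero => simp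
      | add x y _ _ hx hy => rw [mul_add]; exact add_mem hx hy
      | smul r x _ hx => rw [mul_smul_comm]; exact Submodule.smul_mem _ _ hx
    have key : ∀ x ∈ τ.cosetSpan 0, a * x ∈ τ.cosetSpan 0 := by
      induction ha using Algebra.adjoin_induction with
      | mem y hy => obtain ⟨j, hj, rfl⟩ := hy; exact gen j hj
      | algebraMap r =>
        intro x hx; rw [Algebra.algebraMap_eq_smul_one, smul_mul_assoc, one_mul]
        exact Submodule.smul_mem _ _ hx
      | add u v _ _ hu hv => intro x hx; rw [add_mul]; exact add_mem (hu x hx) (hv x hx)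
      | mul u v _ _ hu hv => intro x hx; rw [mul_assoc]; exact hu _ (hv x hx)
    simpa using key 1 (τ.cs1 (one_mem _))
  | succ m ih =>
    have gen : ∀ j, j + 1 < m + 1 + 2 → ∀ x ∈ τ.cosetSpan (m+1), τ.s j * x ∈ τ.cosetSpan (m+1) := by
      intro j hj x hx
      induction hx using Submodule.span_induction with
      | mem x hx =>
        by_cases hjm : j = m + 1
        · subst hjm
          rcases hx with hx | ⟨b, hb, c, hc, rfl⟩
          · have := τ.cs2 (k := m + 1) (one_mem _) hx
            simpa using this
          · have hb' := ih (by omega) hb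
            clear hb
            induction hb' using Submodule.span_induction with
            | mem b hb =>
              rcases hb with hb | ⟨b', hb', c', hc', rfl⟩
              · have e : τ.s (m+1) * (b * τ.s (m+1) * c) = b * c := by
                  rw [τ.s_comm_A (k := m+1) (by omega) hb, ← mul_assoc, ← mul_assoc,
                    τ.s_sq _ (by omega), one_mul]
                rw [e]
                exact τ.cs1 (mul_mem (τ.A_mono (by omega) hb) hc)
              · have h1 := τ.s_comm_A (k := m+1) (by omega) hb'
                have h2 := τ.s_comm_A (k := m+1) (by omega) hc'
                have h3 := τ.braid m (by omega)
                have e : τ.s (m+1) * (b' * τ.s m * c' * τ.s (m+1) * c) =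
                    (b' * τ.s m) * τ.s (m+1) * (τ.s m * c' * c) := by
                  calc τ.s (m+1) * (b' * τ.s m * c' * τ.s (m+1) * c)
                      = (τ.s (m+1) * b') * τ.s m * (c' * τ.s (m+1)) * c := by
                        simp only [mul_assoc]
                    _ = b' * (τ.s (m+1) * τ.s m * τ.s (m+1)) * c' * c := by
                        rw [← h1, h2]; simp only [mul_assoc]
                    _ = _ := by rw [← h3]; simp only [mul_assoc]
                rw [e]
                exact τ.cs2 (mul_mem (τ.A_mono (by omega) hb') (τ.s_mem (by omega)))
                  (mul_mem (mul_mem (τ.s_mem (by omega)) (τ.A_mono (by omega) hc')) hc)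
            | zero => simp
            | add x y _ _ hx hy =>
              have : τ.s (m+1) * ((x + y) * τ.s (m+1) * c) = τ.s (m+1) * (x * τ.s (m+1) * c)
                + τ.s (m+1) * (y * τ.s (m+1) * c) := by simp only [add_mul, mul_add]
              rw [this]; exact add_mem hx hy
            | smul r x _ hx =>
              have : τ.s (m+1) * ((r • x) * τ.s (m+1) * c) = r • (τ.s (m+1) * (x * τ.s (m+1) * c)) := by
                simp only [smul_mul_assoc, mul_smul_comm]
              rw [this]; exact Submodule.smul_mem _ _ hx
        · have hjA : τ.s j ∈ τ.A (m + 1 + 1) := τ.s_mem (by omega)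
          rcases hx with hx | ⟨b, hb, c, hc, rfl⟩
          · exact τ.cs1 (mul_mem hjA hx)
          · rw [← mul_assoc, ← mul_assoc]
            exact τ.cs2 (mul_mem hjA hb) hc
      | zero => simp
      | add x y _ _ hx hy => rw [mul_add]; exact add_mem hx hy
      | smul r x _ hx => rw [mul_smul_comm]; exact Submodule.smul_mem _ _ hx
    have key : ∀ x ∈ τ.cosetSpan (m+1), a * x ∈ τ.cosetSpan (m+1) := by
      induction ha using Algebra.adjoin_induction with
      | mem y hy => obtain ⟨j, hj, rfl⟩ := hy; exact gen j hj
      | algebraMap r =>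
        intro x hx; rw [Algebra.algebraMap_eq_smul_one, smul_mul_assoc, one_mul]
        exact Submodule.smul_mem _ _ hx
      | add u v _ _ hu hv => intro x hx; rw [add_mul]; exact add_mem (hu x hx) (hv x hx)
      | mul u v _ _ hu hv => intro x hx; rw [mul_assoc]; exact hu _ (hv x hx)
    simpa using key 1 (τ.cs1 (one_mem _))

/-- induction principle -/
theorem coset_ind {k : ℕ} (hk : k + 1 < n) (p : 𝓐 → Prop)
    (h1 : ∀ b ∈ τ.A (k+1), p b)
    (h2 : ∀ b ∈ τ.A (k+1), ∀ c ∈ τ.A (k+1), p (b * τ.s k * c))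
    (hadd : ∀ x y, p x → p y → p (x + y)) (hsmul : ∀ (r : ℝ) x, p x → p (r • x))
    {a : 𝓐} (ha : a ∈ τ.A (k+2)) : p a := by
  have := τ.coset_mem k hk ha
  clear ha
  induction this using Submodule.span_induction with
  | mem x hx =>
    rcases hx with hx | ⟨b, hb, c, hc, rfl⟩
    · exact h1 x hx
    · exact h2 b hb c hc
  | zero => exact h1 0 (zero_mem _)
  | add x y _ _ hx hy => exact hadd x y hx hy
  | smul r x _ hx => exact hsmul r x hx

theorem E_A {k : ℕ} (hk : k < n) {a : 𝓐} (ha : a ∈ τ.A k) : τ.E k a = (d : ℝ) • a := by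
  have := τ.E_left' hk ha 1
  rw [mul_one] at this
  rw [this, τ.E_one k hk, mul_smul_comm, mul_one]

theorem E_bsc {k : ℕ} (hk : k + 1 < n) {b c : 𝓐} (hb : b ∈ τ.A (k+1)) (hc : c ∈ τ.A (k+1)) :
    τ.E (k+1) (b * τ.s k * c) = b * c := by
  rw [τ.E_right' hk hc, τ.E_left' hk hb, τ.E_s k hk, mul_one]

theorem E_mem {k : ℕ} (hk : k < n) {a : 𝓐} (ha : a ∈ τ.A (k+1)) : τ.E k a ∈ τ.A k := by
  cases k with
  | zero =>
    obtain ⟨r, rfl⟩ := τ.A_scalar (by omega) ha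
    rw [map_smul, τ.E_one 0 hk]
    exact (τ.A 0).smul_mem ((τ.A 0).smul_mem (one_mem _) _) _
  | succ k =>
    refine τ.coset_ind hk (fun a => τ.E (k+1) a ∈ τ.A (k+1)) ?_ ?_ ?_ ?_ ha
    · intro b hb; rw [τ.E_A hk hb]; exact (τ.A (k+1)).smul_mem hb _
    · intro b hb c hc; rw [τ.E_bsc hk hb hc]; exact mul_mem hb hc
    · intro x y hx hy; rw [map_add]; exact add_mem hx hy
    · intro r x hx; rw [map_smul]; exact (τ.A (k+1)).smul_mem hx _

theorem E_shift {k : ℕ} (hk : k + 1 < n) {a : 𝓐} (ha : a ∈ τ.A (k+1)) :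
    τ.E (k+1) (τ.s k * a * τ.s k) = τ.E k a := by
  cases k with
  | zero =>
    obtain ⟨r, rfl⟩ := τ.A_scalar (by omega) ha
    rw [mul_smul_comm, mul_one, smul_mul_assoc, τ.s_sq 0 hk, map_smul, map_smul,
      τ.E_one _ hk, τ.E_one 0 (by omega)]
  | succ k =>
    refine τ.coset_ind (by omega : k + 1 < n)
      (fun a => τ.E (k+1+1) (τ.s (k+1) * a * τ.s (k+1)) = τ.E (k+1) a) ?_ ?_ ?_ ?_ ha
    · intro b hb
      rw [← τ.s_comm_A hk hb, mul_assoc, τ.s_sq _ hk, mul_one, τ.E_A (by omega) hb,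
        τ.E_A hk (τ.A_mono (by omega) hb)]
    · intro b hb c hc
      have h1 := τ.s_comm_A (k := k+1) (by omega) hb
      have h2 := τ.s_comm_A (k := k+1) (by omega) hc
      have h3 := τ.braid k (by omega)
      have e : τ.s (k+1) * (b * τ.s k * c) * τ.s (k+1) =
          (b * τ.s k) * τ.s (k+1) * (τ.s k * c) := by
        calc τ.s (k+1) * (b * τ.s k * c) * τ.s (k+1)
            = (τ.s (k+1) * b) * τ.s k * (c * τ.s (k+1)) := by simp only [mul_assoc]
          _ = b * (τ.s (k+1) * τ.s k * τ.s (k+1)) * c := by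
                rw [← h1, h2]; simp only [mul_assoc]
          _ = _ := by rw [← h3]; simp only [mul_assoc]
      rw [e, τ.E_bsc hk (mul_mem (τ.A_mono (by omega) hb) (τ.s_mem (by omega)))
        (mul_mem (τ.s_mem (by omega)) (τ.A_mono (by omega) hc)), τ.E_bsc (by omega) hb hc]
      rw [mul_assoc, ← mul_assoc (τ.s k), τ.s_sq k (by omega), one_mul]
    · intro x y hx hy; rw [mul_add, add_mul, map_add, map_add, hx, hy]
    · intro r x hx; rw [mul_smul_comm, smul_mul_assoc, map_smul, map_smul, hx]

/-- Jucys-Murphy elements -/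
def JM : ℕ → 𝓐
  | 0 => 0
  | k + 1 => τ.s k * JM k * τ.s k + τ.s k

theorem JM_mem (k : ℕ) : τ.JM k ∈ τ.A (k+1) := by
  induction k with
  | zero => exact zero_mem _
  | succ k ih =>
    have hs : τ.s k ∈ τ.A (k+1+1) := τ.s_mem (by omega)
    exact add_mem (mul_mem (mul_mem hs (τ.A_mono (by omega) ih)) hs) hs

theorem JM_star {k : ℕ} (hk : k < n) : star (τ.JM k) = τ.JM k := by
  induction k with
  | zero => simp [JM]
  | succ k ih => simp [JM, τ.s_star k hk, ih (by omega), mul_assoc]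

theorem JM_comm_s {k : ℕ} (hk : k < n) : ∀ j, j + 1 < k → τ.s j * τ.JM k = τ.JM k * τ.s j := by
  induction k with
  | zero => intro j hj; omega
  | succ k ih =>
    intro j hj
    by_cases hjk : j + 1 < k
    · have h1 := τ.comm j k hjk hk
      have h2 := ih (by omega) j hjk
      simp only [JM]
      rw [mul_add, add_mul, h1]
      congr 1
      calc τ.s j * (τ.s k * τ.JM k * τ.s k) = (τ.s j * τ.s k) * τ.JM k * τ.s k := by
            simp only [mul_assoc]
        _ = τ.s k * (τ.s j * τ.JM k) * τ.s k := by rw [h1]; simp only [mul_assoc]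
        _ = τ.s k * τ.JM k * (τ.s j * τ.s k) := by rw [h2]; simp only [mul_assoc]
        _ = _ := by rw [h1]; simp only [mul_assoc]
    · obtain rfl : k = j + 1 := by omega
      have h3 := τ.braid j (by omega)
      have hx : τ.JM j * τ.s (j+1) = τ.s (j+1) * τ.JM j :=
        τ.s_comm_A (by omega) (τ.JM_mem j)
      have hsq := τ.s_sq j (by omega)
      simp only [JM]
      generalize τ.s j = a at *
      generalize τ.s (j+1) = b at *
      generalize τ.JM j = x at *
      have e1 : a * (b * (a * x * a + a) * b + b) = (a * b * a) * x * a * b + a * (b * a * b) + a * b := by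
        noncomm_ring
      have e2 : (b * (a * x * a + a) * b + b) * a = b * a * x * (a * b * a) + b * (a * b * a) + b * a := by
        noncomm_ring
      have f1 : (a * b * a) * x * a * b = b * a * x * (a * b * a) := by
        calc (a * b * a) * x * a * b = b * a * (b * x) * a * b := by rw [h3]; simp only [mul_assoc]
          _ = b * a * x * (b * a * b) := by rw [← hx]; simp only [mul_assoc]
          _ = _ := by rw [h3]
      have hsb := τ.s_sq (j+1) (by omega)
      have f2 : a * (b * a * b) = b * a := by
        rw [← h3, ← mul_assoc, ← mul_assoc, hsq, one_mul]
      have f3 : b * (a * b * a) = a * b := by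
        calc b * (a * b * a) = (b * a * b) * a := by simp only [mul_assoc]
          _ = a * b * (a * a) := by rw [← h3]; simp only [mul_assoc]
          _ = a * b := by rw [hsq, mul_one]
      rw [e1, e2, f1, f2, f3]
      abel

theorem JM_comm_A {k : ℕ} (hk : k < n) {a : 𝓐} (ha : a ∈ τ.A k) : a * τ.JM k = τ.JM k * a :=
  τ.comm_of_gen (τ.JM_comm_s hk) ha

theorem aeval_comm_A {k : ℕ} (hk : k < n) {a : 𝓐} (ha : a ∈ τ.A k) (p : ℝ[X]) :
    a * aeval (τ.JM k) p = aeval (τ.JM k) p * a := by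
  have h : Commute a (τ.JM k) := τ.JM_comm_A hk ha
  induction p using Polynomial.induction_on' with
  | add p q hp hq => simp only [map_add, mul_add, add_mul, hp, hq]
  | monomial m r =>
    rw [aeval_monomial]
    have h2 : Commute a (algebraMap ℝ 𝓐 r) := (Algebra.commutes r a).symm
    exact h2.mul_right (h.pow_right m)

theorem aeval_mem (k : ℕ) (p : ℝ[X]) : aeval (τ.JM k) p ∈ τ.A (k+1) := by
  induction p using Polynomial.induction_on' with
  | add p q hp hq => rw [map_add]; exact add_mem hp hq
  | monomial m r =>
    rw [aeval_monomial]
    exact mul_mem (Subalgebra.algebraMap_mem _ _) (pow_mem (τ.JM_mem k) m)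

theorem aeval_star {k : ℕ} (hk : k < n) (p : ℝ[X]) :
    star (aeval (τ.JM k) p) = aeval (τ.JM k) p := by
  induction p using Polynomial.induction_on' with
  | add p q hp hq => simp only [map_add, star_add, hp, hq]
  | monomial m r =>
    rw [aeval_monomial, star_mul, star_pow, τ.JM_star hk, Algebra.algebraMap_eq_smul_one,
      star_smul, star_one, star_trivial]
    simp

theorem E_JM {k : ℕ} (hk : k < n) : τ.E k (τ.JM k) = (k : ℝ) • 1 := by
  induction k with
  | zero => simp [JM]
  | succ k ih =>
    rw [JM, map_add, τ.E_shift hk (τ.JM_mem k), τ.E_s k hk, ih (by omega)]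
    push_cast; rw [add_smul, one_smul]

end Tower
end PBT

end PartB

section PartC
open Finset Polynomial
namespace PBT
variable {𝓐 : Type*} [Ring 𝓐] [Algebra ℝ 𝓐] [StarRing 𝓐] [StarModule ℝ 𝓐] {d n : ℕ}

noncomputable def lag (a : Fin d → ℝ) (i : Fin d) : ℝ[X] := Lagrange.basis univ a i

theorem lag_eval {a : Fin d → ℝ} (ha : Function.Injective a) (i j : Fin d) :
    (lag a i).eval (a j) = if i = j then 1 else 0 := by
  split_ifs with h
  · subst h; exact Lagrange.eval_basis_self ha.injOn (mem_univ _)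
  · exact Lagrange.eval_basis_of_ne h (mem_univ _)

namespace Tower
variable (τ : Tower 𝓐 d n)

theorem JM_comm_JM {k : ℕ} (hk : k + 1 < n) : τ.JM k * τ.JM (k+1) = τ.JM (k+1) * τ.JM k :=
  τ.JM_comm_A hk (τ.JM_mem k)

/-- intertwiner identity -/
theorem intertwine {k : ℕ} (hk : k + 1 < n) (f : ℝ[X]) :
    aeval (τ.JM (k+1)) f * ((τ.JM (k+1) - τ.JM k) * (τ.JM (k+1) - τ.JM k) - 1) =
    τ.s k * (aeval (τ.JM k) (X ^ 2 * f)) * τ.s k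
      + τ.JM k * (τ.s k * aeval (τ.JM k) f * τ.s k) * τ.JM k
      - (τ.s k * aeval (τ.JM k) (X * f) * τ.s k) * τ.JM k
      - τ.JM k * (τ.s k * aeval (τ.JM k) (X * f) * τ.s k) := by
  have hsq := τ.s_sq k hk
  have hxy := τ.JM_comm_JM hk
  have hy : τ.JM (k+1) = τ.s k * τ.JM k * τ.s k + τ.s k := rfl
  simp only [map_mul, map_pow, aeval_X]
  have hfx : ∀ f : ℝ[X], aeval (τ.JM k) f * τ.JM k = τ.JM k * aeval (τ.JM k) f := by
    intro f
    have h1 : aeval (τ.JM k) (f * X) = aeval (τ.JM k) (X * f) := by rw [mul_comm]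
    simpa using h1
  have hx := hfx f
  have hintw : ∀ f : ℝ[X], aeval (τ.JM (k+1)) f * (τ.s k * τ.JM k - τ.JM k * τ.s k) =
      (τ.s k * τ.JM k - τ.JM k * τ.s k) * aeval (τ.JM k) f := by
    have h1 : SemiconjBy (τ.s k * τ.JM k - τ.JM k * τ.s k) (τ.JM k) (τ.JM (k+1)) := by
      show (τ.s k * τ.JM k - τ.JM k * τ.s k) * τ.JM k = τ.JM (k+1) * (τ.s k * τ.JM k - τ.JM k * τ.s k)
      rw [hy] at hxy ⊢
      generalize τ.s k = s at *
      generalize τ.JM k = x at *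
      have h2 := congrArg (fun z => z * s) hxy
      beta_reduce at h2
      have e1 : x * (s * x * s + s) * s = x * s * x * (s * s) + x * (s * s) := by noncomm_ring
      have e2 : (s * x * s + s) * x * s = s * x * s * x * s + s * x * s := by noncomm_ring
      rw [e1, e2, hsq, mul_one, mul_one] at h2
      have e3 : (s * x * s + s) * (s * x - x * s) = s * x * (s * s) * x - s * x * s * x * s
        + (s * s) * x - s * x * s := by noncomm_ring
      rw [e3, hsq, mul_one, one_mul]
      have e4 : s * x * s * x * s = x * s * x + x - s * x * s := by rw [h2]; abel
      rw [e4]; noncomm_ring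
    intro f
    induction f using Polynomial.induction_on' with
    | add p q hp hq => simp only [map_add, mul_add, add_mul, hp, hq]
    | monomial m r =>
      rw [aeval_monomial, aeval_monomial]
      have h2 : SemiconjBy (τ.s k * τ.JM k - τ.JM k * τ.s k) (algebraMap ℝ 𝓐 r) (algebraMap ℝ 𝓐 r) :=
        (Algebra.commutes r _).symm
      exact (h2.mul_right (h1.pow_right m)).eq.symm
  have hphi : (τ.JM (k+1) - τ.JM k) * (τ.JM (k+1) - τ.JM k) - 1 =
      - ((τ.s k * τ.JM k - τ.JM k * τ.s k) * (τ.s k * τ.JM k - τ.JM k * τ.s k)) := by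
    rw [hy]
    generalize τ.s k = s at *
    generalize τ.JM k = x at *
    have e1 : (s * x * s + s - x) * (s * x * s + s - x) - 1 = s * x * (s * s) * x * s + s * x * (s * s)
      + (s * s) * x * s + s * s - s * x * s * x - s * x - x * s * x * s - x * s + x * x - 1 := by
      noncomm_ring
    have e2 : (s * x - x * s) * (s * x - x * s) = s * x * s * x - s * x * x * s - x * (s * s) * x
      + x * s * x * s := by noncomm_ring
    rw [e1, e2, hsq]
    noncomm_ring
  rw [hphi, mul_neg, ← mul_assoc, hintw]
  clear hintw hphi
  generalize aeval (τ.JM k) f = g at *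
  generalize τ.s k = s at *
  generalize τ.JM k = x at *
  have e1 : (s * x - x * s) * g * (s * x - x * s) = s * (x * g) * s * x - s * x * (g * x) * s
    - x * s * g * s * x + x * s * (g * x) * s := by noncomm_ring
  rw [e1, hx]
  noncomm_ring

theorem E_step {k : ℕ} (hk : k + 1 < n) (f : ℝ[X]) :
    τ.E (k+1) (aeval (τ.JM (k+1)) f * ((τ.JM (k+1) - τ.JM k) * (τ.JM (k+1) - τ.JM k) - 1)) =
    τ.E k (aeval (τ.JM k) (X ^ 2 * f))
      + τ.JM k * τ.E k (aeval (τ.JM k) f) * τ.JM k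
      - τ.E k (aeval (τ.JM k) (X * f)) * τ.JM k
      - τ.JM k * τ.E k (aeval (τ.JM k) (X * f)) := by
  rw [τ.intertwine hk, map_sub, map_sub, map_add, τ.E_shift hk (τ.aeval_mem _ _),
    τ.E_right' hk (τ.JM_mem k), τ.E_left' hk (τ.JM_mem k), τ.E_shift hk (τ.aeval_mem _ _),
    τ.E_right' hk (τ.JM_mem k), τ.E_shift hk (τ.aeval_mem _ _), τ.E_left' hk (τ.JM_mem k),
    τ.E_shift hk (τ.aeval_mem _ _)]

noncomputable def e : List (Fin d) → 𝓐
  | [] => 1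
  | i :: w => e w * aeval (τ.JM w.length) (lag (cont w) i)

structure Good (w : List (Fin d)) : Prop where
  star : star (τ.e w) = τ.e w
  sq : τ.e w * τ.e w = τ.e w
  mem : τ.e w ∈ τ.A w.length
  mom : w.length < n → ∀ p : ℝ[X],
    τ.E w.length (aeval (τ.JM w.length) p) * τ.e w = mom (cont w) p • τ.e w

section step
variable {τ}

theorem Good.comm {w : List (Fin d)} (hg : τ.Good w) (hv : Valid w) (hn : w.length < n) (p : ℝ[X]) : τ.e w * aeval (τ.JM w.length) p = aeval (τ.JM w.length) p * τ.e w :=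
  τ.aeval_comm_A hn hg.mem p

theorem Good.ann {w : List (Fin d)} (hg : τ.Good w) (hv : Valid w) (hn : w.length < n) {p : ℝ[X]} (hp : ∀ j, p.eval (cont w j) = 0) :
    aeval (τ.JM w.length) p * τ.e w = 0 := by
  apply τ.E_faithful w.length hn
  rw [star_mul, hg.star, τ.aeval_star hn]
  have : τ.e w * aeval (τ.JM w.length) p * (aeval (τ.JM w.length) p * τ.e w) =
      aeval (τ.JM w.length) (p * p) * τ.e w := by
    rw [hg.comm hv hn, mul_assoc, ← mul_assoc (τ.e w), hg.comm hv hn, mul_assoc, hg.sq, map_mul,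
      mul_assoc]
  rw [this, τ.E_right' hn hg.mem, hg.mom hn]
  have : PBT.mom (cont w) (p * p) = 0 := by
    simp [PBT.mom, hp]
  rw [this, zero_smul]

theorem Good.ev {w : List (Fin d)} (hg : τ.Good w) (hv : Valid w) (hn : w.length < n) {p q : ℝ[X]} (h : ∀ j, p.eval (cont w j) = q.eval (cont w j)) :
    aeval (τ.JM w.length) p * τ.e w = aeval (τ.JM w.length) q * τ.e w := by
  have := hg.ann hv hn (p := p - q) (fun j => by simp [h j])
  rw [map_sub, sub_mul, sub_eq_zero] at this
  exact this

theorem Good.cons_eq {w : List (Fin d)} (hg : τ.Good w) (hv : Valid w) (hn : w.length < n) (i : Fin d) :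
    τ.e (i :: w) = aeval (τ.JM w.length) (lag (cont w) i) * τ.e w := by
  rw [← hg.comm hv hn]; rfl

theorem Good.aeval_cons {w : List (Fin d)} (hg : τ.Good w) (hv : Valid w) (hn : w.length < n) (i : Fin d) (p : ℝ[X]) :
    aeval (τ.JM w.length) p * τ.e (i :: w) = p.eval (cont w i) • τ.e (i :: w) := by
  have hinj := (cont_strictAnti hv.antitone).injective
  have : p.eval (cont w i) • τ.e (i :: w) =
      aeval (τ.JM w.length) (C (p.eval (cont w i)) * lag (cont w) i) * τ.e w := by
    rw [map_mul, aeval_C, hg.cons_eq hv hn, Algebra.algebraMap_eq_smul_one, smul_mul_assoc,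
      one_mul, smul_mul_assoc]
  rw [this, hg.cons_eq hv hn, ← mul_assoc, ← map_mul]
  apply hg.ev hv hn
  intro j
  simp only [eval_mul, lag_eval hinj, eval_C]
  split_ifs with h
  · rw [h]
  · simp

theorem Good.JM_cons {w : List (Fin d)} (hg : τ.Good w) (hv : Valid w) (hn : w.length < n) (i : Fin d) :
    τ.JM w.length * τ.e (i :: w) = cont w i • τ.e (i :: w) := by
  simpa using hg.aeval_cons hv hn i X

theorem Good.cons_star {w : List (Fin d)} (hg : τ.Good w) (hv : Valid w) (hn : w.length < n) (i : Fin d) : Star.star (τ.e (i :: w)) = τ.e (i :: w) := by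
  rw [e, star_mul, hg.star, τ.aeval_star hn, hg.comm hv hn]

theorem Good.cons_JM {w : List (Fin d)} (hg : τ.Good w) (hv : Valid w) (hn : w.length < n) (i : Fin d) :
    τ.e (i :: w) * τ.JM w.length = cont w i • τ.e (i :: w) := by
  have := congrArg Star.star (hg.JM_cons hv hn i)
  simpa [star_mul, star_smul, hg.cons_star hv hn, τ.JM_star hn] using this

theorem Good.cons_left {w : List (Fin d)} (hg : τ.Good w) (hv : Valid w) (hn : w.length < n) (i : Fin d) : τ.e w * τ.e (i :: w) = τ.e (i :: w) := by
  rw [e, ← mul_assoc, hg.sq]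

theorem Good.cons_right {w : List (Fin d)} (hg : τ.Good w) (hv : Valid w) (hn : w.length < n) (i : Fin d) : τ.e (i :: w) * τ.e w = τ.e (i :: w) := by
  rw [hg.cons_eq hv hn, mul_assoc, hg.sq]

theorem Good.cons_mul {w : List (Fin d)} (hg : τ.Good w) (hv : Valid w) (hn : w.length < n) (i j : Fin d) :
    τ.e (i :: w) * τ.e (j :: w) = if i = j then τ.e (i :: w) else 0 := by
  have hinj := (cont_strictAnti hv.antitone).injective
  rw [hg.cons_eq hv hn i, mul_assoc, hg.cons_left hv hn, hg.aeval_cons hv hn, lag_eval hinj]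
  split_ifs with h
  · subst h; rw [one_smul, hg.cons_eq hv hn]
  · rw [zero_smul]

theorem Good.cons_mem {w : List (Fin d)} (hg : τ.Good w) (hv : Valid w) (hn : w.length < n) (i : Fin d) : τ.e (i :: w) ∈ τ.A (w.length + 1) :=
  mul_mem (τ.A_mono (by omega) hg.mem) (τ.aeval_mem _ _)

theorem Good.E_cons {w : List (Fin d)} (hg : τ.Good w) (hv : Valid w) (hn : w.length < n) (i : Fin d) : τ.E w.length (τ.e (i :: w)) = wt (cont w) i • τ.e w := by
  have hinj := (cont_strictAnti hv.antitone).injective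
  rw [hg.cons_eq hv hn, τ.E_right' hn hg.mem, hg.mom hn]
  congr 1
  simp [PBT.mom, lag_eval hinj]

theorem Good.cons_zero {w : List (Fin d)} (hg : τ.Good w) (hv : Valid w) (hn : w.length < n) (i : Fin d) (hi : ¬ Antitone (sh (i :: w))) : τ.e (i :: w) = 0 := by
  apply τ.E_faithful w.length hn
  rw [hg.cons_star hv hn, hg.cons_mul hv hn, if_pos rfl, hg.E_cons hv hn,
    wt_zero hv.antitone hi, zero_smul]

theorem Good.sum_cons {w : List (Fin d)} (hg : τ.Good w) (hv : Valid w) (hn : w.length < n) : ∑ i, τ.e (i :: w) = τ.e w := by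
  have hinj := (cont_strictAnti hv.antitone).injective
  simp only [hg.cons_eq hv hn]
  rw [← Finset.sum_mul, ← map_sum]
  have := hg.ev hv hn (p := ∑ i, lag (cont w) i) (q := 1) (fun j => by
    simp [eval_finsetSum, lag_eval hinj])
  rw [this, map_one, one_mul]

theorem Good.cons_mom {w : List (Fin d)} (hg : τ.Good w) (hv : Valid w) (hn : w.length < n) (i : Fin d) (hi : Valid (i :: w)) (hn' : w.length + 1 < n) (p : ℝ[X]) :
    τ.E (w.length + 1) (aeval (τ.JM (w.length + 1)) p) * τ.e (i :: w) =
      PBT.mom (cont (i :: w)) p • τ.e (i :: w) := by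
  set k := w.length with hk
  set c := cont w i with hc
  have hinj := (cont_strictAnti hi.antitone).injective
  have hmem := hg.cons_mem hv hn i
  have hye : τ.e (i :: w) * τ.JM (k+1) = τ.JM (k+1) * τ.e (i :: w) := τ.JM_comm_A hn' hmem
  have hxe : τ.JM k * τ.e (i :: w) = c • τ.e (i :: w) := hg.JM_cons hv hn i
  have hx2 : ∀ q : ℝ[X], τ.E k (aeval (τ.JM k) q) * τ.e (i :: w) = PBT.mom (cont w) q • τ.e (i :: w) := by
    intro q
    rw [← hg.cons_left hv hn i, ← mul_assoc, hg.mom hn, smul_mul_assoc]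
  have hsq : ∀ f : ℝ[X], τ.E (k+1) (aeval (τ.JM (k + 1)) (((X - C c) ^ 2 - 1) * f)) * τ.e (i :: w) =
      PBT.mom (cont w) ((X - C c) ^ 2 * f) • τ.e (i :: w) := by
    intro f
    have h1 : aeval (τ.JM (k + 1)) (((X - C c) ^ 2 - 1) * f) * τ.e (i :: w) =
        aeval (τ.JM (k+1)) f * ((τ.JM (k+1) - τ.JM k) * (τ.JM (k+1) - τ.JM k) - 1) * τ.e (i :: w) := by
      rw [mul_comm, map_mul, mul_assoc, mul_assoc]
      congr 1
      simp only [map_sub, map_pow, map_one, aeval_X, aeval_C, sub_mul, Algebra.algebraMap_eq_smul_one]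
      rw [pow_two]
      have h3 : (τ.JM (k+1) - τ.JM k) * τ.e (i :: w) = τ.e (i :: w) * (τ.JM (k+1) - c • 1) := by
        rw [sub_mul, hxe, mul_sub, hye, mul_smul_comm, mul_one]
      have h4 : (τ.JM (k+1) - c • 1) * τ.e (i :: w) = τ.e (i :: w) * (τ.JM (k+1) - c • 1) := by
        rw [sub_mul, mul_sub, hye, mul_smul_comm, mul_one, smul_mul_assoc, one_mul]
      congr 1
      calc _ = (τ.JM (k+1) - c • 1) * ((τ.JM (k+1) - c • 1) * τ.e (i :: w)) := by rw [mul_assoc]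
        _ = (τ.JM (k+1) - τ.JM k) * ((τ.JM (k+1) - τ.JM k) * τ.e (i :: w)) := by
          rw [h4, h3, ← mul_assoc, ← mul_assoc, h3, h4]
        _ = _ := by rw [← mul_assoc, sub_mul _ _ (τ.JM (k+1) - τ.JM k), sub_mul]
    rw [← τ.E_right' hn' hmem, h1, τ.E_right' hn' hmem, τ.E_step hn', sub_mul, sub_mul, add_mul]
    simp only [mul_assoc, hxe, hx2, mul_smul_comm]
    simp only [smul_smul, ← sub_smul, ← add_smul]
    congr 1
    simp only [PBT.mom, Finset.mul_sum, Finset.sum_mul, ← Finset.sum_add_distrib,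
      ← Finset.sum_sub_distrib]
    apply Finset.sum_congr rfl
    intro j _
    simp
    ring
  obtain ⟨f, α, β, rfl⟩ := quad_div c p
  rw [map_add, map_add, add_mul, hsq, mom_add, ← mom_step hi, ← hc, add_smul]
  congr 1
  have h5 : PBT.mom (cont (i :: w)) (C α + C β * X) = α * d + β * (k + 1) := by
    have h6 := mom_one hinj
    have h7 := mom_X hinj
    rw [sum_cont] at h7
    rw [← h6]
    have h8 : ((k : ℝ) + 1) = ((i :: w).length : ℝ) := by simp [hk]
    rw [h8, ← h7]
    simp only [PBT.mom, eval_add, eval_mul, eval_C, eval_X, mul_add, Finset.sum_add_distrib,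
      Finset.mul_sum]
    congr 1
    · exact Finset.sum_congr rfl (fun _ _ => by ring)
    · exact Finset.sum_congr rfl (fun _ _ => by ring)
  rw [h5, map_add, aeval_C, map_mul, aeval_C, aeval_X, Algebra.algebraMap_eq_smul_one,
    Algebra.algebraMap_eq_smul_one, smul_mul_assoc, one_mul, map_add, map_smul, map_smul,
    τ.E_one _ hn', τ.E_JM hn', smul_smul, smul_smul, ← add_smul, smul_mul_assoc, one_mul]
  push_cast; rfl

end step

theorem good (w : List (Fin d)) (hv : Valid w) (hn : w.length ≤ n) : τ.Good w := by
  induction w with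
  | nil =>
    refine ⟨by simp [e], by simp [e], by simp [e, one_mem], ?_⟩
    intro h p
    simp only [List.length_nil, JM, mom_nil, e, mul_one]
    have : aeval (0 : 𝓐) p = (p.eval 0) • (1 : 𝓐) := by
      rw [← coeff_zero_eq_eval_zero, ← Algebra.algebraMap_eq_smul_one, ← coeff_zero_eq_aeval_zero']
    have h0 : τ.E 0 1 = (d:ℝ) • (1:𝓐) := τ.E_one 0 (by simpa using h)
    rw [this, map_smul, h0, smul_smul, mul_comm]
  | cons i w ih =>
    simp only [List.length_cons] at hn
    have hg := ih hv.1 (by omega)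
    refine ⟨hg.cons_star hv.1 (by omega) i, ?_, hg.cons_mem hv.1 (by omega) i, ?_⟩
    · rw [hg.cons_mul hv.1 (by omega), if_pos rfl]
    · intro h p
      exact hg.cons_mom hv.1 (by omega) i hv (by simpa using h) p

end Tower
end PBT

end PartC

section PartD
open Finset Polynomial
namespace PBT
variable {d n : ℕ}

open scoped Classical in
noncomputable def W (d : ℕ) : ℕ → Finset (List (Fin d))
  | 0 => {[]}
  | k + 1 => ((univ ×ˢ W d k).image (fun p : Fin d × List (Fin d) => p.1 :: p.2)).filter Valid

theorem mem_W {k : ℕ} {w : List (Fin d)} : w ∈ W d k ↔ Valid w ∧ w.length = k := by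
  induction k generalizing w with
  | zero =>
    simp only [W, mem_singleton, List.length_eq_zero_iff]
    constructor
    · rintro rfl; exact ⟨trivial, rfl⟩
    · exact fun h => h.2
  | succ k ih =>
    simp only [W, mem_filter, mem_image, mem_product, mem_univ, true_and, Prod.exists, ih]
    constructor
    · rintro ⟨⟨i, v, ⟨hv, hl⟩, rfl⟩, h⟩
      exact ⟨h, by simp [hl]⟩
    · rintro ⟨h, hl⟩
      cases w with
      | nil => simp at hl
      | cons i v => exact ⟨⟨i, v, ⟨h.1, by simpa using hl⟩, rfl⟩, h⟩

open scoped Classical in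
theorem sum_W {M : Type*} [AddCommMonoid M] (k : ℕ) (f : List (Fin d) → M) :
    ∑ w ∈ W d (k+1), f w = ∑ w ∈ W d k, ∑ i, if Valid (i :: w) then f (i :: w) else 0 := by
  rw [W, Finset.sum_filter, Finset.sum_image, Finset.sum_product, Finset.sum_comm]
  rintro ⟨i, v⟩ _ ⟨j, u⟩ _ h
  simpa using h

theorem valid_one {i : Fin d} (h : Valid [i]) : (i : ℕ) = 0 := by
  by_contra hi
  have := lt_of_adm h.2 (j := ⟨0, i.pos⟩) (by show (0:ℕ) < i; omega)
  simp [sh] at this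

theorem valid_le_one {w w' : List (Fin d)} (h : Valid w) (h' : Valid w') (hl : w.length = w'.length)
    (h1 : w.length ≤ 1) : w = w' := by
  match w, w', h, h', hl, h1 with
  | [], [], _, _, _, _ => rfl
  | [i], [j], h, h', _, _ => 
    have : i = j := Fin.ext ((valid_one h).trans (valid_one h').symm)
    rw [this]

/-- every antitone shape has a valid word -/
theorem exists_word (m : ℕ) (κ : Fin d → ℕ) (hκ : Antitone κ) (hs : ∑ i, κ i = m) :
    ∃ w : List (Fin d), Valid w ∧ w.length = m ∧ sh w = κ := by
  induction m generalizing κ with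
  | zero =>
    refine ⟨[], trivial, rfl, ?_⟩
    funext i
    have := (Finset.sum_eq_zero_iff.mp hs) i (mem_univ _)
    simp [sh, this]
  | succ m ih =>
    have hne : (univ.filter (fun i => 0 < κ i)).Nonempty := by
      by_contra hc
      rw [Finset.not_nonempty_iff_eq_empty] at hc
      have : ∑ i, κ i = 0 := Finset.sum_eq_zero (fun i _ => by
        by_contra h
        have : i ∈ univ.filter (fun i => 0 < κ i) := by simp; omega
        rw [hc] at this; simp at this)
      omega
    obtain ⟨i, hi, hmax⟩ := Finset.exists_max_image _ id hne
    simp only [mem_filter, mem_univ, true_and, id] at hi hmax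
    have hz : ∀ j, i < j → κ j = 0 := by
      intro j hj
      by_contra h
      exact absurd (hmax j (by omega)) (not_le.mpr hj)
    obtain ⟨w, hw, hl, hsh⟩ := ih (fun j => κ j - if i = j then 1 else 0) (by
        intro a b hab
        have := hκ hab
        by_cases ha : i = a
        · by_cases hb : i = b
          · simp [← ha, ← hb]
          · have : κ b = 0 := hz b (lt_of_le_of_ne (ha ▸ hab) hb)
            simp [this]
        · simp [ha]; omega) (by
        have h1 : ∑ j, κ j = ∑ j, ((κ j - if i = j then 1 else 0) + if i = j then 1 else 0) := by
          apply Finset.sum_congr rfl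
          intro j _
          split_ifs with h
          · subst h; omega
          · simp
        rw [Finset.sum_add_distrib, hs] at h1
        simp at h1
        omega)
    have e : sh (i :: w) = κ := by
      funext j
      rw [sh_cons, hsh]
      by_cases h : i = j
      · subst h; simp; omega
      · simp [h]
    exact ⟨i :: w, ⟨hw, e ▸ hκ⟩, by simp [hl], e⟩

theorem cont_eq_of_sh {u v : List (Fin d)} (h : sh u = sh v) : cont u = cont v := by
  funext i; simp [cont, h]

theorem length_eq_sum (w : List (Fin d)) : w.length = ∑ i, sh w i := by
  induction w with
  | nil => simp [sh]
  | cons i w ih => simp [sh_cons, Finset.sum_add_distrib, ih]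

theorem cont_not_succ {q : List (Fin d)} {i j : Fin d} (hq : Antitone (sh q))
    (hi : Antitone (sh (i :: q))) (hij : i ≠ j) : cont q j ≠ cont q i + 1 := by
  intro h
  have hlt : j < i := by
    by_contra hc
    have := cont_strictAnti hq (lt_of_le_of_ne (not_lt.mp hc) hij)
    linarith
  have h1 := lt_of_adm hi hlt
  rw [cont_int, cont_int] at h
  have h2 : (sh q j : ℤ) - (j : ℕ) = (sh q i : ℤ) - (i : ℕ) + 1 := by exact_mod_cast h
  have h3 : (j : ℕ) < i := hlt
  omega

/-- double box exclusion -/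
theorem cont_not_dbl {q : List (Fin d)} {i j : Fin d} (hv : Valid (i :: i :: q)) (hij : i ≠ j) :
    cont q j ≠ cont q i + 1 :=
  cont_not_succ hv.1.1.antitone hv.1.2 hij

variable {𝓐 : Type*} [Ring 𝓐] [Algebra ℝ 𝓐] [StarRing 𝓐] [StarModule ℝ 𝓐]
namespace Tower
variable (τ : Tower 𝓐 d n)

theorem e_star {w : List (Fin d)} (hv : Valid w) (hn : w.length ≤ n) : star (τ.e w) = τ.e w :=
  (τ.good w hv hn).star

theorem e_sq {w : List (Fin d)} (hv : Valid w) (hn : w.length ≤ n) : τ.e w * τ.e w = τ.e w :=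
  (τ.good w hv hn).sq

theorem e_mem {w : List (Fin d)} (hv : Valid w) (hn : w.length ≤ n) : τ.e w ∈ τ.A w.length :=
  (τ.good w hv hn).mem

theorem e_ne_zero [Nontrivial 𝓐] {w : List (Fin d)} (hv : Valid w) (hn : w.length ≤ n) :
    τ.e w ≠ 0 := by
  induction w with
  | nil => simp [e]
  | cons i w ih =>
    simp only [List.length_cons] at hn
    intro h
    have h1 := (τ.good w hv.1 (by omega)).E_cons hv.1 (by omega) i
    rw [h, map_zero] at h1
    have := wt_pos hv.1.antitone hv.2
    rcases smul_eq_zero.mp h1.symm with h2 | h2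
    · linarith
    · exact ih hv.1 (by omega) h2

theorem e_ortho {w w' : List (Fin d)} (hv : Valid w) (hv' : Valid w') (hl : w.length = w'.length)
    (hn : w.length ≤ n) (hne : w ≠ w') : τ.e w * τ.e w' = 0 := by
  induction w generalizing w' with
  | nil =>
    simp only [List.length_nil] at hl
    exact absurd (List.length_eq_zero_iff.mp hl.symm).symm hne
  | cons i w ih =>
    cases w' with
    | nil => simp at hl
    | cons j w' =>
      simp only [List.length_cons, add_left_inj] at hl hn
      have hg := τ.good w hv.1 (by omega)
      have hg' := τ.good w' hv'.1 (by omega)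
      by_cases hww : w = w'
      · subst hww
        rw [hg.cons_mul hv.1 (by omega), if_neg]
        intro h; exact hne (by rw [h])
      · rw [← hg.cons_right hv.1 (by omega), ← hg'.cons_left hv'.1 (by omega), mul_assoc,
          ← mul_assoc (τ.e w), ih hv.1 hv'.1 hl (by omega) hww, zero_mul, mul_zero]

theorem sum_e {k : ℕ} (hk : k ≤ n) : ∑ w ∈ W d k, τ.e w = 1 := by
  induction k with
  | zero => simp [W, e]
  | succ k ih =>
    rw [sum_W, ← ih (by omega)]
    apply Finset.sum_congr rfl
    intro w hw
    obtain ⟨hv, hl⟩ := mem_W.mp hw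
    have hg := τ.good w hv (by omega)
    rw [← hg.sum_cons hv (by omega)]
    apply Finset.sum_congr rfl
    intro i _
    split_ifs with h
    · rfl
    · exact (hg.cons_zero hv (by omega) i (fun h' => h ⟨hv, h'⟩)).symm

theorem carry {v u : List (Fin d)} (hv : Valid v) (hu : Valid u) (hl : v.length < n)
    (hs : sh u = sh v) {b : 𝓐} (hb : b ∈ τ.A v.length) (i : Fin d) :
    τ.e (i :: v) * b * τ.e u = τ.e v * b * τ.e (i :: u) := by
  have hlen : u.length = v.length := by rw [length_eq_sum, length_eq_sum, hs]
  rw [(τ.good u hu (by omega)).cons_eq hu (by omega), hlen, cont_eq_of_sh hs, e, mul_assoc, mul_assoc, mul_assoc,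
    ← mul_assoc b, τ.aeval_comm_A hl hb, mul_assoc]

/-- core relations -/
theorem core1 {p p' i j : Fin d} {q q' : List (Fin d)} (h : Valid (i :: p :: q)) (h' : Valid (j :: p' :: q'))
    (hl : q.length = q'.length) (hn : q.length + 1 < n) :
    (cont (p :: q) i - cont q' p') • (τ.e (i :: p :: q) * τ.s q.length * τ.e (j :: p' :: q')) =
      τ.e (i :: p :: q) * τ.e (j :: p' :: q') := by
  have hs := τ.s_sq _ hn
  have h1 : τ.JM (q.length + 1) * τ.s q.length = τ.s q.length * τ.JM q.length + 1 := by
    show (τ.s q.length * τ.JM q.length * τ.s q.length + τ.s q.length) * τ.s q.length = _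
    rw [add_mul, mul_assoc, hs, mul_one]
  have h2 := (τ.good (p :: q) h.1 (by simp; omega)).cons_JM h.1 (by simpa using hn) i
  have h3 := (τ.good q' h'.1.1 (by omega)).JM_cons h'.1.1 (by omega) p'
  have h4 := (τ.good (p' :: q') h'.1 (by simp; omega)).cons_left h'.1 (by simp; omega) j
  have h5 : τ.JM q.length * τ.e (j :: p' :: q') = cont q' p' • τ.e (j :: p' :: q') := by
    rw [← h4, ← mul_assoc, hl, h3, smul_mul_assoc]
  simp only [List.length_cons] at h2
  rw [sub_smul, ← smul_mul_assoc, ← smul_mul_assoc, ← h2, ← mul_smul_comm, ← h5, mul_assoc _ (τ.JM _),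
    h1]
  noncomm_ring

theorem core_ne {p p' i j : Fin d} {q q' : List (Fin d)} (h : Valid (i :: p :: q)) (h' : Valid (j :: p' :: q'))
    (hl : q.length = q'.length) (hn : q.length + 1 < n) 
    (hne : τ.e (i :: p :: q) * τ.s q.length * τ.e (j :: p' :: q') ≠ 0) :
    q = q' ∧ ((i = j ∧ p = p') ∨ (i = p' ∧ j = p ∧ i ≠ j)) := by
  have hqq : q = q' := by
    by_contra hc
    apply hne
    have h1 := (τ.good (p :: q) h.1 (by simp; omega)).cons_right h.1 (by simp; omega) i
    have h2 := (τ.good q h.1.1 (by omega)).cons_right h.1.1 (by omega) p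
    have h3 := (τ.good (p' :: q') h'.1 (by simp; omega)).cons_left h'.1 (by simp; omega) j
    have h4 := (τ.good q' h'.1.1 (by omega)).cons_left h'.1.1 (by omega) p'
    have h5 := τ.s_comm_A hn (τ.e_mem h.1.1 (by omega))
    have h6 := τ.e_ortho h.1.1 h'.1.1 hl (by omega) hc
    rw [← h1, ← h2, ← h3, ← h4]
    have : ∀ a b c f : 𝓐, a * (b * τ.e q) * τ.s q.length * (τ.e q' * c * f) =
      a * b * (τ.e q * τ.s q.length * τ.e q') * c * f := by intros; noncomm_ring
    rw [this, h5, mul_assoc _ (τ.e q), h6]; simp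
  subst hqq
  refine ⟨rfl, ?_⟩
  by_cases hw : i :: p :: q = j :: p' :: q
  · left; simpa using hw
  right
  have hz := τ.e_ortho h h' (by simp) (by simp; omega) hw
  have c1 := τ.core1 h h' rfl hn
  rw [hz] at c1
  have c1 := (smul_eq_zero.mp c1).resolve_right hne
  have hne' : τ.e (j :: p' :: q) * τ.s q.length * τ.e (i :: p :: q) ≠ 0 := by
    intro h0
    apply hne
    have := congrArg star h0
    simpa [star_mul, τ.e_star h (by simp; omega), τ.e_star h' (by simp; omega), τ.s_star _ hn,
      mul_assoc] using this
  have hz' := τ.e_ortho h' h (by simp) (by simp; omega) (Ne.symm hw)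
  have c2 := τ.core1 h' h rfl hn
  rw [hz'] at c2
  have c2 := (smul_eq_zero.mp c2).resolve_right hne'
  have hinj := (cont_strictAnti h.1.1.antitone).injective
  rw [cont_cons] at c1 c2
  by_cases hpi : p = i
  · subst hpi
    rw [if_pos rfl] at c1
    have : p ≠ p' := by rintro rfl; linarith
    exact absurd (by linarith) (cont_not_dbl h this)
  rw [if_neg hpi] at c1
  have e1 : i = p' := hinj (by linarith)
  subst e1
  by_cases hpj : i = j
  · subst hpj
    rw [if_pos rfl] at c2
    exact absurd (by linarith) (cont_not_dbl h' (Ne.symm hpi))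
  rw [if_neg hpj] at c2
  exact ⟨rfl, hinj (by linarith), hpj⟩

theorem core_diag {p i : Fin d} {q : List (Fin d)} (h : Valid (i :: p :: q)) 
    (hn : q.length + 1 < n) : ∃ r : ℝ, τ.e (i :: p :: q) * τ.s q.length * τ.e (i :: p :: q) =
      r • τ.e (i :: p :: q) ∧ (cont (p :: q) i - cont q p) • (r • τ.e (i :: p :: q)) = τ.e (i :: p :: q) := by
  have c1 := τ.core1 h h rfl hn
  rw [τ.e_sq h (by simp; omega)] at c1
  by_cases h0 : cont (p :: q) i - cont q p = 0
  · rw [h0, zero_smul] at c1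
    exact ⟨0, by simp [← c1], by simp [← c1]⟩
  · refine ⟨(cont (p :: q) i - cont q p)⁻¹, ?_, ?_⟩
    · rw [eq_inv_smul_iff₀ h0]; exact c1
    · rw [smul_smul, mul_inv_cancel₀ h0, one_smul]

end Tower
end PBT

end PartD

section PartD2
open Finset Polynomial
namespace PBT
variable {d n : ℕ}
variable {𝓐 : Type*} [Ring 𝓐] [Algebra ℝ 𝓐] [StarRing 𝓐] [StarModule ℝ 𝓐] [Nontrivial 𝓐]
namespace Tower
variable (τ : Tower 𝓐 d n)

theorem swap_ne {i j : Fin d} {q : List (Fin d)} (h : Valid (i :: j :: q)) (h' : Valid (j :: i :: q))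
    (hij : i ≠ j) (hn : q.length + 1 < n) :
    τ.e (i :: j :: q) * τ.s q.length * τ.e (j :: i :: q) ≠ 0 := by
  intro h0
  have hs : τ.s q.length * τ.e (j :: i :: q) =
      τ.e (j :: i :: q) * τ.s q.length * τ.e (j :: i :: q) := by
    have h1 := τ.sum_e (k := q.length + 2) (by omega)
    have h2 : τ.s q.length * τ.e (j :: i :: q) = ∑ w ∈ W d (q.length + 2),
        τ.e w * τ.s q.length * τ.e (j :: i :: q) := by
      rw [← Finset.sum_mul, ← Finset.sum_mul, h1, one_mul]
    rw [h2]
    apply Finset.sum_eq_single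
    · intro w hw hne
      obtain ⟨hv, hl⟩ := mem_W.mp hw
      match w, hv, hl with
      | a :: b :: q', hv, hl =>
        have hl : q'.length = q.length := by simpa using hl
        by_contra hc
        rw [← hl] at hc
        obtain ⟨rfl, h3⟩ := τ.core_ne hv h' hl (by omega) hc
        rcases h3 with ⟨rfl, rfl⟩ | ⟨rfl, rfl, _⟩
        · exact hne rfl
        · exact hc h0
    · intro hc
      exact absurd (mem_W.mpr ⟨h', by simp⟩) hc
  obtain ⟨r, hr1, hr2⟩ := τ.core_diag h' hn
  have hne := τ.e_ne_zero h' (by simp; omega)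
  have h3 : (r * r) • τ.e (j :: i :: q) = τ.e (j :: i :: q) := by
    have : τ.s q.length * (τ.s q.length * τ.e (j :: i :: q)) = τ.e (j :: i :: q) := by
      rw [← mul_assoc, τ.s_sq _ hn, one_mul]
    rw [hs, hr1, mul_smul_comm, hs, hr1, smul_smul] at this
    exact this
  have h4 : r * r = 1 := by
    have : (r * r - 1) • τ.e (j :: i :: q) = 0 := by rw [sub_smul, h3, one_smul, sub_self]
    have := (smul_eq_zero.mp this).resolve_right hne
    linarith
  have h5 : (cont (i :: q) j - cont q i) * r = 1 := by
    have : ((cont (i :: q) j - cont q i) * r - 1) • τ.e (j :: i :: q) = 0 := by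
      rw [sub_smul, one_smul, ← smul_smul, hr2, sub_self]
    have := (smul_eq_zero.mp this).resolve_right hne
    linarith
  rw [cont_cons, if_neg hij, add_zero] at h5
  have h6 : cont q j - cont q i = r := by
    calc cont q j - cont q i = (cont q j - cont q i) * (r * r) := by rw [h4, mul_one]
      _ = r := by rw [← mul_assoc, h5, one_mul]
  have h7 : (r - 1) * (r + 1) = 0 := by linarith
  rcases mul_eq_zero.mp h7 with h8 | h8
  · exact cont_not_succ h.1.1.antitone h'.1.2 hij (by linarith)
  · exact cont_not_succ h.1.1.antitone h.1.2 hij.symm (by linarith)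

structure Lev (k : ℕ) : Prop where
  D : ∀ w ∈ W d k, ∀ w' ∈ W d k, sh w ≠ sh w' → ∀ a ∈ τ.A k, τ.e w * a * τ.e w' = 0
  S : ∀ w ∈ W d k, ∀ a ∈ τ.A k, ∃ t : ℝ, τ.e w * a * τ.e w = t • τ.e w
  C : ∀ w ∈ W d k, ∀ w' ∈ W d k, sh w = sh w' → ∃ a ∈ τ.A k, τ.e w * a * τ.e w' ≠ 0

variable {τ}
theorem Lev.iso {k : ℕ} (hk : k ≤ n) (hL : τ.Lev k) {w w' : List (Fin d)} (hw : w ∈ W d k)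
    (hw' : w' ∈ W d k) (hs : sh w = sh w') :
    ∃ x ∈ τ.A k, τ.e w * x = x ∧ x * τ.e w' = x ∧ star x * x = τ.e w' ∧ x * star x = τ.e w := by
  obtain ⟨a, ha, hne⟩ := hL.C w hw w' hw' hs
  obtain ⟨hv, hl⟩ := mem_W.mp hw
  obtain ⟨hv', hl'⟩ := mem_W.mp hw'
  have st := τ.e_star hv (by omega)
  have st' := τ.e_star hv' (by omega)
  have sq := τ.e_sq hv (by omega)
  have sq' := τ.e_sq hv' (by omega)
  have me : τ.e w ∈ τ.A k := hl ▸ τ.e_mem hv (by omega)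
  have me' : τ.e w' ∈ τ.A k := hl' ▸ τ.e_mem hv' (by omega)
  set y := τ.e w * a * τ.e w' with hy
  have hym : y ∈ τ.A k := mul_mem (mul_mem me ha) me'
  have hsm := τ.A_star hk hym
  have ly : τ.e w * y = y := by rw [hy, mul_assoc, ← mul_assoc, sq]
  have ry : y * τ.e w' = y := by rw [hy, mul_assoc, sq']
  have ly' : τ.e w' * star y = star y := by
    conv_rhs => rw [← ry, star_mul, st']
  have ry' : star y * τ.e w = star y := by
    conv_rhs => rw [← ly, star_mul, st]
  obtain ⟨t, ht⟩ := hL.S w' hw' (star y * y) (mul_mem hsm hym)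
  rw [← mul_assoc, ly', mul_assoc, ry] at ht
  obtain ⟨t', ht'⟩ := hL.S w hw (y * star y) (mul_mem hym hsm)
  rw [← mul_assoc, ly, mul_assoc, ry'] at ht'
  have htt : t = t' := by
    have h1 : y * (star y * y) = t • y := by rw [ht, mul_smul_comm, ry]
    have h2 : (y * star y) * y = t' • y := by rw [ht', smul_mul_assoc, ly]
    rw [← mul_assoc, h2] at h1
    have : (t' - t) • y = 0 := by rw [sub_smul, h1, sub_self]
    have := (smul_eq_zero.mp this).resolve_right hne
    linarith
  subst htt
  have htpos : 0 < t := by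
    by_contra hc
    apply hne
    apply τ.pos y (Real.sqrt (-t) • τ.e w')
    rw [star_smul, star_trivial (Real.sqrt (-t)), st', smul_mul_smul_comm, Real.mul_self_sqrt (by linarith), sq', ht,
      ← add_smul, add_neg_cancel, zero_smul]
  have hq : (Real.sqrt t)⁻¹ * (Real.sqrt t)⁻¹ * t = 1 := by
    have := Real.mul_self_sqrt htpos.le
    rw [← mul_inv, this, inv_mul_cancel₀ htpos.ne']
  refine ⟨(Real.sqrt t)⁻¹ • y, (τ.A k).smul_mem hym _, ?_, ?_, ?_, ?_⟩
  · rw [mul_smul_comm, ly]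
  · rw [smul_mul_assoc, ry]
  · rw [star_smul, star_trivial, smul_mul_smul_comm, ht, smul_smul, hq, one_smul]
  · rw [star_smul, star_trivial, smul_mul_smul_comm, ht', smul_smul, hq, one_smul]

theorem exists_common {i j : Fin d} {v v' : List (Fin d)} (h : Valid (i :: v)) (h' : Valid (j :: v'))
    (hs : sh (i :: v) = sh (j :: v')) (hij : i ≠ j) : ∃ q, Valid (i :: j :: q) ∧ Valid (j :: i :: q) ∧
      sh v = sh (j :: q) ∧ sh v' = sh (i :: q) := by
  have hanti : Antitone (fun l => min (sh v l) (sh v' l)) := by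
    intro a b hab
    exact min_le_min (h.1.antitone hab) (h'.1.antitone hab)
  obtain ⟨q, hq, -, hsq⟩ := exists_word _ _ hanti rfl
  have key : ∀ l, sh v l + (if i = l then 1 else 0) = sh v' l + (if j = l then 1 else 0) := by
    intro l
    have := congrFun hs l
    rwa [sh_cons, sh_cons] at this
  have e1 : sh v = sh (j :: q) := by
    funext l
    rw [sh_cons, hsq]
    have := key l
    by_cases h1 : i = l
    · have h2 : j ≠ l := fun h2 => hij (h1.trans h2.symm)
      rw [if_pos h1, if_neg h2] at this
      rw [if_neg h2]
      show _ = min _ _ + 0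
      omega
    · rw [if_neg h1] at this
      show _ = min _ _ + _
      split_ifs at this ⊢ <;> omega
  have e2 : sh v' = sh (i :: q) := by
    funext l
    rw [sh_cons, hsq]
    have := key l
    by_cases h1 : j = l
    · have h2 : i ≠ l := fun h2 => hij (h2.trans h1.symm)
      rw [if_pos h1, if_neg h2] at this
      rw [if_neg h2]
      show _ = min _ _ + 0
      omega
    · rw [if_neg h1] at this
      show _ = min _ _ + _
      split_ifs at this ⊢ <;> omega
  have e3 : sh (i :: j :: q) = sh (i :: v) := by
    funext l; rw [sh_cons, ← e1, ← sh_cons]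
  have e4 : sh (j :: i :: q) = sh (j :: v') := by
    funext l; rw [sh_cons, ← e2, ← sh_cons]
  refine ⟨q, ⟨⟨hq, ?_⟩, ?_⟩, ⟨⟨hq, ?_⟩, ?_⟩, e1, e2⟩
  · rw [← e1]; exact h.1.antitone
  · rw [e3]; exact h.antitone
  · rw [← e2]; exact h'.1.antitone
  · rw [e4]; exact h'.antitone

variable (τ)

theorem lev_base {k : ℕ} (hk : k ≤ 1) (hn : k ≤ n) : τ.Lev k := by
  have huniq : ∀ w ∈ W d k, ∀ w' ∈ W d k, w = w' := by
    intro w hw w' hw'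
    obtain ⟨hv, hl⟩ := mem_W.mp hw
    obtain ⟨hv', hl'⟩ := mem_W.mp hw'
    exact valid_le_one hv hv' (hl.trans hl'.symm) (by omega)
  refine ⟨?_, ?_, ?_⟩
  · intro w hw w' hw' hs
    exact absurd (by rw [huniq w hw w' hw']) hs
  · intro w hw a ha
    obtain ⟨hv, hl⟩ := mem_W.mp hw
    obtain ⟨r, rfl⟩ := τ.A_scalar hk ha
    exact ⟨r, by rw [mul_smul_comm, mul_one, smul_mul_assoc, τ.e_sq hv (by omega)]⟩
  · intro w hw w' hw' hs
    obtain ⟨hv, hl⟩ := mem_W.mp hw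
    rw [← huniq w hw w' hw']
    exact ⟨1, one_mem _, by rw [mul_one, τ.e_sq hv (by omega)]; exact τ.e_ne_zero hv (by omega)⟩

theorem insert_sum {k : ℕ} (hk : k ≤ n) (x b s c y : 𝓐) :
    x * (b * s * c) * y = ∑ u ∈ W d k, ∑ u' ∈ W d k, (x * b * τ.e u) * s * (τ.e u' * c * y) := by
  have h1 := τ.sum_e hk
  simp only [← Finset.mul_sum, ← Finset.sum_mul, h1]
  noncomm_ring

/-- left and right carry for terms in the sum -/
theorem term_eq {k : ℕ} (hL : τ.Lev k) (hk : k < n) {i j : Fin d} {v v' u u' : List (Fin d)}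
    (h : Valid (i :: v)) (h' : Valid (j :: v')) (hv : v ∈ W d k) (hv' : v' ∈ W d k)
    (hu : u ∈ W d k) (hu' : u' ∈ W d k) {b c : 𝓐} (hb : b ∈ τ.A k) (hc : c ∈ τ.A k) (s : 𝓐)
    (hne : (τ.e (i :: v) * b * τ.e u) * s * (τ.e u' * c * τ.e (j :: v')) ≠ 0) :
    sh u = sh v ∧ sh u' = sh v' ∧ Valid (i :: u) ∧ Valid (j :: u') ∧
    (τ.e (i :: v) * b * τ.e u) * s * (τ.e u' * c * τ.e (j :: v')) =
      τ.e v * b * (τ.e (i :: u) * s * τ.e (j :: u')) * c * τ.e v' := by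
  obtain ⟨vv, lv⟩ := mem_W.mp hv
  obtain ⟨vv', lv'⟩ := mem_W.mp hv'
  obtain ⟨vu, lu⟩ := mem_W.mp hu
  obtain ⟨vu', lu'⟩ := mem_W.mp hu'
  have h1 := (τ.good v vv (by omega)).cons_right vv (by omega) i
  have h2 := (τ.good v' vv' (by omega)).cons_left vv' (by omega) j
  have s1 : sh u = sh v := by
    by_contra hs
    apply hne
    rw [← h1, mul_assoc (τ.e (i :: v)), mul_assoc (τ.e (i :: v)), hL.D v hv u hu (Ne.symm hs) b hb]
    simp
  have s2 : sh u' = sh v' := by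
    by_contra hs
    apply hne
    rw [← h2, ← mul_assoc _ (τ.e v'), hL.D u' hu' v' hv' hs c hc]
    simp
  have e1 := τ.carry vv vu (by omega) s1 (by rwa [lv]) i (b := b)
  have e2 := τ.carry vu' vv' (by omega) s2.symm (by rwa [lu']) j (b := c)
  refine ⟨s1, s2, ⟨vu, ?_⟩, ⟨vu', ?_⟩, ?_⟩
  · have : sh (i :: u) = sh (i :: v) := by funext l; rw [sh_cons, s1, ← sh_cons]
    rw [this]; exact h.2
  · have : sh (j :: u') = sh (j :: v') := by funext l; rw [sh_cons, s2, ← sh_cons]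
    rw [this]; exact h'.2
  · rw [e1, ← e2]; noncomm_ring

theorem lev_step {k : ℕ} (hk : k + 1 < n) (hL : τ.Lev (k+1)) : τ.Lev (k+2) := by
  have hn1 : k + 1 ≤ n := by omega
  refine ⟨?_, ?_, ?_⟩
  · intro w hw w' hw' hs a ha
    obtain ⟨hv, hl⟩ := mem_W.mp hw
    obtain ⟨hv', hl'⟩ := mem_W.mp hw'
    match w, w', hv, hv', hl, hl', hs with
    | i :: v, j :: v', hv, hv', hl, hl', hs =>
    have lv : v.length = k + 1 := by simpa using hl
    have lv' : v'.length = k + 1 := by simpa using hl'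
    have mv : v ∈ W d (k+1) := mem_W.mpr ⟨hv.1, lv⟩
    have mv' : v' ∈ W d (k+1) := mem_W.mpr ⟨hv'.1, lv'⟩
    have h1 := (τ.good v hv.1 (by omega)).cons_right hv.1 (by omega) i
    have h2 := (τ.good v' hv'.1 (by omega)).cons_left hv'.1 (by omega) j
    refine τ.coset_ind hk (fun a => τ.e (i :: v) * a * τ.e (j :: v') = 0) ?_ ?_ ?_ ?_ ha
    · intro b hb; beta_reduce
      by_cases hs' : sh v' = sh v
      · rw [← h2, ← mul_assoc, τ.carry hv.1 hv'.1 (by omega) hs' (by rwa [lv]), mul_assoc,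
          (τ.good v' hv'.1 (by omega)).cons_mul hv'.1 (by omega), if_neg, mul_zero]
        rintro rfl
        apply hs
        funext l; rw [sh_cons, ← hs', ← sh_cons]
      · rw [← h1, ← h2]
        have : ∀ x y : 𝓐, x * τ.e v * b * (τ.e v' * y) = x * (τ.e v * b * τ.e v') * y := by
          intros; noncomm_ring
        rw [this, hL.D v mv v' mv' (Ne.symm hs') b hb]; simp
    · intro b hb c hc; beta_reduce
      rw [τ.insert_sum hn1]
      apply Finset.sum_eq_zero; intro u hu
      apply Finset.sum_eq_zero; intro u' hu'
      by_contra hne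
      obtain ⟨s1, s2, v1, v2, he⟩ := τ.term_eq hL hk hv hv' mv mv' hu hu' hb hc _ hne
      rw [he] at hne
      have hne' : τ.e (i :: u) * τ.s k * τ.e (j :: u') ≠ 0 := by
        intro h0; rw [h0] at hne; simp at hne
      obtain ⟨vu, lu⟩ := mem_W.mp hu
      obtain ⟨vu', lu'⟩ := mem_W.mp hu'
      match u, u', lu, lu', v1, v2, hne', s1, s2 with
      | p :: q, p' :: q', lu, lu', v1, v2, hne', s1, s2 =>
      have lq : q.length = k := by simpa using lu
      have lq' : q'.length = k := by simpa using lu'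
      rw [← lq] at hne'
      obtain ⟨rfl, h3⟩ := τ.core_ne v1 v2 (by omega) (by omega) hne'
      apply hs
      funext l
      rw [sh_cons, sh_cons, ← s1, ← s2, sh_cons, sh_cons]
      rcases h3 with ⟨rfl, rfl⟩ | ⟨rfl, rfl, _⟩
      · rfl
      · omega
    · intro x y hx hy; beta_reduce at hx hy ⊢; rw [mul_add, add_mul, hx, hy, add_zero]
    · intro r x hx; beta_reduce at hx ⊢; rw [mul_smul_comm, smul_mul_assoc, hx, smul_zero]
  · intro w hw a ha
    obtain ⟨hv, hl⟩ := mem_W.mp hw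
    match w, hv, hl with
    | i :: v, hv, hl =>
    have lv : v.length = k + 1 := by simpa using hl
    have mv : v ∈ W d (k+1) := mem_W.mpr ⟨hv.1, lv⟩
    have hg := τ.good v hv.1 (by omega)
    have h1 := hg.cons_right hv.1 (by omega) i
    have h2 := hg.cons_left hv.1 (by omega) i
    have hsq := τ.e_sq hv (by omega)
    have base : ∀ b ∈ τ.A (k+1), ∃ t : ℝ, τ.e (i :: v) * b * τ.e (i :: v) = t • τ.e (i :: v) := by
      intro b hb
      obtain ⟨t, ht⟩ := hL.S v mv b hb
      refine ⟨t, ?_⟩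
      calc τ.e (i :: v) * b * τ.e (i :: v)
          = (τ.e (i :: v) * τ.e v) * b * (τ.e v * τ.e (i :: v)) := by rw [h1, h2]
        _ = τ.e (i :: v) * (τ.e v * b * τ.e v) * τ.e (i :: v) := by noncomm_ring
        _ = _ := by rw [ht, mul_smul_comm, h1, smul_mul_assoc, hsq]
    refine τ.coset_ind hk (fun a => ∃ t : ℝ, τ.e (i :: v) * a * τ.e (i :: v) = t • τ.e (i :: v)) ?_ ?_ ?_ ?_ ha
    · intro b hb; beta_reduce; exact base b hb
    · intro b hb c hc; beta_reduce
      rw [τ.insert_sum hn1]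
      have hterm : ∀ u ∈ W d (k+1), ∀ u' ∈ W d (k+1), ∃ t : ℝ,
          (τ.e (i :: v) * b * τ.e u) * τ.s k * (τ.e u' * c * τ.e (i :: v)) = t • τ.e (i :: v) := by
        intro u hu u' hu'
        by_cases hne : (τ.e (i :: v) * b * τ.e u) * τ.s k * (τ.e u' * c * τ.e (i :: v)) = 0
        · exact ⟨0, by rw [hne, zero_smul]⟩
        obtain ⟨s1, s2, v1, v2, he⟩ := τ.term_eq hL hk hv hv mv mv hu hu' hb hc _ hne
        rw [he] at hne ⊢
        have hne' : τ.e (i :: u) * τ.s k * τ.e (i :: u') ≠ 0 := by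
          intro h0; rw [h0] at hne; simp at hne
        obtain ⟨vu, lu⟩ := mem_W.mp hu
        obtain ⟨vu', lu'⟩ := mem_W.mp hu'
        match u, u', lu, lu', v1, v2, hne', s1, s2, vu with
        | p :: q, p' :: q', lu, lu', v1, v2, hne', s1, s2, vu =>
        have lq : q.length = k := by simpa using lu
        have lq' : q'.length = k := by simpa using lu'
        rw [← lq] at hne'
        obtain ⟨rfl, h3⟩ := τ.core_ne v1 v2 (by omega) (by omega) hne'
        have h4 : p = p' := by
          rcases h3 with h3 | h3
          · exact h3.2
          · exact absurd rfl h3.2.2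
        subst h4
        obtain ⟨r, hr, -⟩ := τ.core_diag v1 (by omega)
        rw [← lq, hr]
        obtain ⟨t, ht⟩ := base (b * τ.e (p :: q) * c)
          (mul_mem (mul_mem hb (by have := τ.e_mem vu (by omega); rwa [lu] at this)) hc)
        refine ⟨r * t, ?_⟩
        have e1 := τ.carry hv.1 vu (by omega) s1 (by rwa [lv]) i (b := b)
        have e2 := τ.carry vu hv.1 (by omega) s1.symm (by rwa [lu]) i (b := c)
        have gu := τ.good (p :: q) vu (by omega)
        have e3 := gu.cons_mul vu (by omega) i i
        rw [if_pos rfl] at e3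
        calc τ.e v * b * r • τ.e (i :: p :: q) * c * τ.e v 
            = r • (τ.e v * b * τ.e (i :: p :: q) * c * τ.e v) := by
              rw [mul_smul_comm, smul_mul_assoc, smul_mul_assoc]
          _ = r • ((τ.e v * b * τ.e (i :: p :: q)) * (τ.e (i :: p :: q) * c * τ.e v)) := by
              conv_lhs => rw [← e3]
              congr 1; noncomm_ring
          _ = r • ((τ.e (i :: v) * b * τ.e (p :: q)) * (τ.e (p :: q) * c * τ.e (i :: v))) := by
              rw [e1, e2]
          _ = r • (τ.e (i :: v) * (b * (τ.e (p :: q) * τ.e (p :: q)) * c) * τ.e (i :: v)) := by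
              congr 1; noncomm_ring
          _ = _ := by rw [gu.sq, ht, smul_smul]
      choose! t ht using hterm
      refine ⟨∑ u ∈ W d (k+1), ∑ u' ∈ W d (k+1), t u u', ?_⟩
      rw [Finset.sum_smul]
      apply Finset.sum_congr rfl; intro u hu
      rw [Finset.sum_smul]
      apply Finset.sum_congr rfl; intro u' hu'
      exact ht u hu u' hu'
    · intro x y hx hy; beta_reduce at hx hy ⊢
      obtain ⟨t, ht⟩ := hx
      obtain ⟨t', ht'⟩ := hy
      exact ⟨t + t', by rw [mul_add, add_mul, ht, ht', add_smul]⟩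
    · intro r x hx; beta_reduce at hx ⊢
      obtain ⟨t, ht⟩ := hx
      exact ⟨r * t, by rw [mul_smul_comm, smul_mul_assoc, ht, smul_smul]⟩
  · intro w hw w' hw' hs
    obtain ⟨hv, hl⟩ := mem_W.mp hw
    obtain ⟨hv', hl'⟩ := mem_W.mp hw'
    match w, w', hv, hv', hl, hl', hs with
    | i :: v, j :: v', hv, hv', hl, hl', hs =>
    have lv : v.length = k + 1 := by simpa using hl
    have lv' : v'.length = k + 1 := by simpa using hl'
    have mv : v ∈ W d (k+1) := mem_W.mpr ⟨hv.1, lv⟩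
    have mv' : v' ∈ W d (k+1) := mem_W.mpr ⟨hv'.1, lv'⟩
    have h1 := (τ.good v hv.1 (by omega)).cons_right hv.1 (by omega) i
    have h2 := (τ.good v' hv'.1 (by omega)).cons_left hv'.1 (by omega) j
    by_cases hij : i = j
    · subst hij
      have hs' : sh v = sh v' := by
        funext l
        have := congrFun hs l
        rw [sh_cons, sh_cons] at this
        omega
      obtain ⟨x, hx, lx, rx, sx, -⟩ := hL.iso hn1 mv mv' hs'
      refine ⟨x, τ.A_mono (by omega) hx, ?_⟩
      intro h0
      have e1 : τ.e (i :: v) * x * τ.e (i :: v') = x * τ.e (i :: v') := by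
        have := τ.carry hv.1 hv'.1 (by omega) hs'.symm (by rwa [lv]) i (b := x)
        rw [lx, mul_assoc, rx] at this
        rw [this, mul_assoc, τ.e_sq hv' (by omega)]
      have e2 : star x * (x * τ.e (i :: v')) = τ.e (i :: v') := by
        rw [← mul_assoc, sx, h2]
      rw [← e1, h0, mul_zero] at e2
      exact τ.e_ne_zero hv' (by omega) e2.symm
    · obtain ⟨q, vq, vq', s1, s2⟩ := exists_common hv hv' hs hij
      have lq : q.length = k := by
        have := length_eq_sum v
        rw [s1, ← length_eq_sum] at this
        simp at this; omega
      have mq : j :: q ∈ W d (k+1) := mem_W.mpr ⟨vq.1, by simp [lq]⟩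
      have mq' : i :: q ∈ W d (k+1) := mem_W.mpr ⟨vq'.1, by simp [lq]⟩
      obtain ⟨x, hx, lx, rx, sx, -⟩ := hL.iso hn1 mv mq s1
      obtain ⟨y, hy, ly, ry, -, sy⟩ := hL.iso hn1 mq' mv' s2.symm
      have hsw := τ.swap_ne vq vq' hij (by omega)
      rw [lq] at hsw
      have hs : τ.s k ∈ τ.A (k+2) := τ.s_mem (by omega)
      refine ⟨x * τ.s k * y, mul_mem (mul_mem (τ.A_mono (by omega) hx) hs) (τ.A_mono (by omega) hy), ?_⟩
      intro h0
      have e1 := τ.carry hv.1 vq.1 (by omega) s1.symm (by rwa [lv]) i (b := x)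
      have e2 := τ.carry vq'.1 hv'.1 (by simp; omega) s2 (by simpa [lq] using hy) j (b := y)
      have g1 := τ.good (j :: q) vq.1 (by simp; omega)
      have g2 := τ.good (i :: q) vq'.1 (by simp; omega)
      have f1 := g1.cons_left vq.1 (by simp; omega) i
      have f2 := g2.cons_right vq'.1 (by simp; omega) j
      rw [lx] at e1
      rw [mul_assoc _ y, ry] at e2
      apply hsw
      calc τ.e (i :: j :: q) * τ.s k * τ.e (j :: i :: q)
          = star x * ((x * τ.e (i :: j :: q)) * τ.s k * (τ.e (j :: i :: q) * y)) * star y := by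
            have : star x * ((x * τ.e (i :: j :: q)) * τ.s k * (τ.e (j :: i :: q) * y)) * star y =
              (star x * x) * τ.e (i :: j :: q) * τ.s k * τ.e (j :: i :: q) * (y * star y) := by
              noncomm_ring
            rw [this, sx, sy, f1, mul_assoc _ _ (τ.e (i :: q)), f2]
        _ = star x * (τ.e (i :: v) * x * τ.e (j :: q) * τ.s k * (τ.e (i :: q) * (y * τ.e (j :: v')))) * star y := by
            rw [e1, e2]; noncomm_ring
        _ = star x * (τ.e (i :: v) * (x * τ.e (j :: q)) * τ.s k * ((τ.e (i :: q) * y) * τ.e (j :: v'))) * star y := by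
            noncomm_ring
        _ = star x * (τ.e (i :: v) * (x * τ.s k * y) * τ.e (j :: v')) * star y := by
            rw [rx, ly]; noncomm_ring
        _ = 0 := by rw [h0]; simp

theorem lev (k : ℕ) (hk : k ≤ n) : τ.Lev k := by
  induction k with
  | zero => exact τ.lev_base (by omega) hk
  | succ k ih =>
    cases k with
    | zero => exact τ.lev_base (by omega) hk
    | succ k => exact τ.lev_step (by omega) (ih (by omega))

end Tower
end PBT

end PartD2

section PartE
open Finset Polynomial
namespace PBT
variable {d N : ℕ}

open scoped Classical in
/-- canonical word of a given shape -/
noncomputable def rep (κ : Fin d → ℕ) : List (Fin d) :=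
  if h : ∃ w, Valid w ∧ sh w = κ then h.choose else []

theorem rep_spec {w : List (Fin d)} (h : Valid w) : Valid (rep (sh w)) ∧ sh (rep (sh w)) = sh w := by
  have h' : ∃ u, Valid u ∧ sh u = sh w := ⟨w, h, rfl⟩
  rw [rep, dif_pos h']
  exact h'.choose_spec

theorem rep_mem {k : ℕ} {w : List (Fin d)} (h : w ∈ W d k) : rep (sh w) ∈ W d k := by
  obtain ⟨hv, hl⟩ := mem_W.mp h
  have := rep_spec hv
  refine mem_W.mpr ⟨this.1, ?_⟩
  rw [length_eq_sum, this.2, ← length_eq_sum, hl]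

theorem sh_cons_congr {v v' : List (Fin d)} (h : sh v = sh v') (i : Fin d) :
    sh (i :: v) = sh (i :: v') := by
  funext l; rw [sh_cons, h, ← sh_cons]

theorem valid_cons_congr {v v' : List (Fin d)} (h : sh v = sh v') {i : Fin d} (hv : Valid (i :: v))
    (hv' : Valid v') : Valid (i :: v') :=
  ⟨hv', sh_cons_congr h i ▸ hv.2⟩

open scoped Classical in
/-- valid words of length `N` whose tail is canonical -/
noncomputable def TS (d k : ℕ) : Finset (List (Fin d)) :=
  (W d (k+1)).filter (fun T => T.tail = rep (sh T.tail))

open scoped Classical in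
/-- canonical words -/
noncomputable def V0 (d k : ℕ) : Finset (List (Fin d)) :=
  (W d k).filter (fun v => v = rep (sh v))

theorem mem_TS {k : ℕ} {i : Fin d} {v : List (Fin d)} :
    i :: v ∈ TS d k ↔ Valid (i :: v) ∧ v ∈ V0 d k := by
  simp only [TS, V0, mem_filter, mem_W, List.tail_cons, List.length_cons, add_left_inj]
  exact ⟨fun h => ⟨h.1.1, ⟨h.1.1.1, h.1.2⟩, h.2⟩, fun h => ⟨⟨h.1, h.2.1.2⟩, h.2.2⟩⟩

theorem mem_V0 {k : ℕ} {v : List (Fin d)} : v ∈ V0 d k ↔ v ∈ W d k ∧ v = rep (sh v) := by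
  simp [V0]

theorem rep_mem_V0 {k : ℕ} {w : List (Fin d)} (h : w ∈ W d k) : rep (sh w) ∈ V0 d k := by
  rw [mem_V0]
  refine ⟨rep_mem h, ?_⟩
  rw [(rep_spec (mem_W.mp h).1).2]

theorem exists_cons_of_mem {k : ℕ} {T : List (Fin d)} (h : T ∈ W d (k+1)) :
    ∃ i v, T = i :: v ∧ v ∈ W d k ∧ Valid (i :: v) := by
  obtain ⟨hv, hl⟩ := mem_W.mp h
  cases T with
  | nil => simp at hl
  | cons i v => exact ⟨i, v, rfl, mem_W.mpr ⟨hv.1, by simpa using hl⟩, hv⟩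

open scoped Classical in
theorem sum_TS {M : Type*} [AddCommMonoid M] (k : ℕ) (f : List (Fin d) → M) :
    ∑ w ∈ TS d k, f w = ∑ w ∈ V0 d k, ∑ i, if Valid (i :: w) then f (i :: w) else 0 := by
  rw [TS, Finset.sum_filter, sum_W, V0, Finset.sum_filter]
  apply Finset.sum_congr rfl
  intro w _
  by_cases h : w = rep (sh w)
  · rw [if_pos h]
    apply Finset.sum_congr rfl
    intro i _
    by_cases hv : Valid (i :: w)
    · rw [if_pos hv, if_pos hv]; exact if_pos h
    · rw [if_neg hv, if_neg hv]
  · rw [if_neg h]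
    apply Finset.sum_eq_zero
    intro i _
    by_cases hv : Valid (i :: w)
    · rw [if_pos hv]; exact if_neg h
    · rw [if_neg hv]

variable {𝓐 : Type*} [Ring 𝓐] [Algebra ℝ 𝓐] [StarRing 𝓐] [StarModule ℝ 𝓐] [Nontrivial 𝓐]
namespace Tower
variable (τ : Tower 𝓐 d N)

open scoped Classical in
noncomputable def x (w : List (Fin d)) : 𝓐 :=
  if h : w ∈ W d N then
    ((τ.lev N le_rfl).iso le_rfl h (rep_mem h) (rep_spec (mem_W.mp h).1).2.symm).choose
  else 0

variable {τ}
theorem x_spec {w : List (Fin d)} (h : w ∈ W d N) : τ.x w ∈ τ.A N ∧ τ.e w * τ.x w = τ.x w ∧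
    τ.x w * τ.e (rep (sh w)) = τ.x w ∧ star (τ.x w) * τ.x w = τ.e (rep (sh w)) ∧
    τ.x w * star (τ.x w) = τ.e w := by
  rw [x, dif_pos h]
  exact ((τ.lev N le_rfl).iso le_rfl h (rep_mem h) (rep_spec (mem_W.mp h).1).2.symm).choose_spec

theorem xs_e {w : List (Fin d)} (h : w ∈ W d N) : star (τ.x w) * τ.e w = star (τ.x w) := by
  obtain ⟨hv, hl⟩ := mem_W.mp h
  conv_rhs => rw [← (x_spec h).2.1, star_mul, τ.e_star hv (by omega)]

theorem e_xs {w : List (Fin d)} (h : w ∈ W d N) :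
    τ.e (rep (sh w)) * star (τ.x w) = star (τ.x w) := by
  obtain ⟨hv, hl⟩ := mem_W.mp (rep_mem h)
  conv_rhs => rw [← (x_spec h).2.2.1, star_mul, τ.e_star hv (by omega)]

/-- matrix coefficients -/
theorem coeff {w w' : List (Fin d)} (h : w ∈ W d N) (h' : w' ∈ W d N) (hs : sh w = sh w') {a : 𝓐}
    (ha : a ∈ τ.A N) : ∃ c : ℝ, star (τ.x w) * a * τ.x w' = c • τ.e (rep (sh w)) := by
  have hm : star (τ.x w) * a * τ.x w' ∈ τ.A N :=
    mul_mem (mul_mem (τ.A_star le_rfl (x_spec h).1) ha) (x_spec h').1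
  obtain ⟨c, hc⟩ := (τ.lev N le_rfl).S _ (rep_mem h) _ hm
  refine ⟨c, ?_⟩
  rw [← hc]
  have h1 := e_xs (τ := τ) h
  have h2 := (x_spec (τ := τ) h').2.2.1
  rw [← hs] at h2
  calc _ = (τ.e (rep (sh w)) * star (τ.x w)) * a * (τ.x w' * τ.e (rep (sh w))) := by rw [h1, h2]
    _ = _ := by noncomm_ring

theorem coeff_zero {w w' : List (Fin d)} (h : w ∈ W d N) (h' : w' ∈ W d N) (hs : sh w ≠ sh w') {a : 𝓐}
    (ha : a ∈ τ.A N) : τ.e w * a * τ.x w' = 0 := by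
  rw [← (x_spec (τ := τ) h').2.1, ← mul_assoc, (τ.lev N le_rfl).D w h w' h' hs a ha, zero_mul]

open scoped Classical in
/-- operators `∑ x_w Q(sh w) x_w^*` commute with the tower algebra -/
theorem central (Q : (Fin d → ℕ) → 𝓐) {a : 𝓐} (ha : a ∈ τ.A N) :
    a * ∑ w ∈ W d N, τ.x w * Q (sh w) * star (τ.x w) =
      (∑ w ∈ W d N, τ.x w * Q (sh w) * star (τ.x w)) * a := by
  have h1 : ∀ w ∈ W d N, ∀ w' ∈ W d N, ∃ c : ℝ, sh w = sh w' →
      star (τ.x w) * a * τ.x w' = c • τ.e (rep (sh w)) := by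
    intro w hw w' hw'
    by_cases hs : sh w = sh w'
    · obtain ⟨c, hc⟩ := coeff (τ := τ) hw hw' hs ha
      exact ⟨c, fun _ => hc⟩
    · exact ⟨0, fun h => absurd h hs⟩
  choose! c hc using h1
  have hsum := τ.sum_e (k := N) le_rfl
  have hl : ∀ w ∈ W d N, a * τ.x w = ∑ w' ∈ W d N, if sh w' = sh w then c w' w • τ.x w' else 0 := by
    intro w hw
    calc a * τ.x w = (∑ w' ∈ W d N, τ.e w') * a * τ.x w := by rw [hsum, one_mul]
      _ = ∑ w' ∈ W d N, τ.e w' * a * τ.x w := by rw [Finset.sum_mul, Finset.sum_mul]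
      _ = _ := by
        apply Finset.sum_congr rfl
        intro w' hw'
        split_ifs with hs
        · have := hc w' hw' w hw hs
          rw [← (x_spec (τ := τ) hw').2.2.2.2, mul_assoc, mul_assoc, ← mul_assoc _ a, this,
            mul_smul_comm, (x_spec (τ := τ) hw').2.2.1]
        · exact coeff_zero hw' hw hs ha
  have hr : ∀ w ∈ W d N, star (τ.x w) * a = ∑ w' ∈ W d N, if sh w' = sh w then c w w' • star (τ.x w') else 0 := by
    intro w hw
    calc star (τ.x w) * a = star (τ.x w) * a * (∑ w' ∈ W d N, τ.e w') := by rw [hsum, mul_one]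
      _ = ∑ w' ∈ W d N, star (τ.x w) * a * τ.e w' := by rw [Finset.mul_sum]
      _ = _ := by
        apply Finset.sum_congr rfl
        intro w' hw'
        rw [← (x_spec (τ := τ) hw').2.2.2.2, ← mul_assoc]
        split_ifs with hs
        · have := hc w hw w' hw' hs.symm
          rw [this, smul_mul_assoc, ← hs, e_xs hw']
        · have h2 : star (τ.x w) * a * τ.x w' = star (τ.x w) * (τ.e w * a * τ.x w') := by
            conv_lhs => rw [← xs_e hw]
            noncomm_ring
          rw [h2, coeff_zero hw hw' (Ne.symm hs) ha]; simp
  have e1 : a * ∑ w ∈ W d N, τ.x w * Q (sh w) * star (τ.x w) =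
      ∑ w ∈ W d N, ∑ w' ∈ W d N, if sh w' = sh w then c w' w • (τ.x w' * Q (sh w) * star (τ.x w)) else 0 := by
    rw [Finset.mul_sum]
    apply Finset.sum_congr rfl
    intro w hw
    rw [← mul_assoc, ← mul_assoc, hl w hw, Finset.sum_mul, Finset.sum_mul]
    apply Finset.sum_congr rfl
    intro w' _
    split_ifs
    · rw [smul_mul_assoc, smul_mul_assoc]
    · simp
  have e2 : (∑ w ∈ W d N, τ.x w * Q (sh w) * star (τ.x w)) * a =
      ∑ w ∈ W d N, ∑ w' ∈ W d N, if sh w' = sh w then c w w' • (τ.x w * Q (sh w) * star (τ.x w')) else 0 := by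
    rw [Finset.sum_mul]
    apply Finset.sum_congr rfl
    intro w hw
    rw [mul_assoc, hr w hw, Finset.mul_sum]
    apply Finset.sum_congr rfl
    intro w' _
    split_ifs
    · rw [mul_smul_comm]
    · simp
  rw [e1, e2, Finset.sum_comm]
  apply Finset.sum_congr rfl
  intro w _
  apply Finset.sum_congr rfl
  intro w' _
  by_cases h : sh w = sh w'
  · rw [if_pos h, if_pos h.symm, h]
  · rw [if_neg h, if_neg (Ne.symm h)]

end Tower
end PBT

end PartE

section PartE2
open Finset Polynomial
namespace PBT
variable {d k : ℕ}
variable {𝓐 : Type*} [Ring 𝓐] [Algebra ℝ 𝓐] [StarRing 𝓐] [StarModule ℝ 𝓐]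

/-- the port operator and partial trace over the dual site -/
structure Port (τ : Tower 𝓐 d (k+1)) where
  P : 𝓐
  P_star : star P = P
  P_sq : P * P = (d : ℝ) • P
  P_comm : ∀ j, j + 1 < k → τ.s j * P = P * τ.s j
  P_s : ∀ j, j + 1 = k → P * τ.s j * P = P
  F : 𝓐 →ₗ[ℝ] 𝓐
  F_left : ∀ j, j + 1 < k + 1 → ∀ x, F (τ.s j * x) = τ.s j * F x
  F_right : ∀ j, j + 1 < k + 1 → ∀ x, F (x * τ.s j) = F x * τ.s j
  F_P : F P = 1

namespace Port
variable {τ : Tower 𝓐 d (k+1)} (π : Port τ)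

theorem comm_A {a : 𝓐} (ha : a ∈ τ.A k) : a * π.P = π.P * a := τ.comm_of_gen π.P_comm ha

theorem F_left' {a : 𝓐} (ha : a ∈ τ.A (k+1)) (x : 𝓐) : π.F (a * x) = a * π.F x := by
  induction ha using Algebra.adjoin_induction generalizing x with
  | mem y hy => obtain ⟨j, hj, rfl⟩ := hy; exact π.F_left j hj x
  | algebraMap r => simp [Algebra.algebraMap_eq_smul_one]
  | add a b _ _ ha hb => rw [add_mul, map_add, ha, hb, add_mul]
  | mul a b _ _ ha hb => rw [mul_assoc, ha, hb, mul_assoc]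

theorem F_right' {a : 𝓐} (ha : a ∈ τ.A (k+1)) (x : 𝓐) : π.F (x * a) = π.F x * a := by
  induction ha using Algebra.adjoin_induction generalizing x with
  | mem y hy => obtain ⟨j, hj, rfl⟩ := hy; exact π.F_right j hj x
  | algebraMap r => simp [Algebra.algebraMap_eq_smul_one]
  | add a b _ _ ha hb => rw [mul_add, map_add, ha, hb, mul_add]
  | mul a b _ _ ha hb => rw [← mul_assoc, hb, ha, mul_assoc]

theorem PaP {a : 𝓐} (ha : a ∈ τ.A (k+1)) : π.P * a * π.P = τ.E k a * π.P := by
  cases k with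
  | zero =>
    obtain ⟨r, rfl⟩ := τ.A_scalar (by omega) ha
    rw [map_smul, τ.E_one 0 (by omega), mul_smul_comm, mul_one, smul_mul_assoc, π.P_sq,
      smul_mul_assoc, smul_mul_assoc, one_mul]
  | succ k =>
    refine τ.coset_ind (by omega) (fun a => π.P * a * π.P = τ.E (k+1) a * π.P) ?_ ?_ ?_ ?_ ha
    · intro b hb; beta_reduce
      rw [← π.comm_A hb, mul_assoc, π.P_sq, τ.E_A (by omega) hb, mul_smul_comm, smul_mul_assoc]
    · intro b hb c hc; beta_reduce
      rw [τ.E_bsc (by omega) hb hc]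
      calc π.P * (b * τ.s k * c) * π.P = (π.P * b) * τ.s k * (c * π.P) := by noncomm_ring
        _ = b * (π.P * τ.s k * π.P) * c := by
          rw [← π.comm_A hb, π.comm_A hc]; noncomm_ring
        _ = _ := by rw [π.P_s k rfl, mul_assoc, ← π.comm_A hc, mul_assoc]
    · intro x y hx hy; beta_reduce at hx hy ⊢
      rw [mul_add, add_mul, hx, hy, map_add, add_mul]
    · intro r x hx; beta_reduce at hx ⊢
      rw [mul_smul_comm, smul_mul_assoc, hx, map_smul, smul_mul_assoc]

variable [Nontrivial 𝓐]

/-- transport to the canonical tail -/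
theorem transport {i : Fin d} {v : List (Fin d)} (hv : Valid (i :: v)) (hl : v ∈ W d k) :
    τ.x (i :: v) * star (τ.x (i :: rep (sh v))) * π.P * (τ.x (i :: rep (sh v)) * star (τ.x (i :: v))) =
      τ.e (i :: v) * π.P * τ.e (i :: v) := by
  obtain ⟨vv, lv⟩ := mem_W.mp hl
  obtain ⟨vr, lr⟩ := mem_W.mp (rep_mem hl)
  have hsr := (rep_spec vv).2
  set u := rep (sh v) with hu
  have vS : i :: v ∈ W d (k+1) := mem_W.mpr ⟨hv, by simp [lv]⟩
  have vT : i :: u ∈ W d (k+1) := mem_W.mpr ⟨valid_cons_congr hsr.symm hv vr, by simp [lr]⟩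
  obtain ⟨y, hy, ly, ry, sy, sy'⟩ := (τ.lev k (by omega)).iso (by omega) hl (rep_mem hl) hsr.symm
  rw [← hu] at ry sy
  have hc := τ.carry vv vr (by omega) hsr (by rwa [lv]) i (b := y)
  rw [mul_assoc, ry, ly] at hc
  have hshST : sh (i :: v) = sh (i :: u) := sh_cons_congr hsr.symm i
  have gm : τ.e (i :: v) * y ∈ τ.A (k+1) :=
    mul_mem (by have := τ.e_mem hv (by simp; omega); simpa [lv] using this) (τ.A_mono (by omega) hy)
  obtain ⟨c, hcc⟩ := Tower.coeff (τ := τ) vS vT hshST gm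
  obtain ⟨xm, xl, xr, xs, xs'⟩ := Tower.x_spec (τ := τ) vS
  obtain ⟨ym, yl, yr, ys, ys'⟩ := Tower.x_spec (τ := τ) vT
  have gv := τ.good v vv (by omega)
  have gu := τ.good u vr (by omega)
  have sqS := τ.e_sq hv (by simp; omega)
  have sqT := τ.e_sq (mem_W.mp vT).1 (by simp; omega)
  have stS := τ.e_star hv (by simp; omega)
  set g := τ.e (i :: v) * y with hg
  have hg1 : g = c • (τ.x (i :: v) * star (τ.x (i :: u))) := by
    calc g = τ.e (i :: v) * g * τ.e (i :: u) := by
            rw [hg, ← mul_assoc, sqS, ← hg, hc, mul_assoc, sqT]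
      _ = τ.x (i :: v) * (star (τ.x (i :: v)) * g * τ.x (i :: u)) * star (τ.x (i :: u)) := by
            rw [← xs', ← ys']; noncomm_ring
      _ = _ := by rw [hcc, mul_smul_comm, xr, smul_mul_assoc]
  have hgg : g * star g = τ.e (i :: v) := by
    calc g * star g = τ.e (i :: v) * (y * star y) * τ.e (i :: v) := by
          rw [hg, star_mul, stS]; noncomm_ring
      _ = _ := by rw [sy', gv.cons_right vv (by omega), sqS]
  have hc2 : c * c = 1 := by
    have : g * star g = (c * c) • τ.e (i :: v) := by
      rw [hg1, star_smul, star_trivial c, smul_mul_smul_comm, star_mul, star_star]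
      congr 1
      calc _ = τ.x (i :: v) * (star (τ.x (i :: u)) * τ.x (i :: u)) * star (τ.x (i :: v)) := by
              noncomm_ring
        _ = _ := by rw [ys, ← hshST, xr, xs']
    rw [hgg] at this
    have h2 : (c * c - 1) • τ.e (i :: v) = 0 := by rw [sub_smul, ← this, one_smul, sub_self]
    have := (smul_eq_zero.mp h2).resolve_right (τ.e_ne_zero hv (by simp; omega))
    linarith
  have hxx : τ.x (i :: v) * star (τ.x (i :: u)) = c • g := by
    rw [hg1, smul_smul, hc2, one_smul]
  have hxx' : τ.x (i :: u) * star (τ.x (i :: v)) = c • star g := by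
    have := congrArg star hxx
    rwa [star_mul, star_star, star_smul, star_trivial c] at this
  rw [hxx, hxx', smul_mul_assoc, smul_mul_smul_comm, hc2, one_smul]
  calc g * π.P * star g = τ.e (i :: v) * (y * π.P) * star y * τ.e (i :: v) := by
        rw [hg, star_mul, stS]; noncomm_ring
    _ = τ.e (i :: v) * π.P * ((y * star y) * τ.e (i :: v)) := by
        rw [π.comm_A hy]; noncomm_ring
    _ = _ := by rw [sy', gv.cons_left vv (by omega)]

end Port
end PBT

end PartE2

section PartE3
open Finset Polynomial
open scoped ComplexOrder
namespace PBT
variable {d k : ℕ} {ι : Type*} [Fintype ι] [DecidableEq ι] [Nonempty ι]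

section psd
variable {n : Type*} [Fintype n]
theorem psd_sum {α : Type*} (s : Finset α) (f : α → Matrix n n ℂ) (h : ∀ a ∈ s, (f a).PosSemidef) :
    (∑ a ∈ s, f a).PosSemidef := by
  classical
  exact Matrix.posSemidef_sum s h

theorem psd_smul {c : ℝ} (hc : 0 ≤ c) {M : Matrix n n ℂ} (h : M.PosSemidef) : (c • M).PosSemidef :=
  h.smul hc

theorem psd_conj {M : Matrix n n ℂ} (h : M.PosSemidef) (B : Matrix n n ℂ) :
    (B * M * star B).PosSemidef := h.mul_mul_conjTranspose_same B

theorem psd_conj' {M : Matrix n n ℂ} (h : M.PosSemidef) (B : Matrix n n ℂ) :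
    (star B * M * B).PosSemidef := h.conjTranspose_mul_mul_same B

theorem psd_self (B : Matrix n n ℂ) : (star B * B).PosSemidef :=
  Matrix.posSemidef_conjTranspose_mul_self B
end psd

variable {τ : Tower (Matrix ι ι ℂ) d (k+1)} (π : Port τ)

theorem Port.P_psd (hd : 0 < d) : π.P.PosSemidef := by
  have h : π.P = ((d : ℝ)⁻¹) • (star π.P * π.P) := by
    rw [π.P_star, π.P_sq, smul_smul, inv_mul_cancel₀ (by positivity), one_smul]
  rw [h]
  exact psd_smul (by positivity) (psd_self _)

theorem Tower.e_psd {n : ℕ} (τ : Tower (Matrix ι ι ℂ) d n) {w : List (Fin d)} (hv : Valid w) (hn : w.length ≤ n) :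
    (τ.e w).PosSemidef := by
  have := psd_self (τ.e w)
  rwa [τ.e_star hv hn, τ.e_sq hv hn] at this

open scoped Classical in
theorem Port.sum_valid {n : ℕ} (τ : Tower (Matrix ι ι ℂ) d n) {v : List (Fin d)} (hv : Valid v) (hn : v.length < n) :
    (∑ i, if Valid (i :: v) then τ.e (i :: v) else 0) = τ.e v := by
  have g := τ.good v hv (by omega)
  rw [← g.sum_cons hv hn]
  apply Finset.sum_congr rfl
  intro i _
  split_ifs with h
  · rfl
  · rw [g.cons_zero hv hn]
    exact fun h' => h ⟨hv, h'⟩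

open scoped Classical in
theorem Port.local_psd (hd : 0 < d) (t : List (Fin d) → ℝ) {v : List (Fin d)} (hv : v ∈ W d k)
    (ht : ∀ i, Valid (i :: v) → 0 < t (i :: v))
    (hsum : (∑ i, if Valid (i :: v) then (t (i :: v))⁻¹ else 0) = 1) :
    ((∑ i, if Valid (i :: v) then t (i :: v) • (τ.e (i :: v) * π.P * τ.e (i :: v)) else 0) -
      τ.e v * π.P * τ.e v).PosSemidef := by
  obtain ⟨hv, hl⟩ := mem_W.mp hv
  have hs := Port.sum_valid τ hv (by omega)
  have hst := τ.e_star hv (by omega)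
  have : ((∑ i, if Valid (i :: v) then t (i :: v) • (τ.e (i :: v) * π.P * τ.e (i :: v)) else 0) -
      τ.e v * π.P * τ.e v) = ∑ i, if Valid (i :: v) then
        (t (i :: v))⁻¹ • ((t (i :: v) • τ.e (i :: v) - τ.e v) * π.P * star (t (i :: v) • τ.e (i :: v) - τ.e v))
        else 0 := by
    have e1 : ∀ i, (if Valid (i :: v) then
        (t (i :: v))⁻¹ • ((t (i :: v) • τ.e (i :: v) - τ.e v) * π.P * star (t (i :: v) • τ.e (i :: v) - τ.e v))
        else 0) = (if Valid (i :: v) then t (i :: v) • (τ.e (i :: v) * π.P * τ.e (i :: v)) else 0)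
          - (if Valid (i :: v) then τ.e (i :: v) else 0) * π.P * τ.e v
          - τ.e v * π.P * (if Valid (i :: v) then τ.e (i :: v) else 0)
          + (if Valid (i :: v) then (t (i :: v))⁻¹ else 0) • (τ.e v * π.P * τ.e v) := by
      intro i
      split_ifs with h
      · have h0 := (ht i h).ne'
        rw [star_sub, star_smul, hst, τ.e_star h (by simp; omega), star_trivial]
        simp only [sub_mul, mul_sub, smul_mul_assoc, mul_smul_comm, smul_sub, smul_smul]
        rw [inv_mul_cancel₀ h0, one_smul, one_smul]
        rw [inv_mul_cancel_left₀ h0]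
        abel
      · simp
    rw [Finset.sum_congr rfl (fun i _ => e1 i)]
    rw [Finset.sum_add_distrib, Finset.sum_sub_distrib, Finset.sum_sub_distrib, ← Finset.sum_mul,
      ← Finset.sum_mul, ← Finset.mul_sum, ← Finset.sum_smul, hs, hsum, one_smul]
    abel
  rw [this]
  apply psd_sum
  intro i _
  split_ifs with h
  · exact psd_smul (inv_nonneg.mpr (ht i h).le) (psd_conj (π.P_psd hd) _)
  · exact Matrix.PosSemidef.zero

set_option maxHeartbeats 2000000 in
open scoped Classical in
theorem Port.upper (hd : 0 < d) (t : List (Fin d) → ℝ) (ht : ∀ w ∈ W d (k+1), 0 < t w)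
    (htc : ∀ i v, v ∈ W d k → Valid (i :: v) → t (i :: rep (sh v)) = t (i :: v))
    (hsum : ∀ v ∈ W d k, (∑ i, if Valid (i :: v) then (t (i :: v))⁻¹ else 0) = 1)
    (c : ℝ) (hc : ∀ w ∈ W d (k+1), (∑ T ∈ TS d k, if sh T = sh w then t T else 0) ≤ c) :
    ∃ Ω : Matrix ι ι ℂ, (∀ a ∈ τ.A (k+1), a * Ω = Ω * a) ∧ (Ω - π.P).PosSemidef ∧
      (π.F Ω).PosSemidef ∧ (c • 1 - π.F Ω).PosSemidef := by
  set Q : (Fin d → ℕ) → Matrix ι ι ℂ := fun μ =>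
    ∑ T ∈ TS d k, if sh T = μ then t T • (star (τ.x T) * π.P * τ.x T) else 0 with hQ
  have hTW : ∀ T ∈ TS d k, T ∈ W d (k+1) := fun T hT => (Finset.mem_filter.mp hT).1
  set f : List (Fin d) → List (Fin d) → Matrix ι ι ℂ := fun w T =>
    if sh T = sh w then t T • ((τ.x w * star (τ.x T)) * π.P * (τ.x T * star (τ.x w))) else 0 with hf
  have hfp : ∀ w, ∀ T ∈ TS d k, (f w T).PosSemidef := by
    intro w T hT
    simp only [hf]
    split_ifs
    · apply psd_smul (ht T (hTW T hT)).le
      have := psd_conj (π.P_psd hd) (τ.x w * star (τ.x T))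
      rwa [star_mul, star_star] at this
    · exact Matrix.PosSemidef.zero
  have hΩ : ∑ w ∈ W d (k+1), τ.x w * Q (sh w) * star (τ.x w) =
      ∑ w ∈ W d (k+1), ∑ T ∈ TS d k, f w T := by
    apply Finset.sum_congr rfl
    intro w _
    simp only [hQ, hf]
    rw [Finset.mul_sum, Finset.sum_mul]
    apply Finset.sum_congr rfl
    intro T _
    split_ifs
    · rw [mul_smul_comm, smul_mul_assoc]; congr 1; simp only [mul_assoc]
    · simp
  have hF : π.F (∑ w ∈ W d (k+1), ∑ T ∈ TS d k, f w T) =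
      ∑ w ∈ W d (k+1), (∑ T ∈ TS d k, if sh T = sh w then t T else 0) • τ.e w := by
    rw [map_sum]
    apply Finset.sum_congr rfl
    intro w hw
    rw [map_sum, Finset.sum_smul]
    apply Finset.sum_congr rfl
    intro T hT
    simp only [hf]
    split_ifs with h
    · obtain ⟨xm, xl, xr, xs, xs'⟩ := Tower.x_spec (τ := τ) hw
      obtain ⟨ym, yl, yr, ys, ys'⟩ := Tower.x_spec (τ := τ) (hTW T hT)
      rw [map_smul, π.F_right' (mul_mem ym (τ.A_star le_rfl xm)),
        π.F_left' (mul_mem xm (τ.A_star le_rfl ym)), π.F_P, mul_one]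
      congr 1
      calc _ = τ.x w * (star (τ.x T) * τ.x T) * star (τ.x w) := by simp only [mul_assoc]
        _ = _ := by rw [ys, h, xr, xs']
    · simp
  refine ⟨_, fun a ha => τ.central Q ha, ?_, ?_, ?_⟩
  · rw [hΩ]
    have h1 : ((∑ w ∈ W d (k+1), ∑ T ∈ TS d k, f w T) -
        ∑ w ∈ W d (k+1), t w • (τ.e w * π.P * τ.e w)).PosSemidef := by
      rw [← Finset.sum_sub_distrib]
      apply psd_sum
      intro w hw
      obtain ⟨i, v, rfl, hv, hval⟩ := exists_cons_of_mem hw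
      have hr := rep_spec (mem_W.mp hv).1
      have hT : i :: rep (sh v) ∈ TS d k := mem_TS.mpr ⟨valid_cons_congr hr.2.symm hval hr.1, rep_mem_V0 hv⟩
      rw [← Finset.add_sum_erase _ _ hT]
      have : f (i :: v) (i :: rep (sh v)) = t (i :: v) • (τ.e (i :: v) * π.P * τ.e (i :: v)) := by
        simp only [hf]
        rw [if_pos (sh_cons_congr hr.2 i), htc i v hv hval, π.transport hval hv]
      rw [this, add_sub_cancel_left]
      apply psd_sum
      intro T hT
      exact hfp _ T (Finset.mem_of_mem_erase hT)
    have h2 : ((∑ w ∈ W d (k+1), t w • (τ.e w * π.P * τ.e w)) - π.P).PosSemidef := by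
      have hP : π.P = ∑ v ∈ W d k, τ.e v * π.P * τ.e v := by
        calc π.P = (∑ v ∈ W d k, τ.e v) * π.P := by rw [τ.sum_e (by omega), one_mul]
          _ = _ := by
            rw [Finset.sum_mul]
            apply Finset.sum_congr rfl
            intro v hv
            obtain ⟨hv, hl⟩ := mem_W.mp hv
            have hm := τ.e_mem hv (by omega)
            rw [hl] at hm
            rw [mul_assoc, ← π.comm_A hm, ← mul_assoc, τ.e_sq hv (by omega)]
      have : (∑ w ∈ W d (k+1), t w • (τ.e w * π.P * τ.e w)) - π.P =
        ∑ v ∈ W d k, ((∑ i, if Valid (i :: v) then t (i :: v) • (τ.e (i :: v) * π.P * τ.e (i :: v)) else 0) -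
      τ.e v * π.P * τ.e v) := by
        rw [Finset.sum_sub_distrib, ← hP, sum_W]
      rw [this]
      apply psd_sum
      intro v hv
      exact π.local_psd hd t hv (fun i hi => ht _ (mem_W.mpr ⟨hi, by simp [(mem_W.mp hv).2]⟩)) (hsum v hv)
    have := h1.add h2
    rwa [sub_add_sub_cancel] at this
  · rw [hΩ, hF]
    apply psd_sum
    intro w hw
    obtain ⟨hv, hl⟩ := mem_W.mp hw
    apply psd_smul _ (τ.e_psd hv (by omega))
    apply Finset.sum_nonneg
    intro T hT
    split_ifs
    · exact (ht T (hTW T hT)).le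
    · rfl
  · rw [hΩ, hF]
    have : c • (1 : Matrix ι ι ℂ) = ∑ w ∈ W d (k+1), c • τ.e w := by
      rw [← Finset.smul_sum, τ.sum_e le_rfl]
    rw [this, ← Finset.sum_sub_distrib]
    apply psd_sum
    intro w hw
    obtain ⟨hv, hl⟩ := mem_W.mp hw
    rw [← sub_smul]
    exact psd_smul (sub_nonneg.mpr (hc w hw)) (τ.e_psd hv (by omega))

end PBT

end PartE3

section PartE4
open Finset Polynomial
open scoped ComplexOrder
namespace PBT
variable {d k : ℕ} {ι : Type*} [Fintype ι] [DecidableEq ι] [Nonempty ι]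

/-- real part of the trace -/
noncomputable def tr : Matrix ι ι ℂ →ₗ[ℝ] ℝ where
  toFun M := M.trace.re
  map_add' := by intro x y; simp [Matrix.trace_add]
  map_smul' := by intro c x; simp [Matrix.trace_smul]

theorem tr_comm (a b : Matrix ι ι ℂ) : tr (a * b) = tr (b * a) := by
  simp only [tr, LinearMap.coe_mk, AddHom.coe_mk, Matrix.trace_mul_comm a b]

theorem tr_nonneg {M : Matrix ι ι ℂ} (h : M.PosSemidef) : 0 ≤ tr M :=
  (Complex.nonneg_iff.mp h.trace_nonneg).1

theorem tr_pos {M : Matrix ι ι ℂ} (h : M ≠ 0) : 0 < tr (star M * M) := by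
  have h0 := (psd_self M).trace_nonneg
  rcases h0.eq_or_lt with h1 | h1
  · exact absurd (Matrix.trace_conjTranspose_mul_self_eq_zero_iff.mp h1.symm) h
  · exact (Complex.pos_iff.mp h1).1

variable {τ : Tower (Matrix ι ι ℂ) d (k+1)} (π : Port τ)

theorem Port.tr_e {w : List (Fin d)} (hw : w ∈ W d (k+1)) : tr (τ.e w) = tr (τ.e (rep (sh w))) := by
  obtain ⟨xm, xl, xr, xs, xs'⟩ := Tower.x_spec (τ := τ) hw
  rw [← xs', ← xs, tr_comm]

theorem Tower.tr_e_pos {n : ℕ} (τ : Tower (Matrix ι ι ℂ) d n) {w : List (Fin d)} (hv : Valid w)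
    (hn : w.length ≤ n) : 0 < tr (τ.e w) := by
  have := tr_pos (τ.e_ne_zero hv hn)
  rwa [τ.e_star hv hn, τ.e_sq hv hn] at this

/-- products of the compressed ports -/
theorem Port.K_mul_ne {i j : Fin d} {v u : List (Fin d)} (hT : i :: v ∈ TS d k) (hT' : j :: u ∈ TS d k)
    (hs : sh (i :: v) = sh (j :: u)) (hne : i :: v ≠ j :: u) :
    (star (τ.x (i :: v)) * π.P * τ.x (i :: v)) * (star (τ.x (j :: u)) * π.P * τ.x (j :: u)) = 0 := by
  obtain ⟨vT, hv⟩ := mem_TS.mp hT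
  obtain ⟨vT', hu⟩ := mem_TS.mp hT'
  obtain ⟨hv, rv⟩ := mem_V0.mp hv
  obtain ⟨hu, ru⟩ := mem_V0.mp hu
  have wT : i :: v ∈ W d (k+1) := (Finset.mem_filter.mp hT).1
  have wT' : j :: u ∈ W d (k+1) := (Finset.mem_filter.mp hT').1
  have hsh : sh v ≠ sh u := by
    intro h
    have : v = u := by rw [rv, ru, h]
    subst this
    apply hne
    have h2 := congrFun hs i
    rw [sh_cons, sh_cons] at h2
    by_contra hij
    have : i ≠ j := fun h => hij (by rw [h])
    simp at h2
    exact this h2.symm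
  obtain ⟨xm, xl, xr, xs, xs'⟩ := Tower.x_spec (τ := τ) wT
  obtain ⟨ym, yl, yr, ys, ys'⟩ := Tower.x_spec (τ := τ) wT'
  obtain ⟨vv, lv⟩ := mem_W.mp hv
  obtain ⟨vu, lu⟩ := mem_W.mp hu
  have gv := τ.good v vv (by omega)
  have gu := τ.good u vu (by omega)
  have m : τ.x (i :: v) * star (τ.x (j :: u)) ∈ τ.A (k+1) := mul_mem xm (τ.A_star le_rfl ym)
  have e1 : τ.e v * τ.x (i :: v) = τ.x (i :: v) := by
    rw [← xl, ← mul_assoc, gv.cons_left vv (by omega)]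
  have e2 : star (τ.x (j :: u)) * τ.e u = star (τ.x (j :: u)) := by
    rw [← Tower.xs_e wT', mul_assoc, gu.cons_right vu (by omega)]
  have mv := τ.e_mem vv (by omega)
  have mu := τ.e_mem vu (by omega)
  rw [lv] at mv
  rw [lu] at mu
  have h0 : τ.E k (τ.x (i :: v) * star (τ.x (j :: u))) = 0 := by
    have : τ.x (i :: v) * star (τ.x (j :: u)) = τ.e v * (τ.x (i :: v) * star (τ.x (j :: u)) * τ.e u) := by
      rw [mul_assoc, e2, ← mul_assoc, e1]
    rw [this, τ.E_left' (by omega) mv, τ.E_right' (by omega) mu, ← mul_assoc]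
    exact (τ.lev k (by omega)).D v hv u hu hsh _ (τ.E_mem (by omega) m)
  calc _ = star (τ.x (i :: v)) * (π.P * (τ.x (i :: v) * star (τ.x (j :: u))) * π.P) * τ.x (j :: u) := by
        simp only [mul_assoc]
    _ = 0 := by rw [π.PaP m, h0]; simp

theorem Port.K_mul_self {i : Fin d} {v : List (Fin d)} (hT : i :: v ∈ TS d k) :
    (star (τ.x (i :: v)) * π.P * τ.x (i :: v)) * (star (τ.x (i :: v)) * π.P * τ.x (i :: v)) =
      wt (cont v) i • (star (τ.x (i :: v)) * π.P * τ.x (i :: v)) := by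
  obtain ⟨vT, hv⟩ := mem_TS.mp hT
  obtain ⟨hv, rv⟩ := mem_V0.mp hv
  have wT : i :: v ∈ W d (k+1) := (Finset.mem_filter.mp hT).1
  obtain ⟨xm, xl, xr, xs, xs'⟩ := Tower.x_spec (τ := τ) wT
  obtain ⟨vv, lv⟩ := mem_W.mp hv
  have gv := τ.good v vv (by omega)
  have e1 : τ.e v * τ.x (i :: v) = τ.x (i :: v) := by
    rw [← xl, ← mul_assoc, gv.cons_left vv (by omega)]
  have mv := τ.e_mem vv (by omega)
  rw [lv] at mv
  have mT := τ.e_mem vT (by simp; omega)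
  rw [List.length_cons, lv] at mT
  have hE := gv.E_cons vv (by omega) i
  rw [lv] at hE
  calc _ = star (τ.x (i :: v)) * (π.P * (τ.x (i :: v) * star (τ.x (i :: v))) * π.P) * τ.x (i :: v) := by
        simp only [mul_assoc]
    _ = wt (cont v) i • (star (τ.x (i :: v)) * (π.P * τ.e v) * τ.x (i :: v)) := by
        rw [xs', π.PaP mT, hE, smul_mul_assoc, mul_smul_comm, smul_mul_assoc, π.comm_A mv]
    _ = _ := by
        simp only [mul_assoc, e1]

end PBT

end PartE4

section PartE5
open Finset Polynomial
open scoped ComplexOrder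
namespace PBT
variable {d k : ℕ} {ι : Type*} [Fintype ι] [DecidableEq ι] [Nonempty ι]

/-- the ratio of a word -/
noncomputable def rr : List (Fin d) → ℝ
  | [] => 1
  | i :: v => wt (cont v) i

theorem rr_pos {w : List (Fin d)} (h : Valid w) : 0 < rr w := by
  cases w with
  | nil => simp [rr]
  | cons i v => exact wt_pos h.1.antitone h.2

open scoped Classical in
theorem tr_proj_le {α : Type*} (s : Finset α) (K : α → Matrix ι ι ℂ) (r : α → ℝ)
    (hr : ∀ a ∈ s, 0 < r a) (hst : ∀ a ∈ s, star (K a) = K a)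
    (hK : ∀ a ∈ s, ∀ b ∈ s, K a * K b = if a = b then r a • K a else 0)
    (e : Matrix ι ι ℂ) (he : e * e = e) (hes : star e = e) (heK : ∀ a ∈ s, e * K a = K a)
    (hKe : ∀ a ∈ s, K a * e = K a) (Ω : Matrix ι ι ℂ) (hΩ : Ω.PosSemidef) :
    ∑ a ∈ s, (r a)⁻¹ * tr (Ω * K a) ≤ tr (Ω * e) := by
  set R := ∑ a ∈ s, (r a)⁻¹ • K a with hR
  have hRs : star R = R := by
    rw [hR, star_sum]
    apply Finset.sum_congr rfl
    intro a ha
    rw [star_smul, hst a ha, star_trivial]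
  have heR : e * R = R := by
    rw [hR, Finset.mul_sum]
    apply Finset.sum_congr rfl
    intro a ha
    rw [mul_smul_comm, heK a ha]
  have hRe : R * e = R := by
    rw [hR, Finset.sum_mul]
    apply Finset.sum_congr rfl
    intro a ha
    rw [smul_mul_assoc, hKe a ha]
  have hRR : R * R = R := by
    conv_rhs => rw [hR]
    conv_lhs => rw [hR]
    rw [Finset.sum_mul]
    apply Finset.sum_congr rfl
    intro a ha
    rw [Finset.mul_sum, Finset.sum_eq_single_of_mem a ha]
    · rw [smul_mul_smul_comm, hK a ha a ha, if_pos rfl, smul_smul, inv_mul_cancel_right₀ (hr a ha).ne']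
    · intro b hb hne
      rw [smul_mul_smul_comm, hK a ha b hb, if_neg (Ne.symm hne), smul_zero]
  have h := tr_nonneg (psd_conj' hΩ (e - R))
  have h2 : tr (star (e - R) * Ω * (e - R)) = tr (Ω * e) - tr (Ω * R) := by
    rw [mul_assoc, tr_comm, star_sub, hRs, hes, mul_assoc, mul_sub, sub_mul, sub_mul, he, heR, hRe, hRR,
      sub_self, sub_zero, mul_sub, map_sub]
  have h3 : tr (Ω * R) = ∑ a ∈ s, (r a)⁻¹ * tr (Ω * K a) := by
    rw [hR, Finset.mul_sum, map_sum]
    apply Finset.sum_congr rfl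
    intro a _
    rw [mul_smul_comm, map_smul, smul_eq_mul]
  linarith

variable {τ : Tower (Matrix ι ι ℂ) d (k+1)} (π : Port τ)

section
variable (Ω : Matrix ι ι ℂ) (hcomm : ∀ a ∈ τ.A (k+1), a * Ω = Ω * a)

theorem Port.tr_K (hcomm : ∀ a ∈ τ.A (k+1), a * Ω = Ω * a) {T : List (Fin d)} (hT : T ∈ W d (k+1)) :
    tr (Ω * (star (τ.x T) * π.P * τ.x T)) = tr (Ω * τ.e T * π.P) := by
  obtain ⟨xm, xl, xr, xs, xs'⟩ := Tower.x_spec (τ := τ) hT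
  calc _ = tr ((Ω * star (τ.x T) * π.P) * τ.x T) := by simp only [mul_assoc]
    _ = tr ((τ.x T * Ω) * star (τ.x T) * π.P) := by rw [tr_comm]; simp only [mul_assoc]
    _ = tr (Ω * (τ.x T * star (τ.x T)) * π.P) := by rw [hcomm _ xm]; simp only [mul_assoc]
    _ = _ := by rw [xs']

set_option maxHeartbeats 1000000 in
open scoped Classical in
theorem Port.lowA (hcomm : ∀ a ∈ τ.A (k+1), a * Ω = Ω * a) (hΩ : Ω.PosSemidef) {w : List (Fin d)}
    (hw : w ∈ V0 d (k+1)) :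
    (∑ T ∈ TS d k, if sh T = sh w then (rr T)⁻¹ * tr (Ω * τ.e T * π.P) else 0) ≤ tr (Ω * τ.e w) := by
  rw [← Finset.sum_filter]
  obtain ⟨hwW, hwr⟩ := mem_V0.mp hw
  obtain ⟨hv, hl⟩ := mem_W.mp hwW
  have hm : ∀ T ∈ (TS d k).filter (fun T => sh T = sh w), T ∈ TS d k ∧ T ∈ W d (k+1) ∧ sh T = sh w := by
    intro T hT
    obtain ⟨h1, h2⟩ := Finset.mem_filter.mp hT
    exact ⟨h1, (Finset.mem_filter.mp h1).1, h2⟩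
  have key := tr_proj_le ((TS d k).filter (fun T => sh T = sh w))
    (fun T => star (τ.x T) * π.P * τ.x T) rr
    (fun T hT => rr_pos (mem_W.mp (hm T hT).2.1).1)
    (fun T hT => by simp only [star_mul, star_star, π.P_star, mul_assoc])
    (by
      intro T hT T' hT'
      obtain ⟨h1, h2, h3⟩ := hm T hT
      obtain ⟨h1', h2', h3'⟩ := hm T' hT'
      obtain ⟨i, v, rfl, hv, hval⟩ := exists_cons_of_mem h2
      obtain ⟨j, u, rfl, hu, hval'⟩ := exists_cons_of_mem h2'
      split_ifs with h
      · rw [← h]; exact π.K_mul_self h1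
      · exact π.K_mul_ne h1 h1' (h3.trans h3'.symm) h)
    (τ.e w) (τ.e_sq hv (by omega)) (τ.e_star hv (by omega))
    (by
      intro T hT
      obtain ⟨h1, h2, h3⟩ := hm T hT
      have := Tower.e_xs (τ := τ) h2
      rw [h3, ← hwr] at this
      rw [← mul_assoc, ← mul_assoc, this])
    (by
      intro T hT
      obtain ⟨h1, h2, h3⟩ := hm T hT
      have := (Tower.x_spec (τ := τ) h2).2.2.1
      rw [h3, ← hwr] at this
      rw [mul_assoc, this])
    Ω hΩ
  refine le_trans (le_of_eq ?_) key
  apply Finset.sum_congr rfl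
  intro T hT
  rw [π.tr_K Ω hcomm (hm T hT).2.1]

open scoped Classical in
/-- test vector inequality -/
theorem Port.lowB (hd : 0 < d) (trF : ∀ M, tr (π.F M) = d * tr M)
    (hcomm : ∀ a ∈ τ.A (k+1), a * Ω = Ω * a) (hP : (Ω - π.P).PosSemidef)
    {v : List (Fin d)} (hv : v ∈ W d k) (z : Fin d → ℝ) :
    (∑ i, z i * wt (cont v) i) ^ 2 * tr (τ.e v) ≤
      (d : ℝ)^2 * ∑ i, z i ^ 2 * tr (Ω * τ.e (i :: v) * π.P) := by
  obtain ⟨vv, lv⟩ := mem_W.mp hv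
  have g := τ.good v vv (by omega)
  have mT : ∀ i, τ.e (i :: v) ∈ τ.A (k+1) := by
    intro i
    have := g.cons_mem vv (by omega) i
    rwa [lv] at this
  set Z := ∑ i, z i • τ.e (i :: v) with hZ
  set ζ := ∑ i, z i * wt (cont v) i with hζ
  have mZ : Z ∈ τ.A (k+1) := sum_mem (fun i _ => (τ.A (k+1)).smul_mem (mT i) _)
  have mv := τ.e_mem vv (by omega)
  rw [lv] at mv
  have Zs : star Z = Z := by
    rw [hZ, star_sum]
    apply Finset.sum_congr rfl
    intro i _
    rw [star_smul, g.cons_star vv (by omega), star_trivial]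
  have PZP : π.P * Z * π.P = ζ • (τ.e v * π.P) := by
    rw [π.PaP mZ, hZ, map_sum, Finset.sum_mul, hζ, Finset.sum_smul]
    apply Finset.sum_congr rfl
    intro i _
    have := g.E_cons vv (by omega) i
    rw [lv] at this
    rw [map_smul, this, smul_smul, smul_mul_assoc]
  have ZZ : Z * Z = ∑ i, (z i)^2 • τ.e (i :: v) := by
    conv_lhs => rw [hZ]
    rw [Finset.sum_mul]
    apply Finset.sum_congr rfl
    intro i _
    rw [Finset.mul_sum, Finset.sum_eq_single_of_mem i (mem_univ i)]
    · rw [smul_mul_smul_comm, g.cons_mul vv (by omega), if_pos rfl, sq]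
    · intro j _ hne
      rw [smul_mul_smul_comm, g.cons_mul vv (by omega), if_neg (Ne.symm hne), smul_zero]
  have h := tr_nonneg (psd_conj' hP (Z * π.P))
  rw [star_mul, Zs, π.P_star, mul_sub, sub_mul, map_sub] at h
  have h1 : tr (π.P * Z * Ω * (Z * π.P)) = d * ∑ i, z i ^ 2 * tr (Ω * τ.e (i :: v) * π.P) := by
    calc _ = tr (π.P * (Z * Ω * Z * π.P)) := by simp only [mul_assoc]
      _ = tr (Z * Ω * Z * (π.P * π.P)) := by rw [tr_comm]; simp only [mul_assoc]
      _ = d * tr (Ω * (Z * Z) * π.P) := by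
        rw [π.P_sq, hcomm _ mZ, mul_smul_comm, map_smul, smul_eq_mul]; simp only [mul_assoc]
      _ = _ := by
        rw [ZZ, Finset.mul_sum, Finset.sum_mul, map_sum]
        congr 1
        apply Finset.sum_congr rfl
        intro i _
        rw [mul_smul_comm, smul_mul_assoc, map_smul, smul_eq_mul]
  have h2 : tr (π.P * Z * π.P * (Z * π.P)) = ζ ^ 2 * tr (τ.e v * π.P) := by
    calc _ = tr (ζ • (τ.e v * (π.P * Z * π.P))) := by
            rw [PZP, smul_mul_assoc]
            congr 2
            rw [PZP.symm]; simp only [mul_assoc]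
      _ = tr ((ζ ^ 2) • (τ.e v * π.P)) := by
            rw [PZP, mul_smul_comm, ← mul_assoc, τ.e_sq vv (by omega), smul_smul, sq]
      _ = _ := by rw [map_smul, smul_eq_mul]
  have h3 : tr (τ.e v) = d * tr (τ.e v * π.P) := by
    rw [← trF, π.F_left' (τ.A_mono (by omega) mv), π.F_P, mul_one]
  rw [h1, h2] at h
  rw [h3]
  have hd' : (0:ℝ) < d := by exact_mod_cast hd
  nlinarith
end
end PBT

end PartE5

section PartE6
open Finset Polynomial
open scoped ComplexOrder
namespace PBT
variable {d k : ℕ} {ι : Type*} [Fintype ι] [DecidableEq ι] [Nonempty ι]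
variable {τ : Tower (Matrix ι ι ℂ) d (k+1)} (π : Port τ)

set_option maxHeartbeats 1000000 in
open scoped Classical in
theorem Port.lower (hd : 0 < d) (trF : ∀ M, tr (π.F M) = d * tr M)
    (trE : ∀ M, tr (τ.E k M) = d * tr M) (Ω : Matrix ι ι ℂ)
    (hcomm : ∀ a ∈ τ.A (k+1), a * Ω = Ω * a) (hP : (Ω - π.P).PosSemidef) (L : ℝ)
    (hL : (L • 1 - π.F Ω).PosSemidef) (val : (Fin d → ℕ) → ℝ) :
    ∑ v ∈ V0 d k, (∑ i, if Valid (i :: v) then val (sh (i :: v)) else 0) ^ 2 ≤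
      L * ∑ w ∈ V0 d (k+1), val (sh w) ^ 2 := by
  have hd' : (0:ℝ) < d := by exact_mod_cast hd
  have hΩ : Ω.PosSemidef := by
    have := hP.add (π.P_psd hd)
    rwa [sub_add_cancel] at this
  have hTW : ∀ T ∈ TS d k, T ∈ W d (k+1) := fun T hT => (Finset.mem_filter.mp hT).1
  set m : (Fin d → ℕ) → ℝ := fun μ => tr (τ.e (rep μ)) with hm
  have hmpos : ∀ w ∈ W d (k+1), 0 < m (sh w) := by
    intro w hw
    obtain ⟨h1, h2⟩ := mem_W.mp (rep_mem hw)
    exact τ.tr_e_pos h1 (by omega)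
  -- step 1
  have step1 : ∀ v ∈ V0 d k, (∑ i, if Valid (i :: v) then val (sh (i :: v)) else 0) ^ 2 ≤
      ∑ i, if Valid (i :: v) then
        val (sh (i :: v)) ^ 2 * (d / m (sh (i :: v))) * ((rr (i :: v))⁻¹ * tr (Ω * τ.e (i :: v) * π.P)) else 0 := by
    intro v hv
    obtain ⟨hv, -⟩ := mem_V0.mp hv
    obtain ⟨vv, lv⟩ := mem_W.mp hv
    have g := τ.good v vv (by omega)
    have h := π.lowB Ω hd trF hcomm hP hv
      (fun i => if Valid (i :: v) then val (sh (i :: v)) / wt (cont v) i else 0)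
    have hp := τ.tr_e_pos vv (by omega)
    have e1 : (∑ i, (if Valid (i :: v) then val (sh (i :: v)) / wt (cont v) i else 0) * wt (cont v) i) =
        ∑ i, if Valid (i :: v) then val (sh (i :: v)) else 0 := by
      apply Finset.sum_congr rfl
      intro i _
      split_ifs with hi
      · rw [div_mul_cancel₀]; exact (wt_pos vv.antitone hi.2).ne'
      · simp
    rw [e1] at h
    rw [← le_div_iff₀ hp] at h
    refine h.trans (le_of_eq ?_)
    rw [Finset.mul_sum, Finset.sum_div]
    apply Finset.sum_congr rfl
    intro i _
    split_ifs with hi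
    · have hw : i :: v ∈ W d (k+1) := mem_W.mpr ⟨hi, by simp [lv]⟩
      have hwt := wt_pos vv.antitone hi.2
      have h1 : wt (cont v) i * tr (τ.e v) = d * m (sh (i :: v)) := by
        have hE := g.E_cons vv (by omega) i
        rw [lv] at hE
        simp only [hm]
        rw [← Port.tr_e hw, ← trE, hE, map_smul, smul_eq_mul]
      have h2 : tr (τ.e v) = d * m (sh (i :: v)) / wt (cont v) i := by
        rw [← h1]; field_simp
      have h3 := hmpos _ hw
      rw [h2]
      simp only [rr]
      field_simp
    · simp
  have step2 : ∀ w ∈ V0 d (k+1), (d / m (sh w)) *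
      (∑ T ∈ TS d k, if sh T = sh w then (rr T)⁻¹ * tr (Ω * τ.e T * π.P) else 0) ≤ L := by
    intro w hw
    obtain ⟨hwW, hwr⟩ := mem_V0.mp hw
    obtain ⟨hv, hl⟩ := mem_W.mp hwW
    have h1 := π.lowA Ω hcomm hΩ hw
    have mw := τ.e_mem hv (by omega)
    rw [hl] at mw
    have h2 : d * tr (Ω * τ.e w) = tr (π.F Ω * τ.e w) := by
      rw [← trF, π.F_right' mw]
    have h3 := tr_nonneg (psd_conj' hL (τ.e w))
    rw [mul_assoc, tr_comm, mul_assoc, τ.e_star hv (by omega), τ.e_sq hv (by omega), sub_mul, map_sub,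
      smul_mul_assoc, one_mul, map_smul, smul_eq_mul] at h3
    have h4 : m (sh w) = tr (τ.e w) := by simp only [hm]; rw [← hwr]
    have h5 := hmpos w hwW
    rw [div_mul_eq_mul_div, div_le_iff₀ h5, h4]
    nlinarith
  calc _ ≤ ∑ T ∈ TS d k, val (sh T) ^ 2 * (d / m (sh T)) * ((rr T)⁻¹ * tr (Ω * τ.e T * π.P)) := by
        rw [sum_TS]
        exact Finset.sum_le_sum step1
    _ = ∑ w ∈ V0 d (k+1), val (sh w) ^ 2 * ((d / m (sh w)) *
      (∑ T ∈ TS d k, if sh T = sh w then (rr T)⁻¹ * tr (Ω * τ.e T * π.P) else 0)) := by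
        simp only [Finset.mul_sum]
        rw [Finset.sum_comm]
        apply Finset.sum_congr rfl
        intro T hT
        rw [Finset.sum_eq_single_of_mem (rep (sh T)) (rep_mem_V0 (hTW T hT))]
        · rw [(rep_spec (mem_W.mp (hTW T hT)).1).2, if_pos rfl]; ring
        · intro w hw hne
          rw [if_neg]; · simp
          intro h
          apply hne
          rw [h]; exact (mem_V0.mp hw).2
    _ ≤ ∑ w ∈ V0 d (k+1), val (sh w) ^ 2 * L :=
        Finset.sum_le_sum (fun w hw => mul_le_mul_of_nonneg_left (step2 w hw) (sq_nonneg _))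
    _ = _ := by rw [← Finset.sum_mul, mul_comm]

end PBT

end PartE6

section PartF1
open Finset Polynomial
open scoped ComplexOrder
namespace PBT
variable {d : ℕ} {X : Type*} [Fintype X] [DecidableEq X]

/-- permutation matrices -/
noncomputable def SM (d : ℕ) (σ : Equiv.Perm X) : Matrix (X → Fin d) (X → Fin d) ℂ :=
  fun f g => if f ∘ σ = g then 1 else 0

theorem SM_mul (σ : Equiv.Perm X) (M : Matrix (X → Fin d) (X → Fin d) ℂ) (f g) :
    (SM d σ * M) f g = M (f ∘ σ) g := by
  simp [Matrix.mul_apply, SM]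

theorem mul_SM (σ : Equiv.Perm X) (M : Matrix (X → Fin d) (X → Fin d) ℂ) (f g) :
    (M * SM d σ) f g = M f (g ∘ σ.symm) := by
  have : ∀ h : X → Fin d, h ∘ σ = g ↔ h = g ∘ σ.symm := by
    intro h
    constructor
    · rintro rfl; funext x; simp
    · rintro rfl; funext x; simp
  simp [Matrix.mul_apply, SM, this]

theorem SM_mul_SM (σ ρ : Equiv.Perm X) : SM d σ * SM d ρ = SM d (σ * ρ) := by
  ext f g; rw [SM_mul]; rfl

theorem SM_one : SM d (1 : Equiv.Perm X) = 1 := by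
  ext f g; simp [SM, Matrix.one_apply]

theorem SM_star (σ : Equiv.Perm X) : star (SM d σ) = SM d σ⁻¹ := by
  ext f g
  rw [Matrix.star_apply]
  have : g ∘ σ = f ↔ f ∘ (σ⁻¹ : Equiv.Perm X) = g := by
    constructor
    · rintro rfl; funext x; simp
    · rintro rfl; funext x; simp
  simp only [SM, this]
  split_ifs <;> simp

/-- partial trace (as a conditional expectation up to normalisation) over a site -/
noncomputable def EM (d : ℕ) (a : X) :
    Matrix (X → Fin d) (X → Fin d) ℂ →ₗ[ℝ] Matrix (X → Fin d) (X → Fin d) ℂ where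
  toFun M := Matrix.of fun f g =>
    if f a = g a then ∑ j, M (Function.update f a j) (Function.update g a j) else 0
  map_add' M M' := by
    ext f g
    simp only [Matrix.add_apply, Matrix.of_apply]
    split_ifs
    · rw [Finset.sum_add_distrib]
    · simp
  map_smul' c M := by
    ext f g
    simp only [Matrix.smul_apply, RingHom.id_apply, Matrix.of_apply]
    split_ifs
    · rw [Finset.smul_sum]
    · simp

theorem EM_apply (a : X) (M : Matrix (X → Fin d) (X → Fin d) ℂ) (f g) : EM d a M f g =
    if f a = g a then ∑ j, M (Function.update f a j) (Function.update g a j) else 0 := rfl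

theorem update_comp_perm (f : X → Fin d) {a : X} (j : Fin d) {σ : Equiv.Perm X} (h : σ a = a) :
    Function.update f a j ∘ σ = Function.update (f ∘ σ) a j := by
  funext x
  by_cases hx : x = a
  · subst hx; simp [h]
  · have : σ x ≠ a := fun h' => hx (σ.injective (h'.trans h.symm))
    simp [hx, this]

theorem symm_fix {a : X} {σ : Equiv.Perm X} (h : σ a = a) : σ.symm a = a := by
  rw [Equiv.symm_apply_eq, h]

theorem EM_left {a : X} {σ : Equiv.Perm X} (h : σ a = a) (M : Matrix (X → Fin d) (X → Fin d) ℂ) :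
    EM d a (SM d σ * M) = SM d σ * EM d a M := by
  ext f g
  rw [SM_mul, EM_apply, EM_apply]
  simp only [SM_mul, update_comp_perm _ _ h, Function.comp, h]

theorem EM_right {a : X} {σ : Equiv.Perm X} (h : σ a = a) (M : Matrix (X → Fin d) (X → Fin d) ℂ) :
    EM d a (M * SM d σ) = EM d a M * SM d σ := by
  ext f g
  rw [mul_SM, EM_apply, EM_apply]
  simp only [mul_SM, update_comp_perm _ _ (symm_fix h)]
  simp only [Function.comp, symm_fix h]

theorem EM_one (a : X) : EM d a 1 = (d : ℝ) • 1 := by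
  ext f g
  rw [EM_apply, Matrix.smul_apply]
  simp only [Matrix.one_apply]
  by_cases h : f = g
  · subst h; simp
  · rw [if_neg h, smul_zero]
    split_ifs with ha
    · apply Finset.sum_eq_zero
      intro j _
      rw [if_neg]
      intro h'
      apply h
      funext x
      by_cases hx : x = a
      · rw [hx, ha]
      · simpa [hx] using congrFun h' x
    · rfl

theorem EM_swap {a b : X} (hab : a ≠ b) : EM d a (SM d (Equiv.swap a b)) = 1 := by
  ext f g
  rw [EM_apply]
  simp only [Matrix.one_apply, SM]
  have key : ∀ j, (Function.update f a j ∘ (Equiv.swap a b) = Function.update g a j) ↔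
      (f b = j ∧ j = g b ∧ ∀ x, x ≠ a → x ≠ b → f x = g x) := by
    intro j
    constructor
    · intro h
      refine ⟨?_, ?_, ?_⟩
      · simpa [hab.symm] using congrFun h a
      · simpa [hab.symm] using congrFun h b
      · intro x hxa hxb
        simpa [hxa, hxb, Equiv.swap_apply_of_ne_of_ne hxa hxb] using congrFun h x
    · rintro ⟨h1, h2, h3⟩
      funext x
      by_cases hxa : x = a
      · subst hxa; simp [hab.symm, h1]
      · by_cases hxb : x = b
        · subst hxb; simp [hab.symm, h2]
        · simp [hxa, Equiv.swap_apply_of_ne_of_ne hxa hxb, h3 x hxa hxb]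
  simp only [key]
  by_cases h : f = g
  · subst h
    have : ∀ j, (f b = j ∧ j = f b ∧ ∀ x, x ≠ a → x ≠ b → f x = f x) ↔ j = f b := by
      intro j
      constructor
      · intro h; exact h.2.1
      · rintro rfl; simp
    rw [if_pos rfl, if_pos rfl, Finset.sum_congr rfl (fun j _ => if_congr (this j) rfl rfl)]
    simp
  · rw [if_neg h]
    split_ifs with ha
    · apply Finset.sum_eq_zero
      intro j _
      rw [if_neg]
      rintro ⟨h1, h2, h3⟩
      apply h
      funext x
      by_cases hxa : x = a
      · rw [hxa, ha]
      · by_cases hxb : x = b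
        · rw [hxb, h1, h2]
        · exact h3 x hxa hxb
    · rfl

theorem sum_update (a : X) (h : (X → Fin d) → ℂ) :
    ∑ f, ∑ j, h (Function.update f a j) = d * ∑ f, h f := by
  rw [← Fintype.sum_prod_type' (f := fun f j => h (Function.update f a j))]
  have inv : Function.Involutive (fun p : (X → Fin d) × Fin d => (Function.update p.1 a p.2, p.1 a)) := by
    rintro ⟨f, j⟩
    simp
  rw [← Equiv.sum_comp (inv.toPerm _)]
  simp [Function.Involutive.toPerm, Fintype.sum_prod_type, Finset.mul_sum]

theorem trace_EM (a : X) (M : Matrix (X → Fin d) (X → Fin d) ℂ) :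
    (EM d a M).trace = d * M.trace := by
  simp only [Matrix.trace, Matrix.diag, EM_apply, if_true]
  exact sum_update a (fun f => M f f)

theorem tr_EM (a : X) (M : Matrix (X → Fin d) (X → Fin d) ℂ) :
    tr (EM d a M) = d * tr M := by
  simp [tr, trace_EM]

/-- the (unnormalised) port projector -/
noncomputable def PM (d : ℕ) (a n : X) : Matrix (X → Fin d) (X → Fin d) ℂ :=
  fun f g => if f a = f n ∧ g a = g n ∧ ∀ x, x ≠ a → x ≠ n → f x = g x then 1 else 0

/-- double update -/
def upd (f : X → Fin d) (a n : X) (j : Fin d) : X → Fin d :=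
  Function.update (Function.update f a j) n j

theorem upd_n (f : X → Fin d) (a n : X) (j : Fin d) : upd f a n j n = j := by simp [upd]
theorem upd_a (f : X → Fin d) {a n : X} (h : a ≠ n) (j : Fin d) : upd f a n j a = j := by simp [upd, h]
theorem upd_x (f : X → Fin d) {a n x : X} (h : x ≠ a) (h' : x ≠ n) (j : Fin d) : upd f a n j x = f x := by
  simp [upd, h, h']

theorem PM_mul {a n : X} (han : a ≠ n) (M : Matrix (X → Fin d) (X → Fin d) ℂ) (f g) :
    (PM d a n * M) f g = if f a = f n then ∑ j, M (upd f a n j) g else 0 := by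
  rw [Matrix.mul_apply]
  split_ifs with h
  · simp only [PM, h, true_and, ite_mul, one_mul, zero_mul]
    rw [← Finset.sum_filter]
    refine Finset.sum_bij' (fun h _ => h a) (fun j _ => upd f a n j) ?_ ?_ ?_ ?_ ?_
    · intro _ _; exact mem_univ _
    · intro j _
      simp only [mem_filter, mem_univ, true_and]
      exact ⟨by rw [upd_a f han, upd_n], fun x hx hn => (upd_x f hx hn j).symm⟩
    · intro h hh
      simp only [mem_filter, mem_univ, true_and] at hh
      funext x
      by_cases hxn : x = n
      · rw [hxn, upd_n, hh.1]
      · by_cases hxa : x = a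
        · rw [hxa, upd_a f han]
        · rw [upd_x f hxa hxn, hh.2 x hxa hxn]
    · intro j _; exact upd_a f han j
    · intro h hh
      simp only [mem_filter, mem_univ, true_and] at hh
      congr 1
      funext x
      by_cases hxn : x = n
      · rw [hxn, upd_n, hh.1]
      · by_cases hxa : x = a
        · rw [hxa, upd_a f han]
        · rw [upd_x f hxa hxn, hh.2 x hxa hxn]
  · simp [PM, h]

theorem PM_star (a n : X) : star (PM d a n) = PM d a n := by
  ext f g
  rw [Matrix.star_apply]
  have : (g a = g n ∧ f a = f n ∧ ∀ x, x ≠ a → x ≠ n → g x = f x) ↔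
      (f a = f n ∧ g a = g n ∧ ∀ x, x ≠ a → x ≠ n → f x = g x) :=
    ⟨fun h => ⟨h.2.1, h.1, fun x h1 h2 => (h.2.2 x h1 h2).symm⟩,
     fun h => ⟨h.2.1, h.1, fun x h1 h2 => (h.2.2 x h1 h2).symm⟩⟩
  simp only [PM, this]
  split_ifs <;> simp

theorem PM_sq {a n : X} (han : a ≠ n) : PM d a n * PM d a n = (d : ℝ) • PM d a n := by
  ext f g
  rw [PM_mul han, Matrix.smul_apply]
  have : ∀ j, PM d a n (upd f a n j) g = if g a = g n ∧ ∀ x, x ≠ a → x ≠ n → f x = g x then 1 else 0 := by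
    intro j
    simp only [PM]
    congr 1
    rw [upd_a f han, upd_n]
    simp only [true_and, eq_iff_iff]
    exact and_congr_right fun _ => forall_congr' fun x => forall_congr' fun h => forall_congr' fun h' => by
      rw [upd_x f h h']
  simp only [this]
  simp only [PM]
  by_cases h : f a = f n <;> simp [h]

theorem SM_PM (σ : Equiv.Perm X) (a n : X) : SM d σ * PM d a n = PM d (σ a) (σ n) * SM d σ := by
  ext f g
  rw [SM_mul, mul_SM]
  simp only [PM, Function.comp, Equiv.symm_apply_apply]
  congr 1
  simp only [eq_iff_iff]
  refine and_congr_right fun _ => and_congr_right fun _ => ?_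
  constructor
  · intro h x h1 h2
    have := h (σ.symm x) (fun h' => h1 (by rw [← h']; simp)) (fun h' => h2 (by rw [← h']; simp))
    simpa using this
  · intro h x h1 h2
    have := h (σ x) (fun h' => h1 (σ.injective h')) (fun h' => h2 (σ.injective h'))
    simpa using this

theorem PM_swap {a b n : X} (hab : a ≠ b) (han : a ≠ n) (hbn : b ≠ n) :
    PM d a n * SM d (Equiv.swap a b) * PM d a n = PM d a n := by
  ext f g
  rw [mul_assoc, PM_mul han]
  simp only [SM_mul]
  have key : ∀ j, PM d a n (upd f a n j ∘ (Equiv.swap a b)) g =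
      if j = f b then (if g a = g n ∧ ∀ x, x ≠ a → x ≠ n → f x = g x then 1 else 0) else 0 := by
    intro j
    rw [← ite_and]
    simp only [PM]
    congr 1
    simp only [Function.comp, Equiv.swap_apply_left, Equiv.swap_apply_of_ne_of_ne han.symm hbn.symm,
      upd_n, upd_x f hab.symm hbn, eq_iff_iff]
    constructor
    · rintro ⟨h1, h2, h3⟩
      refine ⟨h1.symm, h2, fun x hxa hxn => ?_⟩
      by_cases hxb : x = b
      · subst hxb
        have := h3 x hxa hxn
        rw [Equiv.swap_apply_right, upd_a f han] at this
        rw [h1, this]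
      · have := h3 x hxa hxn
        rwa [Equiv.swap_apply_of_ne_of_ne hxa hxb, upd_x f hxa hxn] at this
    · rintro ⟨h1, h2, h3⟩
      refine ⟨h1.symm, h2, fun x hxa hxn => ?_⟩
      by_cases hxb : x = b
      · subst hxb
        rw [Equiv.swap_apply_right, upd_a f han, h1, h3 x hxa hxn]
      · rw [Equiv.swap_apply_of_ne_of_ne hxa hxb, upd_x f hxa hxn, h3 x hxa hxn]
  simp only [key, Finset.sum_ite_eq', mem_univ, if_true]
  rw [← ite_and]
  rfl

theorem EM_PM {a n : X} (han : a ≠ n) : EM d n (PM d a n) = 1 := by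
  ext f g
  rw [EM_apply]
  simp only [Matrix.one_apply]
  have key : ∀ j, PM d a n (Function.update f n j) (Function.update g n j) =
      if j = f a then (if ∀ x, x ≠ n → f x = g x then 1 else 0) else 0 := by
    intro j
    rw [← ite_and]
    simp only [PM]
    congr 1
    simp only [Function.update_self, Function.update_of_ne han, eq_iff_iff]
    constructor
    · rintro ⟨h1, h2, h3⟩
      refine ⟨h1.symm, fun x hxn => ?_⟩
      by_cases hxa : x = a
      · rw [hxa, h1, h2]
      · simpa [hxn] using h3 x hxa hxn
    · rintro ⟨h1, h3⟩
      refine ⟨h1.symm, by rw [h1, h3 a han], fun x hxa hxn => ?_⟩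
      simpa [hxn] using h3 x hxn
  simp only [key, Finset.sum_ite_eq', mem_univ, if_true]
  rw [← ite_and]
  congr 1
  simp only [eq_iff_iff]
  constructor
  · rintro ⟨h1, h2⟩
    funext x
    by_cases hx : x = n
    · rw [hx, h1]
    · exact h2 x hx
  · rintro rfl; simp

end PBT

end PartF1

section PartF2
open Finset Polynomial
open scoped ComplexOrder
namespace PBT

/-- site number `j` -/
def pt (N j : ℕ) : Fin (N + 1) := ⟨min j N, by omega⟩

theorem pt_ne {N i j : ℕ} (h : i < j) (hj : j ≤ N) : pt N i ≠ pt N j := by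
  intro h'
  have := congrArg Fin.val h'
  simp only [pt] at this
  omega

theorem pt_ne' {N i j : ℕ} (h : i < j) (hj : j ≤ N) : pt N j ≠ pt N i := (pt_ne h hj).symm

theorem SM_pos {d N : ℕ} (hd : 0 < d) (x y : Matrix (Fin (N + 1) → Fin d) (Fin (N + 1) → Fin d) ℂ)
    (h : star x * x + star y * y = 0) : x = 0 := by
  by_contra hx
  haveI : Nonempty (Fin (N+1) → Fin d) := ⟨fun _ => ⟨0, hd⟩⟩
  have h1 := tr_pos hx
  have h2 := tr_nonneg (psd_self y)
  have h3 := congrArg tr h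
  rw [map_add, map_zero] at h3
  linarith

/-- the concrete tower -/
noncomputable def cT (d N : ℕ) (hd : 0 < d) :
    Tower (Matrix (Fin (N + 1) → Fin d) (Fin (N + 1) → Fin d) ℂ) d N where
  s j := SM d (Equiv.swap (pt N j) (pt N (j+1)))
  E j := EM d (pt N j)
  s_sq j _ := by rw [SM_mul_SM, Equiv.swap_mul_self, SM_one]
  s_star j _ := by rw [SM_star, Equiv.swap_inv]
  comm i j h hj := by
    rw [SM_mul_SM, SM_mul_SM]
    congr 1
    have h1 := pt_ne (N := N) (i := i) (j := j) (by omega) (by omega)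
    have h2 := pt_ne (N := N) (i := i) (j := j+1) (by omega) (by omega)
    have h3 := pt_ne (N := N) (i := i+1) (j := j) (by omega) (by omega)
    have h4 := pt_ne (N := N) (i := i+1) (j := j+1) (by omega) (by omega)
    have h5 := pt_ne (N := N) (i := i) (j := i+1) (by omega) (by omega)
    have h6 := pt_ne (N := N) (i := j) (j := j+1) (by omega) (by omega)
    exact (Equiv.Perm.disjoint_swap_swap (by simp [*])).commute
  braid j hj := by
    rw [SM_mul_SM, SM_mul_SM, SM_mul_SM, SM_mul_SM]
    congr 1
    have h1 := pt_ne (N := N) (i := j) (j := j+1) (by omega) (by omega)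
    have h2 := pt_ne (N := N) (i := j+1) (j := j+2) (by omega) (by omega)
    have h3 := pt_ne (N := N) (i := j) (j := j+2) (by omega) (by omega)
    rw [Equiv.swap_mul_swap_mul_swap h1 h3, Equiv.swap_comm (pt N j) (pt N (j+1)), 
      Equiv.swap_comm (pt N (j+1)) (pt N (j+1+1)), Equiv.swap_mul_swap_mul_swap h2.symm h3.symm, Equiv.swap_comm]
  E_left j k h hk x := EM_left (Equiv.swap_apply_of_ne_of_ne (pt_ne' (by omega) (by omega))
    (pt_ne' (by omega) (by omega))) x
  E_right j k h hk x := EM_right (Equiv.swap_apply_of_ne_of_ne (pt_ne' (by omega) (by omega))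
    (pt_ne' (by omega) (by omega))) x
  E_one k _ := EM_one _
  E_s k hk := by
    rw [Equiv.swap_comm]
    exact EM_swap (pt_ne' (by omega) (by omega))
  E_faithful k hk x hx := by
    by_contra h0
    haveI : Nonempty (Fin (N+1) → Fin d) := ⟨fun _ => ⟨0, hd⟩⟩
    have h1 := tr_pos h0
    have h2 := tr_EM (pt N k) (star x * x)
    rw [hx, map_zero] at h2
    have : (0:ℝ) < d := by exact_mod_cast hd
    nlinarith
  pos x y h := SM_pos hd x y h

/-- the concrete port -/
noncomputable def cP (d k : ℕ) (hd : 0 < d) : Port (cT d (k+1) hd) where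
  P := PM d (pt (k+1) k) (pt (k+1) (k+1))
  P_star := PM_star _ _
  P_sq := PM_sq (pt_ne (by omega) (by omega))
  P_comm j hj := by
    have := SM_PM (d := d) (Equiv.swap (pt (k+1) j) (pt (k+1) (j+1))) (pt (k+1) k) (pt (k+1) (k+1))
    rwa [Equiv.swap_apply_of_ne_of_ne (pt_ne' (by omega) (by omega)) (pt_ne' (by omega) (by omega)),
      Equiv.swap_apply_of_ne_of_ne (pt_ne' (by omega) (by omega)) (pt_ne' (by omega) (by omega))] at this
  P_s j hj := by
    subst hj
    have := PM_swap (d := d) (a := pt (j+1+1) (j+1)) (b := pt (j+1+1) j) (n := pt (j+1+1) (j+1+1))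
      (pt_ne' (by omega) (by omega)) (pt_ne (by omega) (by omega)) (pt_ne (by omega) (by omega))
    rw [Equiv.swap_comm] at this
    exact this
  F := EM d (pt (k+1) (k+1))
  F_left j hj x := EM_left (Equiv.swap_apply_of_ne_of_ne (pt_ne' (by omega) (by omega))
    (pt_ne' (by omega) (by omega))) x
  F_right j hj x := EM_right (Equiv.swap_apply_of_ne_of_ne (pt_ne' (by omega) (by omega))
    (pt_ne' (by omega) (by omega))) x
  F_P := EM_PM (pt_ne (by omega) (by omega))

theorem swap_mem {d N : ℕ} (hd : 0 < d) {i j : ℕ} (h : i < j) (hj : j < N) :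
    SM d (Equiv.swap (pt N i) (pt N j)) ∈ (cT d N hd).A N := by
  induction j, h using Nat.le_induction with
  | base => exact (cT d N hd).s_mem (by omega)
  | succ j hij ih =>
    have h1 : SM d (Equiv.swap (pt N j) (pt N (j+1))) ∈ (cT d N hd).A N := (cT d N hd).s_mem (by omega)
    have h2 := ih (by omega)
    have := mul_mem (mul_mem h1 h2) h1
    rwa [SM_mul_SM, SM_mul_SM, Equiv.swap_mul_swap_mul_swap (pt_ne (by omega) (by omega))
      (pt_ne (by omega) (by omega)), Equiv.swap_comm] at this
end PBT

end PartF2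

section PartF3
open Finset Polynomial
open scoped ComplexOrder
namespace PBT

section norm
open scoped Matrix.Norms.L2Operator MatrixOrder
variable {n : Type*} [Fintype n] [DecidableEq n]

theorem norm_le_of_psd {A : Matrix n n ℂ} {c : ℝ} (hc : 0 ≤ c) (h0 : A.PosSemidef)
    (h1 : (c • 1 - A).PosSemidef) : ‖Matrix.toEuclideanCLM (𝕜 := ℂ) A‖ ≤ c := by
  rw [← Matrix.cstar_norm_def]
  rw [CStarAlgebra.norm_le_iff_le_algebraMap A hc (Matrix.nonneg_iff_posSemidef.mpr h0), Matrix.le_iff,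
    Algebra.algebraMap_eq_smul_one]
  exact h1

theorem psd_norm {A : Matrix n n ℂ} (h : A.IsHermitian) :
    (‖Matrix.toEuclideanCLM (𝕜 := ℂ) A‖ • 1 - A).PosSemidef := by
  rw [← Matrix.cstar_norm_def]
  have := IsSelfAdjoint.le_algebraMap_norm_self (a := A) h
  rwa [Matrix.le_iff, Algebra.algebraMap_eq_smul_one] at this
end norm

variable {d k N : ℕ}

theorem sigma_eq (a : Fin N) : sigmaPBT d N a =
    (((d : ℝ) ^ N)⁻¹) • PM d a.castSucc (Fin.last N) := by
  ext f g
  rw [Matrix.smul_apply]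
  simp only [sigmaPBT, PM]
  split_ifs with h
  · simp
  · simp

theorem pt_last : pt N N = Fin.last N := by ext; simp [pt]
theorem pt_cast (a : Fin N) : pt N a = a.castSucc := by ext; simp [pt]

theorem ptrace_submatrix (hd : 0 < d) (M : Matrix (Fin (N + 1) → Fin d) (Fin (N + 1) → Fin d) ℂ) :
    ptraceLast d N M = (EM d (Fin.last N) M).submatrix (fun f => Fin.snoc f ⟨0, hd⟩)
      (fun f => Fin.snoc f ⟨0, hd⟩) := by
  ext f g
  rw [Matrix.submatrix_apply, EM_apply]
  simp [ptraceLast, Fin.snoc_last, Fin.update_snoc_last]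

theorem EM_ptrace (M : Matrix (Fin (N + 1) → Fin d) (Fin (N + 1) → Fin d) ℂ) (f g) :
    EM d (Fin.last N) M f g = if f (Fin.last N) = g (Fin.last N) then
      ptraceLast d N M (Fin.init f) (Fin.init g) else 0 := by
  rw [EM_apply]
  have : ∀ (f : Fin (N+1) → Fin d) j, Function.update f (Fin.last N) j = Fin.snoc (Fin.init f) j := by
    intro f j
    conv_lhs => rw [← Fin.snoc_init_self f]
    rw [Fin.update_snoc_last]
  simp only [this]
  rfl

theorem EM_psd (M : Matrix (Fin (N + 1) → Fin d) (Fin (N + 1) → Fin d) ℂ) (L : ℝ)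
    (h : (L • 1 - ptraceLast d N M).PosSemidef) : (L • 1 - EM d (Fin.last N) M).PosSemidef := by
  have h1 := h.submatrix (fun f : Fin (N+1) → Fin d => (Fin.init f : Fin N → Fin d))
  have : L • 1 - EM d (Fin.last N) M = ∑ i : Fin d,
      Matrix.diagonal (fun f : Fin (N+1) → Fin d => if f (Fin.last N) = i then (1:ℂ) else 0) *
      ((L • 1 - ptraceLast d N M).submatrix (fun f : Fin (N+1) → Fin d => (Fin.init f : Fin N → Fin d))
        (fun f : Fin (N+1) → Fin d => (Fin.init f : Fin N → Fin d))) *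
      star (Matrix.diagonal (fun f : Fin (N+1) → Fin d => if f (Fin.last N) = i then (1:ℂ) else 0)) := by
    ext f g
    rw [Matrix.sum_apply]
    have e : ∀ i, star (Matrix.diagonal (fun f : Fin (N+1) → Fin d => if f (Fin.last N) = i then (1:ℂ) else 0)) =
        Matrix.diagonal (fun f : Fin (N+1) → Fin d => if f (Fin.last N) = i then (1:ℂ) else 0) := by
      intro i
      rw [Matrix.star_eq_conjTranspose, Matrix.diagonal_conjTranspose]
      congr 1
      funext f
      simp only [Pi.star_apply]
      split_ifs <;> simp
    simp only [e, Matrix.diagonal_mul, Matrix.mul_diagonal, Matrix.submatrix_apply, Matrix.sub_apply,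
      Matrix.smul_apply, EM_ptrace, Matrix.one_apply]
    have hfg : f = g ↔ f (Fin.last N) = g (Fin.last N) ∧ (Fin.init f : Fin N → Fin d) = Fin.init g := by
      constructor
      · rintro rfl; simp
      · rintro ⟨h1, h2⟩
        rw [← Fin.snoc_init_self f, ← Fin.snoc_init_self g, h1, h2]
    by_cases hl : f (Fin.last N) = g (Fin.last N)
    · simp [hfg, hl]
    · have : ∀ i, ¬ (f (Fin.last N) = i ∧ g (Fin.last N) = i) := fun i h => hl (h.1.trans h.2.symm)
      simp [hfg, hl, Ne.symm hl, eq_comm]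
  rw [this]
  apply psd_sum
  intro i _
  exact psd_conj h1 _

open scoped Classical in
theorem concrete_upper (hd : 0 < d) (t : List (Fin d) → ℝ) (ht : ∀ w ∈ W d (k+1), 0 < t w)
    (htc : ∀ i v, v ∈ W d k → Valid (i :: v) → t (i :: rep (sh v)) = t (i :: v))
    (hsum : ∀ v ∈ W d k, (∑ i, if Valid (i :: v) then (t (i :: v))⁻¹ else 0) = 1)
    (c : ℝ) (hc0 : 0 ≤ c)
    (hc : ∀ w ∈ W d (k+1), (∑ T ∈ TS d k, if sh T = sh w then t T else 0) ≤ c) :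
    ∃ Ω : Matrix (Fin (k + 1 + 1) → Fin d) (Fin (k + 1 + 1) → Fin d) ℂ,
      Ω.IsHermitian ∧ (∀ a : Fin (k+1), (Ω - sigmaPBT d (k+1) a).PosSemidef) ∧
      (d : ℝ) ^ (k+1) * ‖Matrix.toEuclideanCLM (𝕜 := ℂ) (ptraceLast d (k+1) Ω)‖ ≤ c := by
  haveI : Nonempty (Fin (k+1+1) → Fin d) := ⟨fun _ => ⟨0, hd⟩⟩
  have hd' : (0:ℝ) < (d : ℝ) ^ (k+1) := by positivity
  obtain ⟨Ω, h1, h2, h3, h4⟩ := (cP d k hd).upper hd t ht htc hsum c hc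
  have hF : ∀ M, (cP d k hd).F M = EM d (Fin.last (k+1)) M := by
    intro M; rw [← pt_last]; rfl
  have hP : (cP d k hd).P = PM d (pt (k+1) k) (Fin.last (k+1)) := by rw [← pt_last]; rfl
  rw [hF] at h3 h4
  rw [hP] at h2
  have h5 : ∀ a : Fin (k+1), (Ω - PM d a.castSucc (Fin.last (k+1))).PosSemidef := by
    intro a
    rw [← pt_cast]
    rcases (Nat.lt_succ_iff.mp a.2).eq_or_lt with ha | ha
    · rw [ha]; exact h2
    · set σ := Equiv.swap (pt (k+1) a) (pt (k+1) k) with hσ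
      have hm : SM d σ ∈ (cT d (k+1) hd).A (k+1) := swap_mem hd ha (by omega)
      have hc := psd_conj h2 (SM d σ)
      have hss : SM d σ * star (SM d σ) = 1 := by
        rw [SM_star, SM_mul_SM, mul_inv_cancel, SM_one]
      rw [mul_sub, sub_mul, h1 _ hm, mul_assoc, hss, mul_one, SM_PM, mul_assoc, hss, mul_one] at hc
      have e1 : σ (pt (k+1) k) = pt (k+1) a := by rw [hσ, Equiv.swap_apply_right]
      have e2 : σ (Fin.last (k+1)) = Fin.last (k+1) := by
        rw [hσ, ← pt_last, Equiv.swap_apply_of_ne_of_ne (pt_ne' (by omega) (by omega)) (pt_ne' (by omega) (by omega))]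
      rwa [e1, e2] at hc
  have hp0 : (ptraceLast d (k+1) Ω).PosSemidef := by
    rw [ptrace_submatrix hd]; exact h3.submatrix _
  have hp1 : (c • 1 - ptraceLast d (k+1) Ω).PosSemidef := by
    have := h4.submatrix (fun f : Fin (k+1) → Fin d => (Fin.snoc f ⟨0, hd⟩ : Fin (k+1+1) → Fin d))
    rw [ptrace_submatrix hd]
    convert this using 1
    ext f g
    simp only [Matrix.submatrix_apply, Matrix.sub_apply, Matrix.smul_apply, Matrix.one_apply]
    congr 3
    simp only [eq_iff_iff]
    constructor
    · rintro rfl; rfl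
    · intro h
      have := congrArg (fun q : Fin (k+1+1) → Fin d => (Fin.init q : Fin (k+1) → Fin d)) h
      simpa [Fin.init_snoc] using this
  have hsm : ptraceLast d (k+1) ((((d : ℝ) ^ (k+1))⁻¹) • Ω) = (((d : ℝ) ^ (k+1))⁻¹) • ptraceLast d (k+1) Ω := by
    ext f g
    simp only [ptraceLast, Matrix.smul_apply, Finset.smul_sum]
  refine ⟨(((d : ℝ) ^ (k+1))⁻¹) • Ω, ?_, ?_, ?_⟩
  · have h6 := (h2.add ((cP d k hd).P_psd hd))
    rw [hP, sub_add_cancel] at h6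
    exact (psd_smul (by positivity) h6).1
  · intro a
    rw [sigma_eq, ← smul_sub]
    exact psd_smul (by positivity) (h5 a)
  · have h7 : ‖Matrix.toEuclideanCLM (𝕜 := ℂ) (ptraceLast d (k+1) ((((d : ℝ) ^ (k+1))⁻¹) • Ω))‖ ≤
        ((d : ℝ) ^ (k+1))⁻¹ * c := by
      apply norm_le_of_psd (by positivity)
      · rw [hsm]; exact psd_smul (by positivity) hp0
      · rw [hsm, mul_smul, ← smul_sub]; exact psd_smul (by positivity) hp1
    calc _ ≤ (d : ℝ) ^ (k+1) * (((d : ℝ) ^ (k+1))⁻¹ * c) := by gcongr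
      _ = c := by field_simp
end PBT

end PartF3

section PartF4
open Finset Polynomial
open scoped ComplexOrder
namespace PBT
variable {d k N : ℕ}

/-- permutations fixing the last site -/
def GG (N : ℕ) : Finset (Equiv.Perm (Fin (N+1))) := univ.filter (fun σ => σ (Fin.last N) = Fin.last N)

theorem mem_GG {σ : Equiv.Perm (Fin (N+1))} : σ ∈ GG N ↔ σ (Fin.last N) = Fin.last N := by simp [GG]

theorem GG_pos : (0:ℝ) < (GG N).card := by
  have : (1 : Equiv.Perm (Fin (N+1))) ∈ GG N := by rw [mem_GG]; rfl
  exact_mod_cast Finset.card_pos.mpr ⟨_, this⟩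

theorem avg_const {V : Type*} [AddCommGroup V] [Module ℝ V] (x : V) :
    ((GG N).card : ℝ)⁻¹ • ∑ _σ ∈ GG N, x = x := by
  rw [Finset.sum_const, ← Nat.cast_smul_eq_nsmul ℝ, smul_smul, inv_mul_cancel₀ GG_pos.ne', one_smul]

theorem ptrace_herm {Ω : Matrix (Fin (N + 1) → Fin d) (Fin (N + 1) → Fin d) ℂ} (h : Ω.IsHermitian) :
    (ptraceLast d N Ω).IsHermitian := by
  ext f g
  rw [Matrix.conjTranspose_apply]
  simp only [ptraceLast, star_sum]
  apply Finset.sum_congr rfl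
  intro j _
  exact h.apply _ _

open scoped Classical in
theorem concrete_lower (hd : 0 < d)
    (Ω : Matrix (Fin (k + 1 + 1) → Fin d) (Fin (k + 1 + 1) → Fin d) ℂ)
    (hH : Ω.IsHermitian) (hO : ∀ a : Fin (k+1), (Ω - sigmaPBT d (k+1) a).PosSemidef)
    (val : (Fin d → ℕ) → ℝ) :
    ∑ v ∈ V0 d k, (∑ i, if Valid (i :: v) then val (sh (i :: v)) else 0)^2 ≤
      ((d : ℝ) ^ (k+1) * ‖Matrix.toEuclideanCLM (𝕜 := ℂ) (ptraceLast d (k+1) Ω)‖) *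
        ∑ w ∈ V0 d (k+1), val (sh w)^2 := by
  haveI : Nonempty (Fin (k+1+1) → Fin d) := ⟨fun _ => ⟨0, hd⟩⟩
  have hd' : (0:ℝ) < (d : ℝ) ^ (k+1) := by positivity
  set L := (d : ℝ) ^ (k+1) * ‖Matrix.toEuclideanCLM (𝕜 := ℂ) (ptraceLast d (k+1) Ω)‖ with hLdef
  set D : ℝ := (d : ℝ) ^ (k+1) with hD
  have hF : ∀ M, (cP d k hd).F M = EM d (Fin.last (k+1)) M := by
    intro M; rw [← pt_last]; rfl
  have hP : (cP d k hd).P = PM d (pt (k+1) k) (Fin.last (k+1)) := by rw [← pt_last]; rfl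
  have hO' : ∀ a : Fin (k+1), (D • Ω - PM d a.castSucc (Fin.last (k+1))).PosSemidef := by
    intro a
    have := psd_smul hd'.le (hO a)
    rwa [sigma_eq, smul_sub, smul_smul, mul_inv_cancel₀ hd'.ne', one_smul] at this
  have hFO : (L • 1 - EM d (Fin.last (k+1)) (D • Ω)).PosSemidef := by
    have h1 := EM_psd Ω _ (psd_norm (ptrace_herm (d := d) (N := k+1) hH))
    have h2 := psd_smul hd'.le h1
    rwa [smul_sub, smul_smul, ← hLdef, ← map_smul] at h2
  have hss : ∀ σ : Equiv.Perm (Fin (k+1+1)), SM d σ * star (SM d σ) = 1 := by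
    intro σ
    rw [SM_star, SM_mul_SM, mul_inv_cancel, SM_one]
  set c : ℝ := ((GG (k+1)).card : ℝ)⁻¹ with hc
  have hc0 : 0 ≤ c := by positivity
  set Ob := c • ∑ σ ∈ GG (k+1), SM d σ * (D • Ω) * star (SM d σ) with hOb
  refine (cP d k hd).lower hd (fun M => tr_EM _ M) (fun M => tr_EM _ M) Ob ?_ ?_ L ?_ val
  · intro a ha
    refine (cT d (k+1) hd).comm_of_gen ?_ ha
    intro j hj
    change SM d (Equiv.swap (pt (k+1) j) (pt (k+1) (j+1))) * Ob = Ob * SM d (Equiv.swap (pt (k+1) j) (pt (k+1) (j+1)))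
    set ρ := Equiv.swap (pt (k+1) j) (pt (k+1) (j+1)) with hρ
    have hρl : ρ (Fin.last (k+1)) = Fin.last (k+1) := by
      rw [hρ, ← pt_last, Equiv.swap_apply_of_ne_of_ne (pt_ne' (by omega) (by omega)) (pt_ne' (by omega) (by omega))]
    rw [hOb, mul_smul_comm, smul_mul_assoc, Finset.mul_sum, Finset.sum_mul]
    congr 1
    refine Finset.sum_bij (fun σ _ => ρ * σ) ?_ ?_ ?_ ?_
    · intro σ hσ
      rw [mem_GG] at hσ ⊢
      rw [Equiv.Perm.mul_apply, hσ, hρl]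
    · intro σ _ σ' _ h; exact mul_left_cancel h
    · intro σ hσ
      refine ⟨ρ⁻¹ * σ, ?_, by simp⟩
      rw [mem_GG] at hσ ⊢
      rw [Equiv.Perm.mul_apply, hσ]
      exact symm_fix hρl
    · intro σ hσ
      rw [SM_star, SM_star, ← SM_mul_SM, mul_inv_rev, ← SM_mul_SM]
      have : SM d ρ⁻¹ * SM d ρ = 1 := by rw [SM_mul_SM, inv_mul_cancel, SM_one]
      simp only [mul_assoc, this, mul_one]
  · rw [hP, ← avg_const (N := k+1) (PM d (pt (k+1) k) (Fin.last (k+1))), hOb, ← smul_sub, ← Finset.sum_sub_distrib]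
    apply psd_smul hc0
    apply psd_sum
    intro σ hσ
    rw [mem_GG] at hσ
    have hne : σ⁻¹ (pt (k+1) k) ≠ Fin.last (k+1) := by
      intro h
      rw [Equiv.Perm.inv_eq_iff_eq, hσ, ← pt_last] at h
      exact pt_ne (by omega) (by omega) h
    obtain ⟨a, ha⟩ := Fin.exists_castSucc_eq.mpr hne
    have h1 := psd_conj (hO' a) (SM d σ)
    rw [mul_sub, sub_mul, SM_PM, mul_assoc (PM d _ _), hss, mul_one, hσ, ha] at h1
    simpa using h1
  · rw [hF, hOb, map_smul, map_sum]
    have : L • (1 : Matrix (Fin (k + 1 + 1) → Fin d) (Fin (k + 1 + 1) → Fin d) ℂ) = 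
      c • ∑ _σ ∈ GG (k+1), L • 1 := (avg_const _).symm
    rw [this, ← smul_sub, ← Finset.sum_sub_distrib]
    apply psd_smul hc0
    apply psd_sum
    intro σ hσ
    rw [mem_GG] at hσ
    have h1 := psd_conj hFO (SM d σ)
    have h2 : EM d (Fin.last (k+1)) (SM d σ * (D • Ω) * star (SM d σ)) =
        SM d σ * EM d (Fin.last (k+1)) (D • Ω) * star (SM d σ) := by
      rw [SM_star, EM_right (σ := σ⁻¹) (symm_fix hσ), EM_left hσ]
    rw [h2]
    rwa [mul_sub, sub_mul, mul_smul_comm, mul_one, smul_mul_assoc, hss] at h1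
end PBT

end PartF4

section PartG1
open Finset
namespace PBT
variable {d k N : ℕ}

/-- row lengths of a diagram, first `d` rows -/
def rs (d : ℕ) (μ : YoungDiagram) : Fin d → ℕ := fun i => μ.rowLen i

theorem rs_anti (μ : YoungDiagram) : Antitone (rs d μ) := fun i j h => μ.rowLen_anti i j h

theorem row_lt {μ : YoungDiagram} (h : μ.colLen 0 ≤ d) {i j : ℕ} (hm : (i, j) ∈ μ) : i < d := by
  have : (i, 0) ∈ μ := μ.up_left_mem le_rfl (Nat.zero_le j) hm
  exact lt_of_lt_of_le (YoungDiagram.mem_iff_lt_colLen.mp this) h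

theorem le_of_rs {μ ν : YoungDiagram} (h : μ.colLen 0 ≤ d) (hr : rs d μ ≤ rs d ν) : μ ≤ ν := by
  rintro ⟨i, j⟩ hm
  have hi := row_lt h hm
  exact YoungDiagram.mem_iff_lt_rowLen.mpr
    (lt_of_lt_of_le (YoungDiagram.mem_iff_lt_rowLen.mp hm) (hr ⟨i, hi⟩))

theorem rs_inj {μ ν : YoungDiagram} (h : μ.colLen 0 ≤ d) (h' : ν.colLen 0 ≤ d)
    (hr : rs d μ = rs d ν) : μ = ν :=
  le_antisymm (le_of_rs h hr.le) (le_of_rs h' hr.ge)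

theorem rs_mono {μ ν : YoungDiagram} (h : μ ≤ ν) : rs d μ ≤ rs d ν := by
  intro i
  by_contra hc
  rw [not_le] at hc
  have : ((i : ℕ), ν.rowLen i) ∈ μ := YoungDiagram.mem_iff_lt_rowLen.mpr hc
  have := YoungDiagram.mem_iff_lt_rowLen.mp (h this)
  omega

theorem card_rs {μ : YoungDiagram} (h : μ.colLen 0 ≤ d) : μ.card = ∑ i, rs d μ i := by
  have : ∀ i : Fin d, rs d μ i = (μ.cells.filter (fun c => c.1 = (i : ℕ))).card := by
    intro i
    exact μ.rowLen_eq_card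
  simp only [this]
  rw [Fin.sum_univ_eq_sum_range (fun i => (μ.cells.filter (fun c => c.1 = i)).card) d]
  exact Finset.card_eq_sum_card_fiberwise (fun c hc => by
    have hc' : (c.1, c.2) ∈ μ := by simpa using hc
    simpa using row_lt h hc')

/-- diagram with given rows -/
def mkY (κ : Fin d → ℕ) (hκ : Antitone κ) : YoungDiagram where
  cells := (univ : Finset (Σ i : Fin d, Fin (κ i))).image (fun p => ((p.1 : ℕ), (p.2 : ℕ)))
  isLowerSet := by
    rintro ⟨i, j⟩ ⟨i', j'⟩ h hm
    simp only [coe_image, coe_univ, Set.image_univ, Set.mem_range, Prod.mk.injEq] at hm ⊢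
    obtain ⟨⟨a, b⟩, h1, h2⟩ := hm
    obtain ⟨h3, h4⟩ := h
    simp only at h1 h2 h3 h4
    subst h1 h2
    have hb := b.2
    have hx : i' < d := lt_of_le_of_lt h3 a.2
    have := hκ (show (⟨i', hx⟩ : Fin d) ≤ a from h3)
    exact ⟨⟨⟨i', hx⟩, ⟨j', by omega⟩⟩, rfl, rfl⟩

theorem mem_mkY {κ : Fin d → ℕ} {hκ : Antitone κ} {i j : ℕ} :
    (i, j) ∈ mkY κ hκ ↔ ∃ h : i < d, j < κ ⟨i, h⟩ := by
  rw [← YoungDiagram.mem_cells]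
  simp only [mkY, mem_image, mem_univ, true_and, Prod.mk.injEq]
  constructor
  · rintro ⟨⟨a, b⟩, rfl, rfl⟩
    exact ⟨a.2, b.2⟩
  · rintro ⟨h, h'⟩
    exact ⟨⟨⟨i, h⟩, ⟨j, h'⟩⟩, rfl, rfl⟩

theorem rs_mkY (κ : Fin d → ℕ) (hκ : Antitone κ) : rs d (mkY κ hκ) = κ := by
  funext i
  apply eq_of_forall_lt_iff
  intro c
  rw [rs, ← YoungDiagram.mem_iff_lt_rowLen, mem_mkY]
  exact ⟨fun h => h.2, fun h => ⟨i.2, h⟩⟩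

theorem col_mkY (κ : Fin d → ℕ) (hκ : Antitone κ) : (mkY κ hκ).colLen 0 ≤ d := by
  by_contra h
  rw [not_le, ← YoungDiagram.mem_iff_lt_colLen, mem_mkY] at h
  obtain ⟨h, _⟩ := h
  omega

theorem exists_part (κ : Fin d → ℕ) (hκ : Antitone κ) (hs : ∑ i, κ i = N) :
    ∃ μ : PartLE N d, rs d μ.1 = κ :=
  ⟨⟨mkY κ hκ, by rw [card_rs (col_mkY κ hκ), rs_mkY, hs], col_mkY κ hκ⟩, rs_mkY κ hκ⟩

theorem part_inj {μ ν : PartLE N d} (h : rs d μ.1 = rs d ν.1) : μ = ν :=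
  Subtype.ext (rs_inj μ.2.2 ν.2.2 h)

theorem part_sum (μ : PartLE N d) : ∑ i, rs d μ.1 i = N := by rw [← card_rs μ.2.2, μ.2.1]

theorem addBox_iff (α : PartLE k d) (μ : PartLE (k+1) d) :
    AddBox α.1 μ.1 ↔ ∃ i, ∀ j, rs d μ.1 j = rs d α.1 j + if i = j then 1 else 0 := by
  constructor
  · rintro ⟨h, -⟩
    have hle := rs_mono (d := d) h
    have h1 := part_sum μ
    have h2 := part_sum α
    have hlt : ∑ i, rs d α.1 i < ∑ i, rs d μ.1 i := by omega
    obtain ⟨i, _, hi⟩ := Finset.exists_lt_of_sum_lt hlt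
    refine ⟨i, ?_⟩
    have key : ∀ j ∈ univ, (rs d α.1 j + if i = j then 1 else 0) = rs d μ.1 j := by
      apply (Finset.sum_eq_sum_iff_of_le ?_).mp
      · rw [Finset.sum_add_distrib]; simp; omega
      · intro j _
        have := hle j
        split_ifs with hj
        · subst hj; omega
        · omega
    exact fun j => (key j (mem_univ _)).symm
  · rintro ⟨i, hi⟩
    refine ⟨le_of_rs α.2.2 ?_, by rw [μ.2.1, α.2.1]⟩
    intro j
    rw [hi j]; exact Nat.le_add_right _ _

theorem addBox_col {α μ : YoungDiagram} (h : AddBox α μ) (hc : μ.colLen 0 ≤ d) : α.colLen 0 ≤ d := by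
  by_contra hh
  rw [not_le, ← YoungDiagram.mem_iff_lt_colLen] at hh
  have := YoungDiagram.mem_iff_lt_colLen.mp (h.1 hh)
  omega

theorem addBox_inf {α μ ν : YoungDiagram} (hne : μ ≠ ν) (h : AddBox α μ) (h' : AddBox α ν) :
    α = μ ⊓ ν := by
  apply YoungDiagram.ext
  apply Finset.eq_of_subset_of_card_le
  · exact le_inf h.1 h'.1
  · by_contra hc
    rw [not_le] at hc
    have e1 : (μ ⊓ ν).cells = μ.cells := by
      apply Finset.eq_of_subset_of_card_le
      · exact (inf_le_left : μ ⊓ ν ≤ μ)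
      · have := h.2; simp only [YoungDiagram.card] at this; omega
    have e2 : (μ ⊓ ν).cells = ν.cells := by
      apply Finset.eq_of_subset_of_card_le
      · exact (inf_le_right : μ ⊓ ν ≤ ν)
      · have := h'.2; simp only [YoungDiagram.card] at this; omega
    exact hne (YoungDiagram.ext (e1.symm.trans e2))

open scoped Classical in
/-- incidence matrix -/
noncomputable def BB (k d : ℕ) : Matrix (PartLE k d) (PartLE (k+1) d) ℝ :=
  fun α μ => if AddBox α.1 μ.1 then 1 else 0

theorem MF_eq : MF (k+1) d = (BB k d).transpose * BB k d := by
  classical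
  ext μ ν
  rw [Matrix.mul_apply]
  simp only [Matrix.transpose_apply, BB, MF]
  have hs : ∑ α : PartLE k d, ((if AddBox α.1 μ.1 then (1:ℝ) else 0) * if AddBox α.1 ν.1 then 1 else 0)
      = (univ.filter (fun α : PartLE k d => AddBox α.1 μ.1 ∧ AddBox α.1 ν.1)).card := by
    rw [Finset.card_filter]
    push_cast
    apply Finset.sum_congr rfl
    intro α _
    by_cases h : AddBox α.1 μ.1 <;> by_cases h' : AddBox α.1 ν.1 <;> simp [h, h']
  rw [hs]
  have hlift : ∀ α : YoungDiagram, AddBox α μ.1 → ∃ α' : PartLE k d, α'.1 = α := by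
    intro α h
    exact ⟨⟨α, by have := h.2; rw [μ.2.1] at this; omega, addBox_col h μ.2.2⟩, rfl⟩
  split_ifs with h h'
  · subst h
    simp only [and_self]
    rw [← Fintype.card_subtype, ← Nat.card_eq_fintype_card, nBox]
    congr 1
    refine Nat.card_congr (Equiv.symm ?_)
    refine Equiv.ofBijective (fun α => ⟨α.1.1, α.2⟩) ⟨?_, ?_⟩
    · intro a b hab
      simp only [Subtype.mk.injEq] at hab
      exact Subtype.ext (Subtype.ext hab)
    · rintro ⟨α, hα⟩
      obtain ⟨α', rfl⟩ := hlift α hα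
      exact ⟨⟨α', hα⟩, rfl⟩
  · obtain ⟨hne, α, h1, h2⟩ := h'
    obtain ⟨α', rfl⟩ := hlift α h1
    symm
    rw [Nat.cast_eq_one, Finset.card_eq_one]
    refine ⟨α', ?_⟩
    ext β
    simp only [mem_filter, mem_univ, true_and, mem_singleton]
    constructor
    · rintro ⟨h3, h4⟩
      exact Subtype.ext ((addBox_inf hne h3 h4).trans (addBox_inf hne h1 h2).symm)
    · rintro rfl; exact ⟨h1, h2⟩
  · symm
    rw [Nat.cast_eq_zero, Finset.card_eq_zero, Finset.filter_eq_empty_iff]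
    rintro α _ ⟨h1, h2⟩
    exact h' ⟨fun e => h (Subtype.ext e), α.1, h1, h2⟩

/-- transfer of sums over partitions to sums over shape representatives -/
theorem sum_part (g : (Fin d → ℕ) → ℝ) : ∑ α : PartLE k d, g (rs d α.1) = ∑ v ∈ V0 d k, g (sh v) := by
  symm
  have h : ∀ v ∈ V0 d k, ∃ α : PartLE k d, rs d α.1 = sh v := by
    intro v hv
    obtain ⟨h1, h2⟩ := mem_W.mp (mem_V0.mp hv).1
    exact exists_part _ h1.antitone (by rw [← length_eq_sum, h2])
  choose φ hφ using h
  refine Finset.sum_bij (fun v hv => φ v hv) (fun _ _ => mem_univ _) ?_ ?_ ?_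
  · intro v hv v' hv' e
    rw [(mem_V0.mp hv).2, (mem_V0.mp hv').2, ← hφ v hv, ← hφ v' hv', e]
  · intro α _
    obtain ⟨w, h1, h2, h3⟩ := exists_word k _ (rs_anti (d := d) α.1) (part_sum α)
    have hw : w ∈ W d k := mem_W.mpr ⟨h1, h2⟩
    refine ⟨rep (sh w), rep_mem_V0 hw, part_inj ?_⟩
    rw [hφ _ (rep_mem_V0 hw), (rep_spec h1).2, h3]
  · intro v hv
    rw [hφ v hv]

open scoped Classical in
theorem sum_add (α : PartLE k d) {v : List (Fin d)} (hv : Valid v) (hs : sh v = rs d α.1)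
    (x : (Fin d → ℕ) → ℝ) :
    (∑ i, if Valid (i :: v) then x (sh (i :: v)) else 0) = ∑ μ, BB k d α μ * x (rs d μ.1) := by
  simp only [BB, ite_mul, one_mul, zero_mul]
  rw [← Finset.sum_filter, ← Finset.sum_filter]
  have h : ∀ i, Valid (i :: v) → ∃ μ : PartLE (k+1) d, rs d μ.1 = sh (i :: v) := by
    intro i hi
    exact exists_part _ hi.antitone (by rw [← length_eq_sum, List.length_cons, length_eq_sum, hs, part_sum])
  choose φ hφ using h
  refine Finset.sum_bij (fun i hi => φ i (mem_filter.mp hi).2) ?_ ?_ ?_ ?_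
  · intro i hi
    simp only [mem_filter, mem_univ, true_and] at hi ⊢
    rw [addBox_iff]
    exact ⟨i, fun j => by rw [hφ i hi, sh_cons, hs]⟩
  · intro i hi j hj e
    simp only [mem_filter, mem_univ, true_and] at hi hj
    have h1 := hφ i hi
    rw [e, hφ j hj] at h1
    have h2 := congrFun h1 i
    rw [sh_cons, sh_cons, if_pos rfl] at h2
    by_contra hne
    rw [if_neg (Ne.symm hne)] at h2
    omega
  · intro μ hμ
    simp only [mem_filter, mem_univ, true_and] at hμ
    rw [addBox_iff] at hμ
    obtain ⟨i, hi⟩ := hμ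
    have e : sh (i :: v) = rs d μ.1 := by
      funext j; rw [sh_cons, hs, hi j]
    have hV : Valid (i :: v) := ⟨hv, by rw [e]; exact rs_anti _⟩
    refine ⟨i, by simp [hV], part_inj ?_⟩
    rw [hφ i hV, e]
  · intro i hi
    simp only [mem_filter, mem_univ, true_and] at hi
    rw [hφ i hi]
end PBT

end PartG1

section PartG2
open Finset
namespace PBT
variable {n : Type*} [Fintype n] [DecidableEq n]
open Matrix

theorem perron (M : Matrix n n ℝ) (hM : M.IsHermitian) (h0 : ∀ i j, 0 ≤ M i j) (lam c : ℝ)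
    (hlam : ∀ x : ℝ, (∃ v : n → ℝ, v ≠ 0 ∧ M.mulVec v = x • v) → x ≤ lam) (hc : lam < c) (hc0 : 0 < c) :
    ∃ v : n → ℝ, (∀ i, 0 < v i) ∧ ∀ i, M.mulVec v i ≤ c * v i := by
  set A : Matrix n n ℝ := c • (1 : Matrix n n ℝ) - M with hA
  have hmul : ∀ v, A.mulVec v = c • v - M.mulVec v := by
    intro v; rw [hA, Matrix.sub_mulVec, Matrix.smul_mulVec, Matrix.one_mulVec]
  have hAH : A.IsHermitian := by
    apply Matrix.IsHermitian.sub _ hM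
    rw [Matrix.IsHermitian, Matrix.conjTranspose_smul, Matrix.conjTranspose_one]; simp
  have hpd : A.PosDef := by
    rw [hAH.posDef_iff_eigenvalues_pos]
    intro i
    have h1 := hAH.mulVec_eigenvectorBasis i
    rw [hmul] at h1
    have h2 := hlam (c - hAH.eigenvalues i) ⟨(hAH.eigenvectorBasis i).ofLp, ?_, ?_⟩
    · linarith
    · intro h
      have h3 := hAH.eigenvectorBasis.orthonormal.ne_zero i
      apply h3
      ext j
      exact congrFun h j
    · rw [sub_smul, ← h1]; abel
  obtain ⟨v, hv⟩ : ∃ v : n → ℝ, A.mulVec v = 1 := by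
    have hu := (Matrix.isUnit_iff_isUnit_det A).mp hpd.isUnit
    exact ⟨A⁻¹.mulVec 1, by rw [Matrix.mulVec_mulVec, Matrix.mul_nonsing_inv _ hu, Matrix.one_mulVec]⟩
  have hnn : ∀ i, 0 ≤ v i := by
    set p : n → ℝ := fun i => max (v i) 0 with hp
    set m : n → ℝ := fun i => max (-v i) 0 with hm
    have hvpm : v = p - m := by
      funext i
      simp only [hp, hm, Pi.sub_apply]
      rcases le_total (v i) 0 with h | h
      · rw [max_eq_right h, max_eq_left (by linarith)]; ring
      · rw [max_eq_left h, max_eq_right (by linarith)]; ring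
    have h1 : 0 ≤ m ⬝ᵥ A.mulVec v := by
      rw [hv]
      exact Finset.sum_nonneg (fun i _ => by simp [hm])
    have h2 : m ⬝ᵥ A.mulVec p ≤ 0 := by
      rw [hmul, dotProduct_sub]
      have h3 : m ⬝ᵥ c • p = 0 := by
        apply Finset.sum_eq_zero
        intro i _
        simp only [Pi.smul_apply, smul_eq_mul, hp, hm]
        rcases le_total (v i) 0 with h | h
        · rw [max_eq_right h]; ring
        · rw [max_eq_right (a := -v i) (by linarith)]; ring
      have h4 : 0 ≤ m ⬝ᵥ M.mulVec p := by
        apply Finset.sum_nonneg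
        intro i _
        apply mul_nonneg (le_max_right _ _)
        exact Finset.sum_nonneg (fun j _ => mul_nonneg (h0 i j) (le_max_right _ _))
      linarith
    have h5 : m = 0 := by
      by_contra hne
      have h6 := hpd.dotProduct_mulVec_pos hne
      have h7 : star m = m := by ext i; simp
      rw [h7] at h6
      rw [hvpm, Matrix.mulVec_sub, dotProduct_sub] at h1
      linarith
    intro i
    have := congrFun h5 i
    simp only [hm, Pi.zero_apply] at this
    have h8 := le_max_left (-v i) 0
    linarith
  have hMv : ∀ i, M.mulVec v i = c * v i - 1 := by
    intro i
    have := congrFun hv i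
    rw [hmul] at this
    simp only [Pi.sub_apply, Pi.smul_apply, smul_eq_mul, Pi.one_apply] at this
    linarith
  refine ⟨v, fun i => ?_, fun i => by rw [hMv]; linarith⟩
  have h1 : 0 ≤ M.mulVec v i := Finset.sum_nonneg (fun j _ => mul_nonneg (h0 i j) (hnn j))
  rw [hMv] at h1
  by_contra hneg
  have : v i = 0 := le_antisymm (not_lt.mp hneg) (hnn i)
  rw [this] at h1
  linarith
end PBT

end PartG2

section PartG3
open Finset
open scoped ComplexOrder
namespace PBT
variable {d k N : ℕ}
open Matrix

/-- extend a function on partitions to all shapes -/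
noncomputable def ex (f : PartLE N d → ℝ) : (Fin d → ℕ) → ℝ :=
  Function.extend (fun μ : PartLE N d => rs d μ.1) f 0

theorem ex_rs (f : PartLE N d → ℝ) (μ : PartLE N d) : ex f (rs d μ.1) = f μ :=
  Function.Injective.extend_apply (fun _ _ h => part_inj h) f 0 μ

theorem part_of {w : List (Fin d)} (h : w ∈ W d N) : ∃ μ : PartLE N d, rs d μ.1 = sh w := by
  obtain ⟨h1, h2⟩ := mem_W.mp h
  exact exists_part _ h1.antitone (by rw [← length_eq_sum, h2])

theorem BB_nonneg (α : PartLE k d) (μ) : 0 ≤ BB k d α μ := by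
  simp only [BB]; split_ifs <;> simp

theorem lower_final (hd : 0 < d)
    (Ω : Matrix (Fin (k + 1 + 1) → Fin d) (Fin (k + 1 + 1) → Fin d) ℂ)
    (hH : Ω.IsHermitian) (hO : ∀ a : Fin (k+1), (Ω - sigmaPBT d (k+1) a).PosSemidef) (lam : ℝ)
    (x : PartLE (k+1) d → ℝ) (hx : x ≠ 0) (hl : (MF (k+1) d).mulVec x = lam • x) :
    lam ≤ (d : ℝ) ^ (k+1) * ‖Matrix.toEuclideanCLM (𝕜 := ℂ) (ptraceLast d (k+1) Ω)‖ := by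
  classical
  have h := concrete_lower hd Ω hH hO (ex x)
  rw [← sum_part (fun κ => ex x κ ^ 2)] at h
  simp only [ex_rs] at h
  have e1 : ∑ v ∈ V0 d k, (∑ i, if Valid (i :: v) then ex x (sh (i :: v)) else 0)^2
      = ∑ α, ((BB k d).mulVec x α)^2 := by
    have e2 : ∀ v ∈ V0 d k, (∑ i, if Valid (i :: v) then ex x (sh (i :: v)) else 0)^2 =
        (ex ((BB k d).mulVec x) (sh v))^2 := by
      intro v hv
      have hw := (mem_V0.mp hv).1
      obtain ⟨α, hα⟩ := part_of hw
      rw [sum_add α (mem_W.mp hw).1 hα.symm, ← hα, ex_rs]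
      simp only [ex_rs]
      rfl
    rw [Finset.sum_congr rfl e2, ← sum_part (fun κ => ex ((BB k d).mulVec x) κ ^ 2)]
    simp only [ex_rs]
  rw [e1] at h
  have e3 : ∑ α, ((BB k d).mulVec x α)^2 = lam * ∑ μ, x μ ^ 2 := by
    calc _ = (BB k d).mulVec x ⬝ᵥ (BB k d).mulVec x := by
          simp only [dotProduct, sq]
      _ = x ⬝ᵥ (MF (k+1) d).mulVec x := by
          rw [MF_eq, ← Matrix.mulVec_mulVec, Matrix.dotProduct_mulVec x, Matrix.vecMul_transpose]
      _ = _ := by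
          rw [hl, dotProduct_smul, smul_eq_mul]
          simp only [dotProduct, sq]
  rw [e3] at h
  have hpos : 0 < ∑ μ, x μ ^ 2 := by
    obtain ⟨μ, hμ⟩ := Function.ne_iff.mp hx
    have hμ' : 0 < x μ ^ 2 := by
      have : x μ ≠ 0 := hμ
      positivity
    exact lt_of_lt_of_le hμ' (Finset.single_le_sum (f := fun μ => x μ ^ 2) (fun _ _ => sq_nonneg _) (mem_univ μ))
  exact le_of_mul_le_mul_right h hpos

theorem upper_final (hd : 0 < d) (c : ℝ) (hc0 : 0 ≤ c) (x : PartLE (k+1) d → ℝ) (hx : ∀ μ, 0 < x μ)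
    (hM : ∀ μ, (MF (k+1) d).mulVec x μ ≤ c * x μ) :
    ∃ Ω : Matrix (Fin (k + 1 + 1) → Fin d) (Fin (k + 1 + 1) → Fin d) ℂ,
      Ω.IsHermitian ∧ (∀ a : Fin (k+1), (Ω - sigmaPBT d (k+1) a).PosSemidef) ∧
      (d : ℝ) ^ (k+1) * ‖Matrix.toEuclideanCLM (𝕜 := ℂ) (ptraceLast d (k+1) Ω)‖ ≤ c := by
  classical
  set S : PartLE k d → ℝ := (BB k d).mulVec x with hS
  have hxp : ∀ w ∈ W d (k+1), 0 < ex x (sh w) := by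
    intro w hw
    obtain ⟨μ, hμ⟩ := part_of hw
    rw [← hμ, ex_rs]; exact hx μ
  have hsumS : ∀ v ∈ W d k, (∑ i, if Valid (i :: v) then ex x (sh (i :: v)) else 0) = ex S (sh v) := by
    intro v hv
    obtain ⟨α, hα⟩ := part_of hv
    rw [sum_add α (mem_W.mp hv).1 hα.symm, ← hα, ex_rs]
    simp only [ex_rs]
    rfl
  have hcons : ∀ i v, v ∈ W d k → Valid (i :: v) → (i :: v) ∈ W d (k+1) := by
    intro i v hv hi
    exact mem_W.mpr ⟨hi, by simp [(mem_W.mp hv).2]⟩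
  have hSp : ∀ i v, v ∈ W d k → Valid (i :: v) → 0 < ex S (sh v) := by
    intro i v hv hi
    rw [← hsumS v hv]
    have h1 := hxp _ (hcons i v hv hi)
    refine lt_of_lt_of_le h1 ?_
    have h2 := Finset.single_le_sum (f := fun i => if Valid (i :: v) then ex x (sh (i :: v)) else 0)
      (s := univ) (fun j _ => ?_) (mem_univ i)
    · simp only [hi, if_true] at h2
      exact h2
    · show 0 ≤ ite _ _ _
      split_ifs with hj
      · exact (hxp _ (hcons j v hv hj)).le
      · exact le_rfl
  have hzero : ∀ v, v ∈ W d k → Valid (⟨0, hd⟩ :: v) := by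
    intro v hv
    have h1 := (mem_W.mp hv).1
    refine ⟨h1, ?_⟩
    intro i j hij
    rw [sh_cons, sh_cons]
    have h2 := h1.antitone hij
    have h3 : (⟨0, hd⟩ : Fin d) = j → (⟨0, hd⟩ : Fin d) = i := by
      rintro rfl
      apply Fin.ext
      have : (i : ℕ) ≤ 0 := hij
      simp; omega
    split_ifs with ha hb hb
    · omega
    · exact absurd (h3 ha) hb
    · omega
    · omega
  refine concrete_upper hd (fun w => ex S (sh w.tail) / ex x (sh w)) ?_ ?_ ?_ c hc0 ?_
  · intro w hw
    obtain ⟨i, v, rfl, hv, hi⟩ := exists_cons_of_mem hw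
    exact div_pos (hSp i v hv hi) (hxp _ hw)
  · intro i v hv hi
    have := (rep_spec (mem_W.mp hv).1).2
    simp only [List.tail_cons]
    rw [this, sh_cons_congr this]
  · intro v hv
    have hp := hSp _ v hv (hzero v hv)
    have : (∑ i, if Valid (i :: v) then (ex S (sh (i :: v).tail) / ex x (sh (i :: v)))⁻¹ else 0)
        = (∑ i, if Valid (i :: v) then ex x (sh (i :: v)) else 0) / ex S (sh v) := by
      rw [Finset.sum_div]
      apply Finset.sum_congr rfl
      intro i _
      split_ifs
      · rw [inv_div]; rfl
      · simp
    rw [this, hsumS v hv, div_self hp.ne']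
  · intro w hw
    obtain ⟨μ, hμ⟩ := part_of hw
    rw [sum_TS]
    have e : ∀ v ∈ V0 d k, (∑ i, if Valid (i :: v) then (if sh (i :: v) = sh w then
        ex S (sh (i :: v).tail) / ex x (sh (i :: v)) else 0) else 0) =
        ex (fun α => BB k d α μ * (S α / x μ)) (sh v) := by
      intro v hv
      have hv' := (mem_V0.mp hv).1
      obtain ⟨α, hα⟩ := part_of hv'
      have h1 := sum_add α (mem_W.mp hv').1 hα.symm (fun κ => if κ = sh w then ex S (sh v) / ex x κ else 0)
      rw [← hα, ex_rs, ← hμ] at h1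
      rw [← hα, ex_rs, ← hμ]
      refine (Eq.trans ?_ h1).trans ?_
      · simp only [List.tail_cons, ← hα, ex_rs]
      · rw [Finset.sum_eq_single μ]
        · rw [if_pos rfl, ex_rs]
        · intro ν _ hne
          rw [if_neg (fun h => hne (part_inj h)), mul_zero]
        · simp
    rw [Finset.sum_congr rfl e, ← sum_part]
    simp only [ex_rs]
    have e2 : ∑ α, BB k d α μ * (S α / x μ) = (MF (k+1) d).mulVec x μ / x μ := by
      rw [MF_eq, ← Matrix.mulVec_mulVec, ← hS]
      simp only [Matrix.mulVec, dotProduct, Matrix.transpose_apply]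
      rw [Finset.sum_div]
      exact Finset.sum_congr rfl (fun α _ => by ring)
    rw [e2, div_le_iff₀ (hx μ)]
    exact hM μ

theorem MF_herm : (MF (k+1) d).IsHermitian := by
  rw [MF_eq]
  exact Matrix.isHermitian_conjTranspose_mul_self (BB k d)

theorem MF_nonneg (μ ν) : 0 ≤ MF N d μ ν := by
  simp only [MF]; split_ifs <;> simp

theorem lam_nonneg (lam : ℝ) (x : PartLE (k+1) d → ℝ) (hx : x ≠ 0)
    (hl : (MF (k+1) d).mulVec x = lam • x) : 0 ≤ lam := by
  have h1 : 0 ≤ lam * ∑ μ, x μ ^ 2 := by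
    have : (BB k d).mulVec x ⬝ᵥ (BB k d).mulVec x = lam * ∑ μ, x μ ^ 2 := by
      calc _ = x ⬝ᵥ (MF (k+1) d).mulVec x := by
            rw [MF_eq, ← Matrix.mulVec_mulVec, Matrix.dotProduct_mulVec x, Matrix.vecMul_transpose]
        _ = _ := by
            rw [hl, dotProduct_smul, smul_eq_mul]
            simp only [dotProduct, sq]
    rw [← this]
    exact Finset.sum_nonneg (fun _ _ => mul_self_nonneg _)
  have hpos : 0 < ∑ μ, x μ ^ 2 := by
    obtain ⟨μ, hμ⟩ := Function.ne_iff.mp hx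
    have hμ' : 0 < x μ ^ 2 := by
      have : x μ ≠ 0 := hμ
      positivity
    exact lt_of_lt_of_le hμ' (Finset.single_le_sum (f := fun μ => x μ ^ 2) (fun _ _ => sq_nonneg _) (mem_univ μ))
  exact nonneg_of_mul_nonneg_left h1 hpos
end PBT

end PartG3

/-- Fix `d ≥ 2` and `N ≥ 1`.  The infimum of `d^{N-2}·‖Tr_n Ω‖` over all Hermitian `Ω` with
`Ω - σ_a` positive semidefinite for every `a ∈ {1,…,N}`, where `‖·‖` is the operator (spectral)
norm, equals `(1/d²)·λ_max(M_F^d(N))`, the largest eigenvalue of the Teleportation Matrix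
restricted to partitions of `N` with at most `d` parts, divided by `d²`. -/
theorem pbt_optimal_fidelity_dual (d N : ℕ) (hd : 2 ≤ d) (hN : 1 ≤ N) (lam : ℝ)
    (hlam : IsGreatest
      {x : ℝ | ∃ v : PartLE N d → ℝ, v ≠ 0 ∧ (MF N d).mulVec v = x • v} lam) :
    sInf {r : ℝ |
        ∃ Ω : Matrix (Fin (N + 1) → Fin d) (Fin (N + 1) → Fin d) ℂ,
          Ω.IsHermitian ∧ (∀ a : Fin N, (Ω - sigmaPBT d N a).PosSemidef) ∧
          r = (d : ℝ) ^ ((N : ℤ) - 2) *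
            ‖Matrix.toEuclideanCLM (𝕜 := ℂ) (ptraceLast d N Ω)‖}
      = (1 / (d : ℝ) ^ 2) * lam := by
  classical
  obtain ⟨k, rfl⟩ : ∃ k, N = k + 1 := ⟨N - 1, by omega⟩
  have hd0 : 0 < d := by omega
  have hdR : (0:ℝ) < d := by exact_mod_cast hd0
  obtain ⟨⟨x, hx, hlx⟩, hmax⟩ := hlam
  have hl0 := PBT.lam_nonneg lam x hx hlx
  have hfac : ∀ y : ℝ, (d : ℝ) ^ (((k+1 : ℕ) : ℤ) - 2) * y = (1 / (d : ℝ) ^ 2) * ((d : ℝ) ^ (k+1) * y) := by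
    intro y
    rw [zpow_sub₀ hdR.ne', zpow_natCast]
    have : (d : ℝ) ^ (2 : ℤ) = (d : ℝ) ^ 2 := by norm_cast
    rw [this]; ring
  have hup : ∀ ε : ℝ, 0 < ε → ∃ r ∈ {r : ℝ |
        ∃ Ω : Matrix (Fin (k + 1 + 1) → Fin d) (Fin (k + 1 + 1) → Fin d) ℂ,
          Ω.IsHermitian ∧ (∀ a : Fin (k + 1), (Ω - sigmaPBT d (k + 1) a).PosSemidef) ∧
          r = (d : ℝ) ^ (((k + 1 : ℕ) : ℤ) - 2) *
            ‖Matrix.toEuclideanCLM (𝕜 := ℂ) (ptraceLast d (k + 1) Ω)‖}, r ≤ (1 / (d : ℝ) ^ 2) * (lam + ε) := by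
    intro ε hε
    obtain ⟨v, hv1, hv2⟩ := PBT.perron (MF (k+1) d) PBT.MF_herm PBT.MF_nonneg lam (lam + ε)
      (fun y hy => hmax hy) (by linarith) (by linarith)
    obtain ⟨Ω, h1, h2, h3⟩ := PBT.upper_final hd0 (lam + ε) (by linarith) v hv1 hv2
    refine ⟨_, ⟨Ω, h1, h2, rfl⟩, ?_⟩
    rw [hfac]
    exact mul_le_mul_of_nonneg_left h3 (by positivity)
  have hlow : ∀ r ∈ {r : ℝ |
        ∃ Ω : Matrix (Fin (k + 1 + 1) → Fin d) (Fin (k + 1 + 1) → Fin d) ℂ,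
          Ω.IsHermitian ∧ (∀ a : Fin (k + 1), (Ω - sigmaPBT d (k + 1) a).PosSemidef) ∧
          r = (d : ℝ) ^ (((k + 1 : ℕ) : ℤ) - 2) *
            ‖Matrix.toEuclideanCLM (𝕜 := ℂ) (ptraceLast d (k + 1) Ω)‖}, (1 / (d : ℝ) ^ 2) * lam ≤ r := by
    rintro r ⟨Ω, h1, h2, rfl⟩
    rw [hfac]
    exact mul_le_mul_of_nonneg_left (PBT.lower_final hd0 Ω h1 h2 lam x hx hlx) (by positivity)
  apply le_antisymm
  · apply le_of_forall_pos_le_add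
    intro ε hε
    obtain ⟨r, hr, hr2⟩ := hup ((d:ℝ)^2 * ε) (by positivity)
    refine (csInf_le ⟨_, hlow⟩ hr).trans (hr2.trans (le_of_eq ?_))
    field_simp
  · obtain ⟨r, hr, -⟩ := hup 1 one_pos
    exact le_csInf ⟨r, hr⟩ hlow
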